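/- Fix η∈(0,1/4] and u₀<∞. There exists C<∞ depending only on η and u₀ such that for all u∈(0,u₀], N ≥ C·u^{−1/ν} and x∈G: exp(−(C₆/(1−η))·F_ν(N·u^{1/ν})) ≤ E_x[exp(−u·cap(X̄_{B(x,N)}))]; moreover E_x[exp(−u·cap(X̄_{B(x,N)}))] ≤ exp(−(c₆/(1+η))·F_ν(N·u^{1/ν})·max(1,log(1/u))^{−1{α=2ν}}) if α≥2ν, and ≤ exp(−c₆·N·u^{(1−α+2ν)/ν}) if α<2ν. Here C₆=C_β and c₆=c_β if ν≤1, while C₆=C₆(u₀)<∞ and c₆=c₆(u₀)>0 if ν>1. (Equivalently, E_x[exp(−u·cap(X̄_{B(x,N)}))] equals the probability that a random interlacement set at level u, independent of the walk, does not intersect X̄_{B(x,N)}.) -/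

import Mathlib

open MeasureTheory Set Filter
open scoped ENNReal Topology Classical

noncomputable section

namespace Paper

variable {V : Type}

/-- Total weight at a vertex: `λ_x = ∑_y λ_{x,y}`. -/
def lamTot (lam : V → V → ℝ) (x : V) : ℝ := ∑' y, lam x y

/-- Closed ball for the distance `dd`. -/
def vball (dd : V → V → ℝ) (x : V) (r : ℝ) : Set V := {y | dd x y ≤ r}

/-- Trajectories that never return to `A` after time `0`, i.e. `H̃_A = ∞`. -/
def avoidSet (A : Set V) : Set (ℕ → V) := {ω | ∀ k, 1 ≤ k → ω k ∉ A}

variable [MeasurableSpace V]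

/-- Equilibrium measure `e_A(x) = λ_x P_x(H̃_A = ∞) 1{x ∈ A}`. -/
def equi (lam : V → V → ℝ) (P : V → Measure (ℕ → V)) (A : Set V) (x : V) : ℝ :=
  if x ∈ A then lamTot lam x * (P x (avoidSet A)).toReal else 0

/-- Capacity `cap(A) = ∑_{x ∈ A} e_A(x)`. -/
def capa (lam : V → V → ℝ) (P : V → Measure (ℕ → V)) (A : Set V) : ℝ :=
  ∑' x : A, equi lam P A x

/-- Green function `g(x,y) = λ_y⁻¹ E_x[∑_k 1{X_k = y}]`. -/
def green (lam : V → V → ℝ) (P : V → Measure (ℕ → V)) (x y : V) : ℝ :=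
  (lamTot lam y)⁻¹ * ∑' k : ℕ, (P x {ω | ω k = y}).toReal

/-- The standing assumptions on the weighted graph `(G,λ)` with distance `dd`,
random-walk law `P`, volume exponent `α`, Green exponent `ν` and asymptotic
Green constants `c₃ ≤ C₃`. -/
structure Standing (lam dd : V → V → ℝ) (P : V → Measure (ℕ → V))
    (α ν c₃ C₃ : ℝ) : Prop where
  countable : Countable V
  lam_symm : ∀ x y, lam x y = lam y x
  lam_nonneg : ∀ x y, 0 ≤ lam x y
  lam_diag : ∀ x, lam x x = 0
  locFin : ∀ x, {y | 0 < lam x y}.Finite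
  dd_self : ∀ x, dd x x = 0
  dd_pos : ∀ x y, x ≠ y → 0 < dd x y
  dd_symm : ∀ x y, dd x y = dd y x
  dd_triangle : ∀ x y z, dd x z ≤ dd x y + dd y z
  prob : ∀ x, IsProbabilityMeasure (P x)
  start : ∀ x, P x {ω | ω 0 = x} = 1
  step : ∀ x y, P x {ω | ω 1 = y} = ENNReal.ofReal (lam x y / lamTot lam x)
  markov : ∀ (x y : V) (k : ℕ) (S : Set (ℕ → V)), MeasurableSet S →
    P x ({ω | ω k = y} ∩ {ω | (fun n => ω (k + n)) ∈ S}) = P x {ω | ω k = y} * P y S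
  nu_pos : 0 < ν
  nu_le : ν ≤ α - 2
  vol : ∃ c₁ C₁ : ℝ, 0 < c₁ ∧ c₁ ≤ C₁ ∧ ∀ (x : V) (r : ℝ), 1 ≤ r →
    c₁ * r ^ α ≤ ∑' y : vball dd x r, lamTot lam y ∧
      ∑' y : vball dd x r, lamTot lam y ≤ C₁ * r ^ α
  greenBounds : ∃ c₂ C₂ : ℝ, 0 < c₂ ∧ c₂ ≤ C₂ ∧
    (∀ x, c₂ ≤ green lam P x x ∧ green lam P x x ≤ C₂) ∧
    ∀ x y, x ≠ y → c₂ * dd x y ^ (-ν) ≤ green lam P x y ∧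
      green lam P x y ≤ C₂ * dd x y ^ (-ν)
  c₃_pos : 0 < c₃
  c₃_le_C₃ : c₃ ≤ C₃
  greenAsymp : ∀ η' : ℝ, 0 < η' → ∃ M : ℝ, ∀ x y, M ≤ dd x y →
    (1 - η') * c₃ ≤ green lam P x y * dd x y ^ ν ∧
      green lam P x y * dd x y ^ ν ≤ (1 + η') * C₃
  p0 : ∃ c : ℝ, 0 < c ∧ ∀ x y, 0 < lam x y → c ≤ lam x y / lamTot lam x

/-- The geodesic assumption: from every point there is an infinite
nearest-neighbour path along which `dd` is comparable to the index difference. -/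
def Geodesic (lam dd : V → V → ℝ) (c₄ C₄ : ℝ) : Prop :=
  ∀ x : V, ∃ γ : ℕ → V, γ 0 = x ∧ (∀ k : ℕ, 0 < lam (γ k) (γ (k + 1))) ∧
    ∀ k p : ℕ, c₄ * |(k : ℝ) - (p : ℝ)| - C₄ ≤ dd (γ k) (γ p) ∧
      dd (γ k) (γ p) ≤ c₄ * |(k : ℝ) - (p : ℝ)| + C₄

/-- The function `F_ν(x,y)`. -/
def Fnu (ν x y : ℝ) : ℝ :=
  if ν < 1 then x ^ ν
  else if ν = 1 then x / max 1 (Real.log (x / y))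
  else x * y ^ (ν - 1)

/-- `F_ν(x) = F_ν(x,1)`. -/
def Fnu1 (ν x : ℝ) : ℝ := Fnu ν x 1

/-- The constant `π⁻¹ B((1+ν)/2,(1+ν)/2) cos(πν/2)` for `ν < 1` and `1/2` for `ν = 1`
(the Beta function expressed through `Γ`). -/
def kappaNu (ν : ℝ) : ℝ :=
  if ν < 1 then
    Real.Gamma ((1 + ν) / 2) * Real.Gamma ((1 + ν) / 2) / Real.Gamma (1 + ν)
      * Real.cos (Real.pi * ν / 2) / Real.pi
  else 1 / 2

/-- `c_β`, defined by `c_β · C₃ = kappaNu ν`. -/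
def cBeta (ν C₃ : ℝ) : ℝ := kappaNu ν / C₃

/-- `C_β`, defined by `C_β · c₃ = kappaNu ν`. -/
def CBeta (ν c₃ : ℝ) : ℝ := kappaNu ν / c₃

/-- `a` and `b` are joined by a nearest-neighbour path inside `S`. -/
def connIn (lam : V → V → ℝ) (S : Set V) (a b : V) : Prop :=
  ∃ (m : ℕ) (γ : ℕ → V), γ 0 = a ∧ γ m = b ∧ (∀ i ≤ m, γ i ∈ S) ∧
    ∀ i < m, 0 < lam (γ i) (γ (i + 1))

/-- The set `X̄_A` of points visited by a trajectory strictly before exiting `A`. -/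
def visited (A : Set V) (ω : ℕ → V) : Set V :=
  {v | ∃ k : ℕ, (∀ n ≤ k, ω n ∈ A) ∧ ω k = v}

set_option linter.unusedSectionVars false

variable {lam dd : V → V → ℝ} {P : V → Measure (ℕ → V)} {α ν c₃ C₃ : ℝ}

/-- Prepend `x` to the path `ω`. -/
def pcons (x : V) (ω : ℕ → V) : ℕ → V := fun n => Nat.casesOn n x ω

/-- The time shift by `k`. -/
def pshift (k : ℕ) (ω : ℕ → V) : ℕ → V := fun n => ω (k + n)

@[simp] lemma pshift_apply (k : ℕ) (ω : ℕ → V) (n : ℕ) : pshift k ω n = ω (k + n) := rfl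

lemma measurable_pcons (x : V) : Measurable (pcons x) := by
  refine measurable_pi_lambda _ fun n => ?_
  cases n with
  | zero => exact measurable_const
  | succ n => exact measurable_pi_apply n

lemma measurable_pshift (k : ℕ) : Measurable (pshift (V := V) k) :=
  measurable_pi_lambda _ fun n => measurable_pi_apply (k + n)

namespace Standing

lemma lamTot_pos (h : Standing lam dd P α ν c₃ C₃) (x : V) : 0 < lamTot lam x := by
  have h0 : 0 ≤ lamTot lam x := tsum_nonneg fun y => h.lam_nonneg x y
  obtain ⟨c₂, C₂, hc, -, hg, -⟩ := h.greenBounds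
  rcases h0.lt_or_eq with h1 | h1
  · exact h1
  · have := (hg x).1
    rw [green, ← h1] at this
    simp at this
    linarith

lemma hasSum_lam (h : Standing lam dd P α ν c₃ C₃) (x : V) :
    HasSum (fun y => lam x y) (lamTot lam x) := by
  refine Summable.hasSum ?_
  refine summable_of_hasFiniteSupport ((h.locFin x).subset ?_)
  intro y hy
  exact lt_of_le_of_ne (h.lam_nonneg x y) (Ne.symm hy)

lemma hasSum_step (h : Standing lam dd P α ν c₃ C₃) (x : V) :
    HasSum (fun y => lam x y / lamTot lam x) 1 := by
  have := (h.hasSum_lam x).div_const (lamTot lam x)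
  rwa [div_self (h.lamTot_pos x).ne'] at this

lemma exists_nbr (h : Standing lam dd P α ν c₃ C₃) (x : V) : ∃ y, 0 < lam x y := by
  by_contra! hc
  have : lamTot lam x = 0 := by
    rw [lamTot]
    have : ∀ y, lam x y = 0 := fun y => le_antisymm (hc y) (h.lam_nonneg x y)
    simp [this]
  exact (h.lamTot_pos x).ne' this

end Standing

/-- A measurable set of paths is a union of cylinders over the atoms of the state space. -/
lemma update_mem_of_measurableSet {S : Set (ℕ → V)} (hS : MeasurableSet S) {ω : ℕ → V}
    (k : ℕ) {y : V} (hy : y ∈ measurableAtom (ω k)) (hω : Function.update ω k y ∈ S) :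
    ω ∈ S := by
  have hm : Measurable fun z => Function.update ω k z := measurable_update ω
  have h1 : MeasurableSet {z | Function.update ω k z ∈ S} := hm hS
  by_contra hc
  have h2 : ω k ∈ {z | Function.update ω k z ∈ S}ᶜ := by simpa using hc
  exact (mem_of_mem_measurableAtom hy h1.compl h2) hω

lemma measure_eval_eq_measurableAtom [Countable V] (μ : Measure (ℕ → V)) (k : ℕ) (y : V) :
    μ {ω | ω k = y} = μ {ω | ω k ∈ measurableAtom y} := by
  refine le_antisymm (measure_mono fun ω hω => ?_) ?_
  · rw [mem_ofPred_eq] at hω ⊢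
    rw [hω]
    exact mem_measurableAtom_self y
  · rw [← measure_toMeasurable {ω : ℕ → V | ω k = y}]
    refine measure_mono fun ω hω => ?_
    have hy : y ∈ measurableAtom (ω k) := by
      rw [measurableAtom_eq_of_mem hω]; exact mem_measurableAtom_self y
    refine update_mem_of_measurableSet (measurableSet_toMeasurable _ _) k hy ?_
    exact subset_toMeasurable _ _ (by simp)

lemma Standing.measurableSingletonClass (h : Standing lam dd P α ν c₃ C₃) :
    MeasurableSingletonClass V := by
  have := h.countable
  refine ⟨fun y => ?_⟩
  have hat : measurableAtom y = {y} := by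
    by_contra hne
    obtain ⟨z, hz, hzy⟩ : ∃ z ∈ measurableAtom y, z ≠ y := by
      by_contra! hc
      exact hne (Subset.antisymm hc (singleton_subset_iff.2 (mem_measurableAtom_self y)))
    obtain ⟨x, hx⟩ := h.exists_nbr y
    have := h.prob x
    have hstep : ∀ w, P x {ω | ω 1 ∈ measurableAtom w} =
        ENNReal.ofReal (lam x w / lamTot lam x) := fun w => by
      rw [← measure_eval_eq_measurableAtom, h.step]
    have hxy : 0 < lam x y := by rw [h.lam_symm]; exact hx
    have hzy' : lam x z = lam x y := by
      have h1 := hstep z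
      rw [measurableAtom_eq_of_mem hz, hstep y, ENNReal.ofReal_eq_ofReal_iff
        (div_nonneg (h.lam_nonneg _ _) (h.lamTot_pos _).le)
        (div_nonneg (h.lam_nonneg _ _) (h.lamTot_pos _).le)] at h1
      exact (div_left_inj' (h.lamTot_pos x).ne').1 h1.symm
    have hcov : (univ : Set (ℕ → V)) ⊆
        ⋃ w : V, if w = z then ∅ else {ω | ω 1 ∈ measurableAtom w} := by
      intro ω _
      by_cases hw : ω 1 = z
      · refine mem_iUnion.2 ⟨y, ?_⟩
        rw [if_neg hzy.symm]
        change ω 1 ∈ measurableAtom y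
        rwa [hw]
      · refine mem_iUnion.2 ⟨ω 1, ?_⟩
        rw [if_neg hw]
        exact mem_measurableAtom_self _
    have h1 : (1 : ℝ≥0∞) ≤ ∑' w : V, if w = z then 0 else
        ENNReal.ofReal (lam x w / lamTot lam x) := by
      calc (1 : ℝ≥0∞) = P x univ := measure_univ.symm
        _ ≤ _ := measure_mono hcov
        _ ≤ ∑' w : V, P x (if w = z then ∅ else {ω | ω 1 ∈ measurableAtom w}) :=
          measure_iUnion_le _
        _ = _ := by
          refine tsum_congr fun w => ?_
          split_ifs
          · exact measure_empty
          · exact hstep w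
    have hs := h.hasSum_step x
    have hnn : ∀ w, 0 ≤ lam x w / lamTot lam x := fun w =>
      div_nonneg (h.lam_nonneg _ _) (h.lamTot_pos _).le
    have h2 : ∑' w, ENNReal.ofReal (lam x w / lamTot lam x) = 1 := by
      rw [← ENNReal.ofReal_tsum_of_nonneg hnn hs.summable, hs.tsum_eq, ENNReal.ofReal_one]
    rw [ENNReal.tsum_eq_add_tsum_ite z] at h2
    have h3 : 0 < ENNReal.ofReal (lam x z / lamTot lam x) := by
      rw [ENNReal.ofReal_pos, hzy']; exact div_pos hxy (h.lamTot_pos x)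
    have h4 : ENNReal.ofReal (lam x z / lamTot lam x) + 1 ≤ 0 + 1 := by
      rw [zero_add]
      exact (add_le_add_right h1 _).trans h2.le
    exact absurd ((ENNReal.add_le_add_iff_right ENNReal.one_ne_top).1 h4) (not_le.2 h3)
  rw [← hat]
  exact MeasurableSet.measurableAtom_of_countable y

section Markov

variable [Countable V] [MeasurableSingletonClass V]

lemma measurable_of_dependsOn {β : Type*} [MeasurableSpace β] {F : (ℕ → V) → β} {n : ℕ}
    (hF : DependsOn F (Set.Iic n)) : Measurable F := by
  rcases isEmpty_or_nonempty V with hV | ⟨⟨v⟩⟩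
  · exact measurable_of_empty F
  have h1 : F = (fun a : Fin (n + 1) → V => F fun i => if hi : i < n + 1 then a ⟨i, hi⟩ else v) ∘
      fun ω (i : Fin (n + 1)) => ω i := by
    funext ω
    refine hF fun i hi => ?_
    simp [Nat.lt_succ_of_le (show i ≤ n from hi)]
  rw [h1]
  exact (measurable_of_countable _).comp (measurable_pi_lambda _ fun i => measurable_pi_apply _)

lemma measurableSet_eval (k : ℕ) (S : Set V) : MeasurableSet {ω : ℕ → V | ω k ∈ S} :=
  measurable_pi_apply k (Set.to_countable S).measurableSet

lemma measurableSet_eval_eq (k : ℕ) (y : V) : MeasurableSet {ω : ℕ → V | ω k = y} :=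
  measurableSet_eval k {y}

lemma Standing.ae_start (h : Standing lam dd P α ν c₃ C₃) (x : V) : ∀ᵐ ω ∂(P x), ω 0 = x := by
  have := h.prob x
  have := (prob_compl_eq_zero_iff (μ := P x) (measurableSet_eval_eq 0 x)).2 (h.start x)
  exact this

lemma Standing.map_pshift_restrict (h : Standing lam dd P α ν c₃ C₃) (x y : V) (k : ℕ) :
    ((P x).restrict {ω | ω k = y}).map (pshift k) = P x {ω | ω k = y} • P y := by
  ext S hS
  rw [Measure.map_apply (measurable_pshift k) hS,
    Measure.restrict_apply (measurable_pshift k hS), inter_comm]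
  rw [Measure.smul_apply, smul_eq_mul]
  exact h.markov x y k S hS

lemma lintegral_eq_tsum_eval (μ : Measure (ℕ → V)) (k : ℕ) (f : (ℕ → V) → ℝ≥0∞) :
    ∫⁻ ω, f ω ∂μ = ∑' y, ∫⁻ ω in {ω | ω k = y}, f ω ∂μ := by
  rw [← lintegral_iUnion (fun y => measurableSet_eval_eq k y)]
  · have : (⋃ y, {ω : ℕ → V | ω k = y}) = univ := by ext; simp
    rw [this, Measure.restrict_univ]
  · intro y z hyz
    refine Set.disjoint_left.2 fun ω h1 h2 => hyz ?_
    rw [← h1.out, ← h2.out]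

/-- The Markov property at a fixed time for functions of the future. -/
lemma Standing.lintegral_pshift (h : Standing lam dd P α ν c₃ C₃) (x y : V) (k : ℕ)
    {f : (ℕ → V) → ℝ≥0∞} (hf : Measurable f) :
    ∫⁻ ω in {ω | ω k = y}, f (pshift k ω) ∂(P x) = P x {ω | ω k = y} * ∫⁻ ω, f ω ∂(P y) := by
  rw [← lintegral_map hf (measurable_pshift k), h.map_pshift_restrict, lintegral_smul_measure,
    smul_eq_mul]

/-- First-step decomposition. -/
lemma Standing.lintegral_one_step (h : Standing lam dd P α ν c₃ C₃) (x : V)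
    {f : (ℕ → V) → ℝ≥0∞} (hf : Measurable f) :
    ∫⁻ ω, f ω ∂(P x) = ∑' y, P x {ω | ω 1 = y} * ∫⁻ ω, f (pcons x ω) ∂(P y) := by
  rw [lintegral_eq_tsum_eval _ 1]
  refine tsum_congr fun y => ?_
  rw [← h.lintegral_pshift x y 1 (f := fun ω => f (pcons x ω)) (hf.comp (measurable_pcons x))]
  refine lintegral_congr_ae (ae_restrict_of_ae ?_)
  filter_upwards [h.ae_start x] with ω hω
  congr 1
  funext n
  cases n with
  | zero => exact hω
  | succ n => simp [pcons, pshift, add_comm]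

/-- The simple Markov property at time `n`. -/
lemma Standing.markov_lintegral (h : Standing lam dd P α ν c₃ C₃) (n : ℕ) (x : V)
    {F φ : (ℕ → V) → ℝ≥0∞} (hF : DependsOn F (Set.Iic n)) (hφ : Measurable φ) :
    ∫⁻ ω, F ω * φ (pshift n ω) ∂(P x) = ∫⁻ ω, F ω * ∫⁻ ω', φ ω' ∂(P (ω n)) ∂(P x) := by
  have hG : ∀ n, Measurable fun ω : ℕ → V => ∫⁻ ω', φ ω' ∂(P (ω n)) := fun n =>
    (measurable_of_countable fun z => ∫⁻ ω', φ ω' ∂(P z)).comp (measurable_pi_apply n)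
  induction n generalizing x F with
  | zero =>
    have hc : ∀ᵐ ω ∂(P x), F ω = F fun _ => x := by
      filter_upwards [h.ae_start x] with ω hω
      refine hF fun i hi => ?_
      rw [Nat.le_zero.1 hi, hω]
    have e1 : ∫⁻ ω, F ω * φ (pshift 0 ω) ∂(P x) = ∫⁻ ω, (F fun _ => x) * φ ω ∂(P x) := by
      refine lintegral_congr_ae ?_
      filter_upwards [hc] with ω hω
      rw [hω]
      congr 2
      funext n; simp [pshift]
    have e2 : ∫⁻ ω, F ω * ∫⁻ ω', φ ω' ∂(P (ω 0)) ∂(P x) =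
        ∫⁻ ω, (F fun _ => x) * ∫⁻ ω', φ ω' ∂(P x) ∂(P x) := by
      refine lintegral_congr_ae ?_
      filter_upwards [hc, h.ae_start x] with ω hω h0
      rw [hω, h0]
    have := h.prob x
    rw [e1, e2, lintegral_const_mul _ hφ, lintegral_const, measure_univ, mul_one]
  | succ n ih =>
    have hFm := measurable_of_dependsOn hF
    rw [h.lintegral_one_step x (f := fun ω => F ω * φ (pshift (n + 1) ω))
      (hFm.mul (hφ.comp (measurable_pshift _))),
      h.lintegral_one_step x (f := fun ω => F ω * ∫⁻ ω', φ ω' ∂(P (ω (n + 1))))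
      (hFm.mul (hG (n + 1)))]
    refine tsum_congr fun y => ?_
    congr 1
    have hF' : DependsOn (fun ω => F (pcons x ω)) (Set.Iic n) := by
      intro ω ω' hω
      refine hF fun i hi => ?_
      cases i with
      | zero => rfl
      | succ i => exact hω i (Nat.le_of_succ_le_succ hi)
    have := ih y hF'
    have hsh : ∀ ω : ℕ → V, pshift (n + 1) (pcons x ω) = pshift n ω := fun ω => by
      funext m
      simp only [pshift, pcons]
      rw [show n + 1 + m = (n + m) + 1 by ring]
    simp only [hsh]
    exact this

end Markov

section Potential

variable {lam dd : V → V → ℝ} {P : V → Measure (ℕ → V)} {α ν c₃ C₃ : ℝ}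
variable [Countable V] [MeasurableSingletonClass V]

namespace Standing

lemma green_pos (h : Standing lam dd P α ν c₃ C₃) (x y : V) : 0 < green lam P x y := by
  obtain ⟨c₂, C₂, hc, -, hg, hg'⟩ := h.greenBounds
  by_cases hxy : x = y
  · rw [hxy]; exact hc.trans_le (hg y).1
  · exact (mul_pos hc (Real.rpow_pos_of_pos (h.dd_pos x y hxy) _)).trans_le (hg' x y hxy).1

lemma tsum_visits (h : Standing lam dd P α ν c₃ C₃) (x y : V) :
    ∑' k, P x {ω | ω k = y} = ENNReal.ofReal (green lam P x y * lamTot lam y) := by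
  have := h.prob x
  have hs : Summable fun k => (P x {ω | ω k = y}).toReal := by
    by_contra hc
    have := h.green_pos x y
    rw [green, tsum_eq_zero_of_not_summable hc] at this
    simp at this
  have hne : ∀ k, P x {ω | ω k = y} ≠ ∞ := fun k => measure_ne_top _ _
  rw [green, mul_comm, ← mul_assoc, mul_inv_cancel₀ (h.lamTot_pos y).ne', one_mul,
    ENNReal.ofReal_tsum_of_nonneg (fun k => ENNReal.toReal_nonneg) hs]
  exact tsum_congr fun k => (ENNReal.ofReal_toReal (hne k)).symm

lemma lintegral_visits (h : Standing lam dd P α ν c₃ C₃) (x : V) (f : V → ℝ≥0∞) :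
    ∫⁻ ω, ∑' k, f (ω k) ∂(P x) =
      ∑' y, ENNReal.ofReal (green lam P x y * lamTot lam y) * f y := by
  have hf : ∀ k, Measurable fun ω : ℕ → V => f (ω k) := fun k =>
    (measurable_of_countable f).comp (measurable_pi_apply k)
  rw [lintegral_tsum fun k => (hf k).aemeasurable]
  have h1 : ∀ k, ∫⁻ ω, f (ω k) ∂(P x) = ∑' y, P x {ω | ω k = y} * f y := fun k => by
    rw [lintegral_eq_tsum_eval _ k]
    refine tsum_congr fun y => ?_
    rw [setLIntegral_congr_fun (g := fun _ => f y) (measurableSet_eval_eq k y)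
      (fun ω hω => by rw [show ω k = y from hω]), setLIntegral_const, mul_comm]
  simp_rw [h1]
  rw [ENNReal.tsum_comm]
  simp_rw [ENNReal.tsum_mul_right, h.tsum_visits]

lemma measure_eval_succ (h : Standing lam dd P α ν c₃ C₃) (x y : V) (k : ℕ) :
    P x {ω | ω (k + 1) = y} = ∑' z, P x {ω | ω k = z} * P z {ω | ω 1 = y} := by
  rw [← lintegral_indicator_one (measurableSet_eval_eq _ _), lintegral_eq_tsum_eval _ k]
  refine tsum_congr fun z => ?_
  rw [← lintegral_indicator_one (μ := P z) (measurableSet_eval_eq 1 y),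
    ← h.lintegral_pshift x z k (measurable_one.indicator (measurableSet_eval_eq 1 y))]
  rfl

lemma measure_eval_succ' (h : Standing lam dd P α ν c₃ C₃) (x y : V) (k : ℕ) :
    P x {ω | ω (k + 1) = y} = ∑' z, P x {ω | ω 1 = z} * P z {ω | ω k = y} := by
  rw [add_comm k 1, ← lintegral_indicator_one (measurableSet_eval_eq _ _),
    lintegral_eq_tsum_eval _ 1]
  refine tsum_congr fun z => ?_
  rw [← lintegral_indicator_one (μ := P z) (measurableSet_eval_eq k y),
    ← h.lintegral_pshift x z 1 (measurable_one.indicator (measurableSet_eval_eq k y))]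
  rfl

lemma measure_eval_symm (h : Standing lam dd P α ν c₃ C₃) (x y : V) (k : ℕ) :
    ENNReal.ofReal (lamTot lam x) * P x {ω | ω k = y} =
      ENNReal.ofReal (lamTot lam y) * P y {ω | ω k = x} := by
  have h1 : ∀ x y, ENNReal.ofReal (lamTot lam x) * P x {ω | ω 1 = y} =
      ENNReal.ofReal (lam x y) := fun x y => by
    rw [h.step, ← ENNReal.ofReal_mul (h.lamTot_pos x).le, mul_div_cancel₀ _ (h.lamTot_pos x).ne']
  induction k generalizing x y with
  | zero =>
    by_cases hxy : x = y
    · rw [hxy]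
    · have h0 : ∀ x y, x ≠ y → P x {ω | ω 0 = y} = 0 := fun x y hxy => by
        refine measure_mono_null (t := {ω | ω 0 = x}ᶜ) (fun ω hω hc => hxy ?_) (h.ae_start x)
        rw [← hω.out, ← hc.out]
      rw [h0 x y hxy, h0 y x (Ne.symm hxy)]
      simp
  | succ k ih =>
    rw [h.measure_eval_succ' x y k, h.measure_eval_succ y x k, ← ENNReal.tsum_mul_left,
      ← ENNReal.tsum_mul_left]
    refine tsum_congr fun z => ?_
    rw [← mul_assoc, h1, ← mul_assoc, ← ih z y, mul_right_comm, h1, h.lam_symm]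

lemma green_symm (h : Standing lam dd P α ν c₃ C₃) (x y : V) :
    green lam P x y = green lam P y x := by
  have h1 : ENNReal.ofReal (lamTot lam x) * ∑' k, P x {ω | ω k = y} =
      ENNReal.ofReal (lamTot lam y) * ∑' k, P y {ω | ω k = x} := by
    rw [← ENNReal.tsum_mul_left, ← ENNReal.tsum_mul_left]
    exact tsum_congr fun k => h.measure_eval_symm x y k
  have hx := h.lamTot_pos x
  have hy := h.lamTot_pos y
  have g1 := h.green_pos x y
  have g2 := h.green_pos y x
  rw [h.tsum_visits, h.tsum_visits, ← ENNReal.ofReal_mul hx.le, ← ENNReal.ofReal_mul hy.le,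
    ENNReal.ofReal_eq_ofReal_iff (by positivity) (by positivity)] at h1
  have h2 : (green lam P x y - green lam P y x) * (lamTot lam x * lamTot lam y) = 0 := by linarith
  rcases mul_eq_zero.1 h2 with h3 | h3
  · linarith
  · exact absurd h3 (mul_pos hx hy).ne'

lemma ae_eventually_ne (h : Standing lam dd P α ν c₃ C₃) (x : V) :
    ∀ᵐ ω ∂(P x), ∀ y, ∀ᶠ k in atTop, ω k ≠ y := by
  rw [ae_all_iff]
  intro y
  exact ae_eventually_notMem (s := fun k => {ω : ℕ → V | ω k = y})
    (by rw [h.tsum_visits]; exact ENNReal.ofReal_ne_top)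

lemma ae_eventually_notMem_finite (h : Standing lam dd P α ν c₃ C₃) (x : V) {A : Set V}
    (hA : A.Finite) : ∀ᵐ ω ∂(P x), ∀ᶠ k in atTop, ω k ∉ A := by
  filter_upwards [h.ae_eventually_ne x] with ω hω
  have : ∀ᶠ k in atTop, ∀ y ∈ A, ω k ≠ y := (eventually_all_finite hA).2 fun y _ => hω y
  filter_upwards [this] with k hk hkA
  exact hk _ hkA rfl

end Standing

/-- The event that the path visits `A`. -/
def hitSet (A : Set V) : Set (ℕ → V) := {ω | ∃ k, ω k ∈ A}

lemma measurableSet_hitSet (A : Set V) : MeasurableSet (hitSet A) := by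
  have : hitSet A = ⋃ k, {ω : ℕ → V | ω k ∈ A} := by ext; simp [hitSet]
  rw [this]
  exact MeasurableSet.iUnion fun k => measurableSet_eval k A

lemma measurableSet_avoidSet (A : Set V) : MeasurableSet (avoidSet A) := by
  have : avoidSet A = ⋂ k : ℕ, {ω : ℕ → V | 1 ≤ k → ω k ∉ A} := by ext; simp [avoidSet]
  rw [this]
  refine MeasurableSet.iInter fun k => ?_
  by_cases hk : 1 ≤ k
  · simpa [hk] using measurableSet_eval k Aᶜ
  · simp [hk]

/-- Last-exit decomposition: the potential of the equilibrium measure is the hitting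
probability. -/
lemma Standing.sum_green_equi (h : Standing lam dd P α ν c₃ C₃) {A : Set V} (hA : A.Finite)
    (x : V) :
    ∑ y ∈ hA.toFinset, green lam P x y * equi lam P A y = (P x (hitSet A)).toReal := by
  have := h.prob x
  have h1 : P x (hitSet A) =
      P x (⋃ p : ℕ × A, {ω | ω p.1 = p.2} ∩ {ω | (fun n => ω (p.1 + n)) ∈ avoidSet A}) := by
    refine measure_congr ?_
    filter_upwards [h.ae_eventually_notMem_finite x hA] with ω hω
    refine propext ⟨fun ⟨k, hk⟩ => ?_, fun hmem => ?_⟩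
    · obtain ⟨K, hK⟩ := eventually_atTop.1 hω
      have hex : ∃ m, ω m ∈ A ∧ ∀ n, m < n → ω n ∉ A := by
        by_contra! hc
        have : ∀ j, ∃ m, j ≤ m ∧ ω m ∈ A := fun j => by
          induction j with
          | zero => exact ⟨k, Nat.zero_le _, hk⟩
          | succ j ih =>
            obtain ⟨m, hm, hmA⟩ := ih
            obtain ⟨n, hn, hnA⟩ := hc m hmA
            exact ⟨n, by omega, hnA⟩
        obtain ⟨m, hm, hmA⟩ := this K
        exact hK m hm hmA
      obtain ⟨m, hm, hmax⟩ := hex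
      refine mem_iUnion.2 ⟨(m, ⟨ω m, hm⟩), rfl, fun n hn => hmax _ ?_⟩
      omega
    · obtain ⟨⟨m, y⟩, hm, -⟩ := mem_iUnion.1 hmem
      exact ⟨m, by rw [show ω m = y from hm]; exact y.2⟩
  have hdisj : Pairwise (Function.onFun Disjoint fun p : ℕ × A =>
      {ω : ℕ → V | ω p.1 = p.2} ∩ {ω | (fun n => ω (p.1 + n)) ∈ avoidSet A}) := by
    rintro ⟨k, y⟩ ⟨m, z⟩ hne
    refine Set.disjoint_left.2 fun ω h1 h2 => hne ?_
    obtain ⟨a1, b1⟩ := h1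
    obtain ⟨a2, b2⟩ := h2
    have a1' : ω k = y := a1
    have a2' : ω m = z := a2
    have b1' : ∀ n, 1 ≤ n → ω (k + n) ∉ A := b1
    have b2' : ∀ n, 1 ≤ n → ω (m + n) ∉ A := b2
    have hkm : k = m := by
      rcases lt_trichotomy k m with hl | hl | hl
      · have := b1' (m - k) (by omega)
        rw [show k + (m - k) = m by omega, a2'] at this
        exact absurd z.2 this
      · exact hl
      · have := b2' (k - m) (by omega)
        rw [show m + (k - m) = k by omega, a1'] at this
        exact absurd y.2 this
    subst hkm
    rw [Prod.mk.injEq]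
    exact ⟨rfl, Subtype.ext (a1'.symm.trans a2')⟩
  rw [measure_iUnion hdisj (fun p => (measurableSet_eval_eq _ _).inter
    (measurable_pshift p.1 (measurableSet_avoidSet A)))] at h1
  simp_rw [h.markov _ _ _ _ (measurableSet_avoidSet A)] at h1
  rw [ENNReal.tsum_prod', ENNReal.tsum_comm] at h1
  simp_rw [ENNReal.tsum_mul_right, h.tsum_visits] at h1
  have := hA.fintype
  rw [tsum_fintype] at h1
  rw [h1, ENNReal.toReal_sum (fun y _ => by
    have := h.prob y.1
    exact ENNReal.mul_ne_top ENNReal.ofReal_ne_top (measure_ne_top _ _))]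
  rw [← Finset.sum_coe_sort hA.toFinset]
  refine Fintype.sum_equiv (Equiv.subtypeEquivRight fun y => by simp) _ _ fun y => ?_
  have hy : y.1 ∈ A := by simpa using y.2
  have g1 := h.green_pos x y
  have l1 := h.lamTot_pos y.1
  simp only [Equiv.subtypeEquivRight_apply_coe, ENNReal.toReal_mul, equi, if_pos hy]
  rw [ENNReal.toReal_ofReal (by positivity)]
  ring

lemma Standing.sum_green_equi_le_one (h : Standing lam dd P α ν c₃ C₃) {A : Set V}
    (hA : A.Finite) (x : V) :
    ∑ y ∈ hA.toFinset, green lam P x y * equi lam P A y ≤ 1 := by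
  have := h.prob x
  rw [h.sum_green_equi hA]
  exact ENNReal.toReal_le_of_le_ofReal zero_le_one (by simpa using prob_le_one)

lemma Standing.sum_green_equi_eq_one (h : Standing lam dd P α ν c₃ C₃) {A : Set V}
    (hA : A.Finite) {x : V} (hx : x ∈ A) :
    ∑ y ∈ hA.toFinset, green lam P x y * equi lam P A y = 1 := by
  have := h.prob x
  rw [h.sum_green_equi hA]
  have : P x (hitSet A) = 1 := by
    refine le_antisymm prob_le_one ?_
    rw [← h.start x]
    exact measure_mono fun ω hω => ⟨0, by rw [show ω 0 = x from hω]; exact hx⟩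
  rw [this, ENNReal.toReal_one]

lemma Standing.equi_nonneg (h : Standing lam dd P α ν c₃ C₃) (A : Set V) (x : V) :
    0 ≤ equi lam P A x := by
  rw [equi]
  split_ifs
  · exact mul_nonneg (h.lamTot_pos x).le ENNReal.toReal_nonneg
  · exact le_rfl

lemma capa_eq_sum {A : Set V} (hA : A.Finite) :
    capa lam P A = ∑ y ∈ hA.toFinset, equi lam P A y := by
  have := hA.fintype
  rw [capa, tsum_fintype, ← Finset.sum_coe_sort hA.toFinset]
  exact (Fintype.sum_equiv (Equiv.subtypeEquivRight (p := fun y => y ∈ hA.toFinset)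
    (q := fun y => y ∈ A) fun y => hA.mem_toFinset) _ _ fun y => rfl).symm

lemma Standing.capa_nonneg (h : Standing lam dd P α ν c₃ C₃) (A : Set V) :
    0 ≤ capa lam P A := tsum_nonneg fun x => h.equi_nonneg A x

/-- Upper bound on the capacity from a measure with potential at least one on the set. -/
lemma Standing.capa_le_sum (h : Standing lam dd P α ν c₃ C₃) {A : Set V} (hA : A.Finite)
    {ι : Type*} (s : Finset ι) (w : ι → ℝ) (y : ι → V) (hw : ∀ i ∈ s, 0 ≤ w i)
    (hpot : ∀ z ∈ A, 1 ≤ ∑ i ∈ s, w i * green lam P z (y i)) :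
    capa lam P A ≤ ∑ i ∈ s, w i := by
  calc capa lam P A = ∑ z ∈ hA.toFinset, equi lam P A z := capa_eq_sum hA
    _ ≤ ∑ z ∈ hA.toFinset, equi lam P A z * ∑ i ∈ s, w i * green lam P z (y i) := by
        refine Finset.sum_le_sum fun z hz => ?_
        have := hpot z (by simpa using hz)
        nlinarith [h.equi_nonneg A z]
    _ = ∑ i ∈ s, w i * ∑ z ∈ hA.toFinset, green lam P (y i) z * equi lam P A z := by
        simp_rw [Finset.mul_sum]
        rw [Finset.sum_comm]
        refine Finset.sum_congr rfl fun i _ => Finset.sum_congr rfl fun z _ => ?_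
        rw [h.green_symm (y i) z]; ring
    _ ≤ ∑ i ∈ s, w i := by
        refine Finset.sum_le_sum fun i hi => ?_
        have := h.sum_green_equi_le_one hA (y i)
        nlinarith [hw i hi]

lemma Standing.capa_mono (h : Standing lam dd P α ν c₃ C₃) {A B : Set V} (hAB : A ⊆ B)
    (hB : B.Finite) : capa lam P A ≤ capa lam P B := by
  rw [capa_eq_sum hB]
  refine h.capa_le_sum (hB.subset hAB) hB.toFinset (equi lam P B) id
    (fun i _ => h.equi_nonneg B i) fun z hz => ?_
  rw [← h.sum_green_equi_eq_one hB (hAB hz)]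
  exact le_of_eq (Finset.sum_congr rfl fun i _ => mul_comm _ _)

/-- Lower bound on the capacity from a measure carried by the set whose potential is bounded
on its support. -/
lemma Standing.sum_le_mul_capa (h : Standing lam dd P α ν c₃ C₃) {A : Set V} (hA : A.Finite)
    {ι : Type*} (s : Finset ι) (w : ι → ℝ) (y : ι → V) (hy : ∀ i ∈ s, y i ∈ A) {b : ℝ}
    (hb : 0 ≤ b) (hpot : ∀ i ∈ s, ∑ k ∈ s, w k * green lam P (y i) (y k) ≤ b) :
    ∑ i ∈ s, w i ≤ b * capa lam P A := by
  set B : Set V := y '' s with hBdef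
  have hB : B.Finite := s.finite_toSet.image y
  have hBA : B ⊆ A := by rintro _ ⟨i, hi, rfl⟩; exact hy i hi
  refine le_trans ?_ (mul_le_mul_of_nonneg_left (h.capa_mono hBA hA) hb)
  calc ∑ i ∈ s, w i
      = ∑ i ∈ s, w i * ∑ z ∈ hB.toFinset, green lam P (y i) z * equi lam P B z := by
        refine Finset.sum_congr rfl fun i hi => ?_
        rw [h.sum_green_equi_eq_one hB (mem_image_of_mem y hi), mul_one]
    _ = ∑ z ∈ hB.toFinset, equi lam P B z * ∑ i ∈ s, w i * green lam P z (y i) := by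
        simp_rw [Finset.mul_sum]
        rw [Finset.sum_comm]
        refine Finset.sum_congr rfl fun z _ => Finset.sum_congr rfl fun i _ => ?_
        rw [h.green_symm (y i) z]; ring
    _ ≤ ∑ z ∈ hB.toFinset, equi lam P B z * b := by
        refine Finset.sum_le_sum fun z hz => ?_
        obtain ⟨i, hi, rfl⟩ : z ∈ B := by simpa using hz
        exact mul_le_mul_of_nonneg_left (hpot i hi) (h.equi_nonneg B _)
    _ = b * capa lam P B := by rw [← Finset.sum_mul, capa_eq_sum hB, mul_comm]

end Potential

section Geometry

variable {lam dd : V → V → ℝ} {P : V → Measure (ℕ → V)} {α ν c₃ C₃ : ℝ}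
variable [Countable V] [MeasurableSingletonClass V]

namespace Standing

lemma inv_lamTot_le_green (h : Standing lam dd P α ν c₃ C₃) (x y : V) (k : ℕ) :
    (lamTot lam y)⁻¹ * (P x {ω | ω k = y}).toReal ≤ green lam P x y := by
  have := h.prob x
  have hs : Summable fun k => (P x {ω | ω k = y}).toReal := by
    refine ENNReal.summable_toReal ?_
    rw [h.tsum_visits]
    exact ENNReal.ofReal_ne_top
  refine mul_le_mul_of_nonneg_left ?_ (inv_nonneg.2 (h.lamTot_pos y).le)
  exact hs.le_tsum k fun _ _ => ENNReal.toReal_nonneg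

lemma green_le_diag (h : Standing lam dd P α ν c₃ C₃) (x y : V) :
    green lam P x y ≤ green lam P y y := by
  have h1 := h.sum_green_equi_le_one (Set.finite_singleton y) x
  have h2 := h.sum_green_equi_eq_one (Set.finite_singleton y) (Set.mem_singleton y)
  simp only [Set.toFinite_toFinset, Set.toFinset_singleton, Finset.sum_singleton] at h1 h2
  have h3 := h.green_pos y y
  have h4 : 0 < equi lam P {y} y := by
    by_contra! hc
    nlinarith
  nlinarith

end Standing

/-- The ball as a finite set (empty by convention if the ball is infinite). -/
def ballF (dd : V → V → ℝ) (x : V) (r : ℝ) : Finset V :=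
  if hf : (vball dd x r).Finite then hf.toFinset else ∅

/-- Uniform two-sided estimates for volume, Green function and step length. -/
structure Bounds (lam dd : V → V → ℝ) (P : V → Measure (ℕ → V)) (α ν c C : ℝ) : Prop where
  c_pos : 0 < c
  one_le : 1 ≤ C
  finite : ∀ x r, (vball dd x r).Finite
  vol_ge : ∀ x r, 1 ≤ r → c * r ^ α ≤ ∑ z ∈ ballF dd x r, lamTot lam z
  vol_le : ∀ x r, 1 ≤ r → ∑ z ∈ ballF dd x r, lamTot lam z ≤ C * r ^ α
  green_ge : ∀ x y, c * (1 + dd x y) ^ (-ν) ≤ green lam P x y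
  green_le : ∀ x y, green lam P x y ≤ C * (1 + dd x y) ^ (-ν)
  step_le : ∀ x y, 0 < lam x y → dd x y ≤ C

namespace Standing

lemma dd_nonneg (h : Standing lam dd P α ν c₃ C₃) (x y : V) : 0 ≤ dd x y := by
  by_cases hxy : x = y
  · rw [hxy, h.dd_self]
  · exact (h.dd_pos x y hxy).le

lemma exists_bounds (h : Standing lam dd P α ν c₃ C₃) :
    ∃ c C : ℝ, Bounds lam dd P α ν c C := by
  have hν := h.nu_pos
  obtain ⟨c₁, C₁, hc₁, hcC₁, hvol⟩ := h.vol
  obtain ⟨c₂, C₂, hc₂, hcC₂, hg, hg'⟩ := h.greenBounds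
  obtain ⟨p, hp, hp'⟩ := h.p0
  have hC₂ : 0 < C₂ := hc₂.trans_le hcC₂
  have hC₁ : 0 < C₁ := hc₁.trans_le hcC₁
  have hlow : ∀ x, 1 / C₂ ≤ lamTot lam x := by
    intro x
    have h1 := h.inv_lamTot_le_green x x 0
    rw [h.start x, ENNReal.toReal_one, mul_one] at h1
    have h2 := h1.trans (hg x).2
    rw [div_le_iff₀ hC₂]
    rw [inv_le_iff_one_le_mul₀ (h.lamTot_pos x)] at h2
    linarith
  have hfin1 : ∀ x r, 1 ≤ r → (vball dd x r).Finite := by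
    intro x r hr
    have hs : Summable fun y : vball dd x r => lamTot lam y := by
      by_contra hns
      have := (hvol x r hr).1
      rw [tsum_eq_zero_of_not_summable hns] at this
      have : 0 < c₁ * r ^ α := by positivity
      linarith
    have h1 := hs.tendsto_cofinite_zero.eventually (gt_mem_nhds (show 0 < 1 / C₂ by positivity))
    rw [eventually_cofinite] at h1
    have h2 : (univ : Set (vball dd x r)).Finite := by
      refine h1.subset fun y _ => ?_
      simpa using hlow y
    rw [Set.finite_univ_iff] at h2
    exact Set.toFinite _
  have hfin : ∀ x r, (vball dd x r).Finite := fun x r =>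
    (hfin1 x (max 1 r) (le_max_left _ _)).subset fun y (hy : dd x y ≤ r) =>
      show dd x y ≤ max 1 r from le_trans hy (le_max_right _ _)
  have hsum : ∀ x r, ∑ z ∈ ballF dd x r, lamTot lam z = ∑' y : vball dd x r, lamTot lam y := by
    intro x r
    have := (hfin x r).fintype
    rw [ballF, dif_pos (hfin x r), tsum_fintype, ← Finset.sum_coe_sort]
    exact Fintype.sum_equiv (Equiv.subtypeEquivRight (p := fun y => y ∈ (hfin x r).toFinset)
      (q := fun y => y ∈ vball dd x r) fun y => (hfin x r).mem_toFinset) _ _ fun y => rfl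
  have hup : ∀ x, lamTot lam x ≤ C₁ := by
    intro x
    have h1 := (hvol x 1 le_rfl).2
    rw [← hsum, Real.one_rpow, mul_one] at h1
    refine le_trans ?_ h1
    refine Finset.single_le_sum (f := fun z => lamTot lam z) (fun z _ => (h.lamTot_pos z).le) ?_
    rw [ballF, dif_pos (hfin x 1), (hfin x 1).mem_toFinset]
    show dd x x ≤ 1
    rw [h.dd_self]; exact zero_le_one
  have hgC : ∀ x y, green lam P x y ≤ C₂ := fun x y => (h.green_le_diag x y).trans (hg y).2
  have hstep : ∀ x y, 0 < lam x y → dd x y ≤ (C₂ * C₁ / p) ^ (1 / ν) := by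
    intro x y hxy
    have hne : x ≠ y := by
      rintro rfl
      rw [h.lam_diag] at hxy
      exact lt_irrefl _ hxy
    have hd := h.dd_pos x y hne
    have h1 := h.inv_lamTot_le_green x y 1
    rw [h.step, ENNReal.toReal_ofReal (div_nonneg (h.lam_nonneg _ _) (h.lamTot_pos x).le)] at h1
    have h2 := h1.trans (hg' x y hne).2
    have h3 : C₁⁻¹ * p ≤ C₂ * dd x y ^ (-ν) := by
      refine le_trans ?_ h2
      exact mul_le_mul (inv_anti₀ (h.lamTot_pos y) (hup y)) (hp' x y hxy) hp.le
        (inv_nonneg.2 (h.lamTot_pos y).le)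
    rw [Real.rpow_neg hd.le] at h3
    have h4 : dd x y ^ ν ≤ C₂ * C₁ / p := by
      have : 0 < dd x y ^ ν := by positivity
      rw [le_div_iff₀ hp]
      rw [inv_mul_eq_div, div_le_iff₀ hC₁, ← div_eq_mul_inv, div_mul_eq_mul_div,
        le_div_iff₀ this] at h3
      linarith
    calc dd x y = (dd x y ^ ν) ^ (1 / ν) := by
          rw [← Real.rpow_mul hd.le, mul_one_div_cancel hν.ne', Real.rpow_one]
      _ ≤ _ := Real.rpow_le_rpow (by positivity) h4 (by positivity)
  have hle : ∀ x y, green lam P x y ≤ C₂ * 2 ^ ν * (1 + dd x y) ^ (-ν) := by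
    intro x y
    have hd0 := h.dd_nonneg x y
    rw [mul_assoc, Real.rpow_neg (by positivity), ← div_eq_mul_inv,
      ← Real.div_rpow (by norm_num) (by positivity)]
    by_cases hd : dd x y ≤ 1
    · refine (hgC x y).trans ?_
      have : 1 ≤ (2 / (1 + dd x y)) ^ ν := by
        refine Real.one_le_rpow ?_ hν.le
        rw [le_div_iff₀ (by positivity)]; linarith
      nlinarith
    · have hne : x ≠ y := by
        rintro rfl
        rw [h.dd_self] at hd
        exact hd zero_le_one
      refine (hg' x y hne).2.trans (mul_le_mul_of_nonneg_left ?_ hC₂.le)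
      have hd' := h.dd_pos x y hne
      rw [Real.rpow_neg hd'.le, ← Real.inv_rpow hd'.le]
      refine Real.rpow_le_rpow (by positivity) ?_ hν.le
      rw [inv_eq_one_div, div_le_div_iff₀ hd' (by positivity)]
      linarith
  have hge : ∀ x y, c₂ * (1 + dd x y) ^ (-ν) ≤ green lam P x y := by
    intro x y
    have hd0 := h.dd_nonneg x y
    by_cases hxy : x = y
    · rw [hxy, h.dd_self, add_zero, Real.one_rpow, mul_one]
      exact (hg y).1
    · refine le_trans (mul_le_mul_of_nonneg_left ?_ hc₂.le) (hg' x y hxy).1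
      exact Real.rpow_le_rpow_of_nonpos (h.dd_pos x y hxy) (by linarith) (by linarith)
  have hm1 : min c₁ c₂ ≤ c₁ := min_le_left _ _
  have hm2 : min c₁ c₂ ≤ c₂ := min_le_right _ _
  set C := max 1 (max C₁ (max (C₂ * 2 ^ ν) ((C₂ * C₁ / p) ^ (1 / ν)))) with hC
  have hM1 : C₁ ≤ C := (le_max_left _ _).trans (le_max_right _ _)
  have hM2 : C₂ * 2 ^ ν ≤ C :=
    (le_max_left _ _).trans ((le_max_right _ _).trans (le_max_right _ _))
  have hM3 : (C₂ * C₁ / p) ^ (1 / ν) ≤ C :=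
    (le_max_right _ _).trans ((le_max_right _ _).trans (le_max_right _ _))
  refine ⟨min c₁ c₂, C, ⟨lt_min hc₁ hc₂, le_max_left _ _,
    hfin, fun x r hr => ?_, fun x r hr => ?_, fun x y => ?_, fun x y => ?_,
    fun x y hxy => (hstep x y hxy).trans hM3⟩⟩
  · rw [hsum]
    refine le_trans ?_ (hvol x r hr).1
    exact mul_le_mul_of_nonneg_right hm1 (by positivity)
  · rw [hsum]
    refine (hvol x r hr).2.trans ?_
    exact mul_le_mul_of_nonneg_right hM1 (by positivity)
  · refine le_trans ?_ (hge x y)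
    have := h.dd_nonneg x y
    exact mul_le_mul_of_nonneg_right hm2 (by positivity)
  · refine (hle x y).trans ?_
    have := h.dd_nonneg x y
    exact mul_le_mul_of_nonneg_right hM2 (by positivity)

lemma ae_nn (h : Standing lam dd P α ν c₃ C₃) (x : V) :
    ∀ᵐ ω ∂(P x), ∀ n, 0 < lam (ω n) (ω (n + 1)) := by
  rw [ae_all_iff]
  intro n
  have h0 : ∀ y, P y {ω | ¬ 0 < lam (ω 0) (ω 1)} = 0 := by
    intro y
    have : ∀ᵐ ω ∂(P y), 0 < lam (ω 0) (ω 1) := by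
      have h2 : ∀ᵐ ω ∂(P y), ∀ z, lam y z = 0 → ω 1 ≠ z := by
        rw [ae_all_iff]
        intro z
        by_cases hz : lam y z = 0
        · have := h.step y z
          rw [hz, zero_div, ENNReal.ofReal_zero] at this
          have : ∀ᵐ ω ∂(P y), ω 1 ≠ z := by
            rw [ae_iff]; simpa using this
          filter_upwards [this] with ω hω _ using hω
        · exact Eventually.of_forall fun ω hz' => absurd hz' hz
      filter_upwards [h2, h.ae_start y] with ω h2 h1
      rw [h1]
      refine lt_of_le_of_ne (h.lam_nonneg _ _) fun h3 => h2 _ h3.symm rfl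
    exact this
  have hm : MeasurableSet {ω : ℕ → V | ¬ 0 < lam (ω 0) (ω 1)} := by
    have : Measurable fun ω : ℕ → V => lam (ω 0) (ω 1) :=
      Measurable.comp (g := fun z : V × V => lam z.1 z.2) (f := fun ω : ℕ → V => (ω 0, ω 1))
        (measurable_of_countable _) ((measurable_pi_apply 0).prodMk (measurable_pi_apply 1))
    exact (measurableSet_lt measurable_const this).compl
  rw [ae_iff]
  refine le_antisymm ?_ zero_le
  have h5 : {ω : ℕ → V | ¬ 0 < lam (ω n) (ω (n + 1))} ⊆
      ⋃ y, {ω : ℕ → V | ω n = y} ∩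
        {ω | (fun k => ω (n + k)) ∈ {ω : ℕ → V | ¬ 0 < lam (ω 0) (ω 1)}} :=
    fun ω hω => Set.mem_iUnion.2 ⟨ω n, rfl, hω⟩
  refine (measure_mono h5).trans ((measure_iUnion_le _).trans ?_)
  refine le_of_eq (ENNReal.tsum_eq_zero.2 fun y => ?_)
  rw [h.markov _ _ _ _ hm, h0, mul_zero]

end Standing

namespace Bounds

variable {c C : ℝ}

lemma mem_ballF (hb : Bounds lam dd P α ν c C) {x y : V} {r : ℝ} :
    y ∈ ballF dd x r ↔ dd x y ≤ r := by
  rw [ballF, dif_pos (hb.finite x r), (hb.finite x r).mem_toFinset]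
  rfl

lemma C_pos (hb : Bounds lam dd P α ν c C) : 0 < C := one_pos.trans_le hb.one_le

lemma visited_finite (hb : Bounds lam dd P α ν c C) (x : V) (r : ℝ) (ω : ℕ → V) :
    (visited (vball dd x r) ω).Finite :=
  (hb.finite x r).subset (by rintro _ ⟨k, hk, rfl⟩; exact hk k le_rfl)

lemma green_le_C (h : Standing lam dd P α ν c₃ C₃) (hb : Bounds lam dd P α ν c C) (x y : V) :
    green lam P x y ≤ C := by
  refine (hb.green_le x y).trans ?_
  have h1 : (1 + dd x y) ^ (-ν) ≤ 1 :=
    Real.rpow_le_one_of_one_le_of_nonpos (by linarith [h.dd_nonneg x y]) (by linarith [h.nu_pos])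
  nlinarith [hb.C_pos]

end Bounds

end Geometry

section Piece

variable {lam dd : V → V → ℝ} {P : V → Measure (ℕ → V)} {α ν c₃ C₃ c C : ℝ}
variable [Countable V] [MeasurableSingletonClass V]

lemma measurableSet_mem_visited (A : Set V) (v : V) :
    MeasurableSet {ω : ℕ → V | v ∈ visited A ω} := by
  have : {ω : ℕ → V | v ∈ visited A ω} =
      ⋃ k : ℕ, (⋂ n : ℕ, {ω : ℕ → V | n ≤ k → ω n ∈ A}) ∩ {ω : ℕ → V | ω k = v} := by
    ext ω
    simp [visited]
  rw [this]
  refine MeasurableSet.iUnion fun k => MeasurableSet.inter (MeasurableSet.iInter fun n => ?_)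
    (measurableSet_eval_eq k v)
  by_cases hn : n ≤ k
  · simpa [hn] using measurableSet_eval n A
  · simp [hn]

lemma visited_subset (A : Set V) (ω : ℕ → V) : visited A ω ⊆ A := by
  rintro _ ⟨k, hk, rfl⟩; exact hk k le_rfl

lemma measurable_visited {A : Set V} (hA : A.Finite) {β : Type*} [MeasurableSpace β]
    (f : Set V → β) : Measurable fun ω : ℕ → V => f (visited A ω) := by
  have := hA.to_subtype
  have h1 : Measurable fun (ω : ℕ → V) (b : A) => ((b : V) ∈ visited A ω) :=
    measurable_pi_lambda _ fun b => measurable_to_prop (by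
      have : (fun ω : ℕ → V => (b : V) ∈ visited A ω) ⁻¹' {True} =
          {ω : ℕ → V | (b : V) ∈ visited A ω} := by ext; simp
      rw [this]
      exact measurableSet_mem_visited A b)
  have h2 : (fun ω : ℕ → V => f (visited A ω)) =
      (fun g : A → Prop => f (Subtype.val '' {b | g b})) ∘
        fun (ω : ℕ → V) (b : A) => ((b : V) ∈ visited A ω) := by
    funext ω
    simp only [Function.comp]
    congr 1
    ext v
    constructor
    · intro hv
      exact ⟨⟨v, visited_subset A ω hv⟩, hv, rfl⟩
    · rintro ⟨b, hb, rfl⟩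
      exact hb
  rw [h2]
  exact (measurable_of_countable _).comp h1

/-- A trajectory segment with small energy has large capacity. -/
lemma Standing.sq_le_energy_mul_capa (h : Standing lam dd P α ν c₃ C₃) {A : Set V}
    (hA : A.Finite) (ω : ℕ → V) (m : ℕ) (hω : ∀ j < m, ω j ∈ A) {E : ℝ}
    (hE : ∑ j ∈ Finset.range m, ∑ k ∈ Finset.range m, green lam P (ω j) (ω k) ≤ E) :
    (m : ℝ) ^ 2 ≤ 4 * E * capa lam P A := by
  rcases Nat.eq_zero_or_pos m with hm | hm
  · subst hm
    have : 0 ≤ E := by simpa using hE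
    have := h.capa_nonneg A
    simp only [Nat.cast_zero, ne_eq, OfNat.ofNat_ne_zero, not_false_eq_true, zero_pow]
    positivity
  have hm' : (0 : ℝ) < m := by exact_mod_cast hm
  set pot : ℕ → ℝ := fun j => ∑ k ∈ Finset.range m, green lam P (ω j) (ω k) with hpot
  have hE0 : 0 < E := by
    refine lt_of_lt_of_le ?_ hE
    refine Finset.sum_pos (fun j _ => Finset.sum_pos (fun k _ => h.green_pos _ _) ?_) ?_ <;>
      exact ⟨0, Finset.mem_range.2 hm⟩
  set s := (Finset.range m).filter fun j => pot j ≤ 2 * E / m with hs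
  set t := (Finset.range m).filter fun j => ¬ pot j ≤ 2 * E / m with ht
  have hcard : (s.card : ℝ) + t.card = m := by
    have := Finset.card_filter_add_card_filter_not (s := Finset.range m)
      (fun j => pot j ≤ 2 * E / m)
    rw [Finset.card_range] at this
    exact_mod_cast this
  have ht' : (t.card : ℝ) * (2 * E / m) ≤ E := by
    rw [← nsmul_eq_mul]
    calc t.card • (2 * E / m) ≤ ∑ j ∈ t, pot j :=
          Finset.card_nsmul_le_sum _ _ _ fun j hj => (not_le.1 (Finset.mem_filter.1 hj).2).le
      _ ≤ ∑ j ∈ Finset.range m, pot j := by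
          refine Finset.sum_le_sum_of_subset_of_nonneg (Finset.filter_subset _ _) fun j _ _ => ?_
          exact Finset.sum_nonneg fun k _ => (h.green_pos _ _).le
      _ ≤ E := hE
  have ht2 : (t.card : ℝ) ≤ m / 2 := by
    rw [mul_div_assoc', div_le_iff₀ hm'] at ht'
    rw [le_div_iff₀ two_pos]
    nlinarith
  have h1 := h.sum_le_mul_capa hA s (fun _ => 1) ω
    (fun j hj => hω j (Finset.mem_range.1 (Finset.mem_filter.1 hj).1)) (b := 2 * E / m)
    (by positivity) (fun j hj => by
      refine le_trans ?_ (Finset.mem_filter.1 hj).2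
      simp only [one_mul]
      exact Finset.sum_le_sum_of_subset_of_nonneg (Finset.filter_subset _ _)
        fun k _ _ => (h.green_pos _ _).le)
  rw [Finset.sum_const, nsmul_eq_mul, mul_one] at h1
  have h2 : (m : ℝ) / 2 ≤ 2 * E / m * capa lam P A := by linarith
  rw [div_mul_eq_mul_div, div_le_div_iff₀ two_pos hm'] at h2
  nlinarith

/-- Expected number of visits to a finite set. -/
lemma Standing.lintegral_visits_finset (h : Standing lam dd P α ν c₃ C₃) (x : V) (s : Finset V)
    (f : V → ℝ) (hf : ∀ y, 0 ≤ f y) :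
    ∫⁻ ω, ∑' k, (if ω k ∈ s then ENNReal.ofReal (f (ω k)) else 0) ∂(P x) =
      ENNReal.ofReal (∑ z ∈ s, green lam P x z * lamTot lam z * f z) := by
  rw [h.lintegral_visits x fun y => if y ∈ s then ENNReal.ofReal (f y) else 0]
  rw [tsum_eq_sum (s := s) (fun y hy => by simp [hy])]
  rw [ENNReal.ofReal_sum_of_nonneg fun z _ => mul_nonneg
    (mul_nonneg (h.green_pos x z).le (h.lamTot_pos z).le) (hf z)]
  refine Finset.sum_congr rfl fun z hz => ?_
  rw [if_pos hz, ENNReal.ofReal_mul (mul_nonneg (h.green_pos x z).le (h.lamTot_pos z).le)]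

lemma Standing.measurable_visits_sum (f : V → V → ℝ≥0∞) :
    Measurable fun ω : ℕ → V => ∑' k, f (ω 0) (ω k) :=
  Measurable.tsum fun k =>
    Measurable.comp (g := fun z : V × V => f z.1 z.2) (f := fun ω : ℕ → V => (ω 0, ω k))
      (measurable_of_countable _) ((measurable_pi_apply 0).prodMk (measurable_pi_apply k))

/-- Lower bound on the probability to stay in a ball for a given number of steps. -/
lemma Standing.stay_prob (h : Standing lam dd P α ν c₃ C₃) (y : V) (A : Set V) (s : Finset V)
    (m : ℕ) {G₁ G₂ G₃ : ℝ} (hG₂ : 0 ≤ G₂) (hG₃ : 0 < G₃)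
    (h1 : G₁ ≤ ∑ z ∈ s, green lam P y z * lamTot lam z)
    (h2 : ∀ w, w ∉ A → ∑ z ∈ s, green lam P w z * lamTot lam z ≤ G₂)
    (h3 : ∀ w, ∑ z ∈ s, green lam P w z * lamTot lam z ≤ G₃) :
    ENNReal.ofReal ((G₁ - G₂ - m) / G₃) ≤ P y {ω | ∀ j ≤ m, ω j ∈ A} := by
  have := h.prob y
  set φ : (ℕ → V) → ℝ≥0∞ := fun ω => ∑' k, (if ω k ∈ s then 1 else 0) with hφ
  have hφm : Measurable φ := Standing.measurable_visits_sum fun _ z => if z ∈ s then 1 else 0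
  have hφi : ∀ w, ∫⁻ ω, φ ω ∂(P w) =
      ENNReal.ofReal (∑ z ∈ s, green lam P w z * lamTot lam z) := by
    intro w
    have := h.lintegral_visits_finset w s (fun _ => 1) fun _ => zero_le_one
    simpa [hφ] using this
  have hφs : ∀ n ω, φ ω ≤ n + φ (pshift n ω) := by
    intro n ω
    simp only [hφ, pshift_apply]
    rw [← Summable.sum_add_tsum_nat_add' (f := fun k => if ω k ∈ s then (1 : ℝ≥0∞) else 0)
      (k := n) ENNReal.summable]
    gcongr ?_ + ?_
    · calc ∑ i ∈ Finset.range n, (if ω i ∈ s then (1 : ℝ≥0∞) else 0)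
          ≤ ∑ i ∈ Finset.range n, 1 := Finset.sum_le_sum fun i _ => by split_ifs <;> simp
        _ = n := by simp
    · refine le_of_eq (tsum_congr fun k => ?_)
      rw [add_comm]
      congr
  set S : Set (ℕ → V) := {ω | ∀ j ≤ m, ω j ∈ A} with hS
  set Ex : ℕ → Set (ℕ → V) := fun n => {ω | (∀ j < n, ω j ∈ A) ∧ ω n ∉ A} with hEx
  have hSd : DependsOn (S.indicator fun _ => (1 : ℝ≥0∞)) (Set.Iic m) := by
    intro ω ω' hω
    have : ω ∈ S ↔ ω' ∈ S := by
      refine forall_congr' fun j => forall_congr' fun hj => ?_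
      rw [hω j hj]
    simp only [Set.indicator, this]
  have hEd : ∀ n, DependsOn ((Ex n).indicator fun _ => (1 : ℝ≥0∞)) (Set.Iic n) := by
    intro n ω ω' hω
    have : ω ∈ Ex n ↔ ω' ∈ Ex n := by
      refine and_congr (forall_congr' fun j => forall_congr' fun hj => ?_) ?_
      · rw [hω j (Set.mem_Iic.2 hj.le)]
      · rw [hω n (Set.mem_Iic.2 le_rfl)]
    simp only [Set.indicator, this]
  have hpt : ∀ ω, φ ω ≤ m + (S.indicator (fun _ => 1) ω * φ (pshift m ω) +
      ∑ n ∈ Finset.range (m + 1), (Ex n).indicator (fun _ => 1) ω * φ (pshift n ω)) := by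
    intro ω
    by_cases hω : ω ∈ S
    · refine (hφs m ω).trans (add_le_add le_rfl ?_)
      rw [Set.indicator_of_mem hω, one_mul]
      exact le_self_add
    · have hex : ∃ n, ω n ∉ A ∧ n ≤ m := by
        by_contra! hc
        exact hω fun j hj => by
          by_contra hj'
          exact absurd hj (not_le.2 (hc j hj'))
      set n := Nat.find hex with hn
      have hn1 := Nat.find_spec hex
      have hnE : ω ∈ Ex n := by
        refine ⟨fun j hj => ?_, hn1.1⟩
        by_contra hj'
        exact Nat.find_min hex hj ⟨hj', hj.le.trans hn1.2⟩
      refine (hφs n ω).trans (add_le_add ?_ ?_)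
      · exact_mod_cast hn1.2
      · refine le_add_left ?_
        refine le_trans ?_ (Finset.single_le_sum (fun _ _ => zero_le)
          (Finset.mem_range.2 (Nat.lt_succ_of_le hn1.2)))
        rw [Set.indicator_of_mem hnE, one_mul]
  have hSm : MeasurableSet S := by
    have : S = ⋂ j : ℕ, {ω : ℕ → V | j ≤ m → ω j ∈ A} := by ext; simp [hS]
    rw [this]
    refine MeasurableSet.iInter fun j => ?_
    by_cases hj : j ≤ m
    · simpa [hj] using measurableSet_eval j A
    · simp [hj]
  have hEm : ∀ n, Measurable ((Ex n).indicator fun _ => (1 : ℝ≥0∞)) := fun n =>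
    measurable_of_dependsOn (hEd n)
  have hφsm : ∀ n, Measurable fun ω => φ (pshift n ω) := fun n =>
    hφm.comp (measurable_pshift n)
  have hm1 : Measurable fun ω => S.indicator (fun _ => (1 : ℝ≥0∞)) ω * φ (pshift m ω) :=
    (measurable_of_dependsOn hSd).mul (hφsm m)
  have hm2 : ∀ n, Measurable fun ω => (Ex n).indicator (fun _ => (1 : ℝ≥0∞)) ω * φ (pshift n ω) :=
    fun n => (hEm n).mul (hφsm n)
  have hm3 : ∀ n, Measurable fun ω => (Ex n).indicator (fun _ => (1 : ℝ≥0∞)) ω *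
      ENNReal.ofReal G₂ := fun n => (hEm n).mul measurable_const
  have key : ENNReal.ofReal G₁ ≤ m + (P y S * ENNReal.ofReal G₃ + ENNReal.ofReal G₂) := by
    calc ENNReal.ofReal G₁ ≤ ∫⁻ ω, φ ω ∂(P y) := by
          rw [hφi]; exact ENNReal.ofReal_le_ofReal h1
      _ ≤ ∫⁻ ω, m + (S.indicator (fun _ => 1) ω * φ (pshift m ω) +
            ∑ n ∈ Finset.range (m + 1), (Ex n).indicator (fun _ => 1) ω * φ (pshift n ω)) ∂(P y) :=
          lintegral_mono hpt
      _ = m + (∫⁻ ω, S.indicator (fun _ => 1) ω * φ (pshift m ω) ∂(P y) +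
            ∑ n ∈ Finset.range (m + 1),
              ∫⁻ ω, (Ex n).indicator (fun _ => 1) ω * φ (pshift n ω) ∂(P y)) := by
          rw [lintegral_add_left measurable_const, lintegral_const, measure_univ, mul_one,
            lintegral_add_left hm1, lintegral_finsetSum _ fun n _ => hm2 n]
      _ ≤ _ := by
          refine add_le_add le_rfl (add_le_add ?_ ?_)
          · have hS1 : P y S * ENNReal.ofReal G₃ =
                ∫⁻ ω, S.indicator (fun _ => (1 : ℝ≥0∞)) ω * ENNReal.ofReal G₃ ∂(P y) := by
              rw [lintegral_mul_const _ (measurable_of_dependsOn hSd)]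
              congr 1
              exact (lintegral_indicator_one hSm).symm
            rw [h.markov_lintegral m y hSd hφm, hS1]
            refine lintegral_mono fun ω => ?_
            refine mul_le_mul' le_rfl ?_
            rw [hφi]; exact ENNReal.ofReal_le_ofReal (h3 _)
          · calc ∑ n ∈ Finset.range (m + 1),
                  ∫⁻ ω, (Ex n).indicator (fun _ => 1) ω * φ (pshift n ω) ∂(P y)
                ≤ ∑ n ∈ Finset.range (m + 1),
                  ∫⁻ ω, (Ex n).indicator (fun _ => 1) ω * ENNReal.ofReal G₂ ∂(P y) := by
                  refine Finset.sum_le_sum fun n _ => ?_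
                  rw [h.markov_lintegral n y (hEd n) hφm]
                  refine lintegral_mono fun ω => ?_
                  by_cases hω : ω ∈ Ex n
                  · refine mul_le_mul' le_rfl ?_
                    rw [hφi]
                    exact ENNReal.ofReal_le_ofReal (h2 _ hω.2)
                  · simp [hω]
              _ = ∫⁻ ω, (∑ n ∈ Finset.range (m + 1), (Ex n).indicator (fun _ => 1) ω) *
                    ENNReal.ofReal G₂ ∂(P y) := by
                  rw [← lintegral_finsetSum _ fun n _ => hm3 n]
                  simp_rw [Finset.sum_mul]
              _ ≤ ∫⁻ ω, 1 * ENNReal.ofReal G₂ ∂(P y) := by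
                  refine lintegral_mono fun ω => mul_le_mul' ?_ le_rfl
                  by_cases hex : ∃ n, ω ∈ Ex n
                  · obtain ⟨n, hn⟩ := hex
                    have huniq : ∀ k, k ≠ n → (Ex k).indicator (fun _ => (1 : ℝ≥0∞)) ω = 0 := by
                      intro k hk
                      refine Set.indicator_of_notMem (fun hk' => ?_) _
                      rcases lt_or_gt_of_ne hk with hlt | hlt
                      · exact hk'.2 (hn.1 k hlt)
                      · exact hn.2 (hk'.1 n hlt)
                    by_cases hmem : n ∈ Finset.range (m + 1)
                    · rw [Finset.sum_eq_single_of_mem n hmem fun k _ hk => huniq k hk,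
                        Set.indicator_of_mem hn]
                    · rw [Finset.sum_eq_zero fun k hk => huniq k (by rintro rfl; exact hmem hk)]
                      exact zero_le
                  · push Not at hex
                    rw [Finset.sum_eq_zero fun k _ => Set.indicator_of_notMem (hex k) _]
                    exact zero_le
              _ = ENNReal.ofReal G₂ := by
                  rw [lintegral_const, measure_univ, one_mul, mul_one]
  have hreal : G₁ ≤ m + ((P y S).toReal * G₃ + G₂) := by
    have hne : (P y S) ≠ ⊤ := measure_ne_top _ _
    rw [← ENNReal.ofReal_toReal hne, ← ENNReal.ofReal_mul ENNReal.toReal_nonneg,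
      ← ENNReal.ofReal_add (mul_nonneg ENNReal.toReal_nonneg hG₃.le) hG₂,
      ← ENNReal.ofReal_natCast, ← ENNReal.ofReal_add (Nat.cast_nonneg m)
      (add_nonneg (mul_nonneg ENNReal.toReal_nonneg hG₃.le) hG₂)] at key
    exact (ENNReal.ofReal_le_ofReal_iff (add_nonneg (Nat.cast_nonneg m)
      (add_nonneg (mul_nonneg ENNReal.toReal_nonneg hG₃.le) hG₂))).1 key
  refine ENNReal.ofReal_le_of_le_toReal ?_
  rw [div_le_iff₀ hG₃]
  linarith

/-- If the walk stays in a ball with positive probability for `m` steps, then its trace in the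
ball has large capacity with positive probability. -/
lemma Standing.capa_visited_of_stay (h : Standing lam dd P α ν c₃ C₃)
    (hb : Bounds lam dd P α ν c C) (y : V) (R : ℝ) (m : ℕ) {Sg p : ℝ} (hm : 0 < m)
    (hSg : 0 < Sg) (hp : 0 < p)
    (hker : ∀ w, ∑ z ∈ ballF dd w (2 * R), green lam P w z * lamTot lam z * green lam P w z ≤ Sg)
    (hstay : ENNReal.ofReal p ≤ P y {ω | ∀ j ≤ m, ω j ∈ vball dd y R}) :
    ENNReal.ofReal (p / 2) ≤
      P y {ω | m * p / (16 * Sg) ≤ capa lam P (visited (vball dd y R) ω)} := by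
  have := h.prob y
  have hm' : (0 : ℝ) < m := by exact_mod_cast hm
  set A := vball dd y R with hA
  set f : V → V → ℝ≥0∞ := fun w z =>
    if z ∈ ballF dd w (2 * R) then ENNReal.ofReal (green lam P w z) else 0 with hf
  set φ : (ℕ → V) → ℝ≥0∞ := fun ω => ∑' k, f (ω 0) (ω k) with hφ
  have hφm : Measurable φ := Standing.measurable_visits_sum f
  have hφi : ∀ w, ∫⁻ ω, φ ω ∂(P w) ≤ ENNReal.ofReal Sg := by
    intro w
    calc ∫⁻ ω, φ ω ∂(P w) = ∫⁻ ω, ∑' k, f w (ω k) ∂(P w) := by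
          refine lintegral_congr_ae ?_
          filter_upwards [h.ae_start w] with ω hω
          simp only [hφ, hω]
      _ = ENNReal.ofReal (∑ z ∈ ballF dd w (2 * R),
            green lam P w z * lamTot lam z * green lam P w z) :=
          h.lintegral_visits_finset w _ _ fun z => (h.green_pos w z).le
      _ ≤ _ := ENNReal.ofReal_le_ofReal (hker w)
  set Φ : (ℕ → V) → ℝ≥0∞ := fun ω => ∑ j ∈ Finset.range m, φ (pshift j ω) with hΦ
  have hφj : ∀ j, Measurable fun ω => φ (pshift j ω) := fun j => hφm.comp (measurable_pshift j)
  have hΦm : Measurable Φ := Finset.measurable_fun_sum _ fun j _ => hφj j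
  have hΦi : ∫⁻ ω, Φ ω ∂(P y) ≤ ENNReal.ofReal (m * Sg) := by
    rw [hΦ, lintegral_finsetSum _ fun j _ => hφj j]
    calc ∑ j ∈ Finset.range m, ∫⁻ ω, φ (pshift j ω) ∂(P y)
        ≤ ∑ j ∈ Finset.range m, ENNReal.ofReal Sg := by
          refine Finset.sum_le_sum fun j _ => ?_
          have h1 := h.markov_lintegral j y (F := fun _ => 1) (fun _ _ _ => rfl) hφm
          simp only [one_mul] at h1
          rw [h1]
          calc ∫⁻ ω, ∫⁻ ω', φ ω' ∂(P (ω j)) ∂(P y) ≤ ∫⁻ ω, ENNReal.ofReal Sg ∂(P y) :=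
                lintegral_mono fun ω => hφi _
            _ = _ := by rw [lintegral_const, measure_univ, mul_one]
      _ = ENNReal.ofReal (m * Sg) := by
          rw [Finset.sum_const, Finset.card_range, nsmul_eq_mul,
            ENNReal.ofReal_mul (Nat.cast_nonneg m), ENNReal.ofReal_natCast]
  set b : ℝ := 2 * m * Sg / p with hbdef
  have hb0 : 0 < b := by positivity
  have hbig : P y {ω | ENNReal.ofReal b ≤ Φ ω} ≤ ENNReal.ofReal (p / 2) := by
    have h1 := (mul_meas_ge_le_lintegral (μ := P y) hΦm (ENNReal.ofReal b)).trans hΦi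
    have hne : P y {ω | ENNReal.ofReal b ≤ Φ ω} ≠ ⊤ := measure_ne_top _ _
    rw [← ENNReal.ofReal_toReal hne, ← ENNReal.ofReal_mul hb0.le,
      ENNReal.ofReal_le_ofReal_iff (by positivity)] at h1
    rw [← ENNReal.ofReal_toReal hne]
    refine ENNReal.ofReal_le_ofReal ?_
    rw [← le_div_iff₀' hb0] at h1
    refine h1.trans (le_of_eq ?_)
    rw [hbdef]
    field_simp
  have hdet : {ω | ∀ j ≤ m, ω j ∈ A} ⊆ {ω | ENNReal.ofReal b ≤ Φ ω} ∪
      {ω | m * p / (16 * Sg) ≤ capa lam P (visited A ω)} := by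
    intro ω hω
    by_cases hb1 : ENNReal.ofReal b ≤ Φ ω
    · exact Or.inl hb1
    right
    have hmem : ∀ j < m, ω j ∈ visited A ω := fun j hj =>
      ⟨j, fun n hn => hω n (hn.trans hj.le), rfl⟩
    have hball : ∀ j < m, ∀ k < m, ω k ∈ ballF dd (ω j) (2 * R) := by
      intro j hj k hk
      rw [hb.mem_ballF]
      have h1 : dd y (ω j) ≤ R := hω j hj.le
      have h2 : dd y (ω k) ≤ R := hω k hk.le
      have h3 := h.dd_triangle (ω j) y (ω k)
      rw [h.dd_symm (ω j) y] at h3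
      linarith
    set D : ℝ := ∑ j ∈ Finset.range m, ∑ k ∈ Finset.range m,
      if j ≤ k then green lam P (ω j) (ω k) else 0 with hD
    have hDΦ : ENNReal.ofReal D ≤ Φ ω := by
      have hnn : ∀ j k, 0 ≤ if j ≤ k then green lam P (ω j) (ω k) else 0 := fun j k => by
        split_ifs
        exacts [(h.green_pos _ _).le, le_rfl]
      rw [hD, ENNReal.ofReal_sum_of_nonneg fun j _ => Finset.sum_nonneg fun k _ => hnn j k]
      refine Finset.sum_le_sum fun j hj => ?_
      rw [ENNReal.ofReal_sum_of_nonneg fun k _ => hnn j k]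
      have hjm := Finset.mem_range.1 hj
      calc ∑ k ∈ Finset.range m, ENNReal.ofReal (if j ≤ k then green lam P (ω j) (ω k) else 0)
          = ∑ k ∈ Finset.Ico j m, ENNReal.ofReal (green lam P (ω j) (ω k)) := by
            rw [Finset.range_eq_Ico, ← Finset.sum_subset
              (Finset.Ico_subset_Ico_left (b := m) (Nat.zero_le j))]
            · refine Finset.sum_congr rfl fun k hk => ?_
              rw [if_pos (Finset.mem_Ico.1 hk).1]
            · intro k hk hk'
              rw [if_neg, ENNReal.ofReal_zero]
              intro hjk
              exact hk' (Finset.mem_Ico.2 ⟨hjk, (Finset.mem_Ico.1 hk).2⟩)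
        _ = ∑ i ∈ Finset.range (m - j), f (ω j) (ω (j + i)) := by
            rw [Finset.sum_Ico_eq_sum_range]
            refine Finset.sum_congr rfl fun i hi => ?_
            rw [hf]
            simp only
            rw [if_pos (hball j hjm (j + i) (by have := Finset.mem_range.1 hi; omega))]
        _ ≤ φ (pshift j ω) := by
            simp only [hφ, pshift_apply, add_zero]
            exact ENNReal.sum_le_tsum _
    have hDb : D ≤ b := by
      by_contra! hc
      exact hb1 ((ENNReal.ofReal_le_ofReal hc.le).trans hDΦ)
    have hE : ∑ j ∈ Finset.range m, ∑ k ∈ Finset.range m, green lam P (ω j) (ω k) ≤ 2 * b := by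
      have h1 : ∑ j ∈ Finset.range m, ∑ k ∈ Finset.range m, green lam P (ω j) (ω k) ≤
          D + ∑ j ∈ Finset.range m, ∑ k ∈ Finset.range m,
            if k ≤ j then green lam P (ω j) (ω k) else 0 := by
        rw [hD, ← Finset.sum_add_distrib]
        refine Finset.sum_le_sum fun j _ => ?_
        rw [← Finset.sum_add_distrib]
        refine Finset.sum_le_sum fun k _ => ?_
        have := h.green_pos (ω j) (ω k)
        rcases le_total j k with hjk | hjk
        · rw [if_pos hjk]
          split_ifs <;> linarith
        · rw [if_pos hjk]
          split_ifs <;> linarith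
      have h2 : ∑ j ∈ Finset.range m, ∑ k ∈ Finset.range m,
          (if k ≤ j then green lam P (ω j) (ω k) else 0) = D := by
        rw [hD, Finset.sum_comm]
        refine Finset.sum_congr rfl fun j _ => Finset.sum_congr rfl fun k _ => ?_
        rw [h.green_symm]
      linarith
    have h1 := h.sq_le_energy_mul_capa (hb.visited_finite y R ω) ω m hmem hE
    rw [Set.mem_ofPred_eq, div_le_iff₀ (by positivity)]
    have h2 : (m : ℝ) ^ 2 * p ≤ 16 * m * Sg * capa lam P (visited A ω) := by
      have h3 : 4 * (2 * b) * p = 16 * m * Sg := by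
        rw [hbdef]; field_simp; ring
      calc (m : ℝ) ^ 2 * p ≤ 4 * (2 * b) * capa lam P (visited A ω) * p :=
            mul_le_mul_of_nonneg_right h1 hp.le
        _ = _ := by rw [← h3]; ring
    nlinarith
  have h1 := hstay.trans ((measure_mono hdet).trans (measure_union_le _ _))
  have h2 : ENNReal.ofReal p ≤ ENNReal.ofReal (p / 2) +
      P y {ω | m * p / (16 * Sg) ≤ capa lam P (visited A ω)} :=
    h1.trans (add_le_add hbig le_rfl)
  rw [show p = p / 2 + p / 2 by ring, ENNReal.ofReal_add (by positivity) (by positivity)] at h2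
  rw [show (p / 2 + p / 2) = p by ring] at h2
  exact (ENNReal.add_le_add_iff_left ENNReal.ofReal_ne_top).1 h2

end Piece

section Shells

variable {lam dd : V → V → ℝ} {P : V → Measure (ℕ → V)} {α ν c₃ C₃ c C : ℝ}
variable [Countable V] [MeasurableSingletonClass V]

lemma Standing.shell_sum (h : Standing lam dd P α ν c₃ C₃) (hb : Bounds lam dd P α ν c C)
    {s : ℝ} (hs : 0 < s) (y : V) (n : ℕ) :
    ∑ z ∈ ballF dd y (2 ^ n), lamTot lam z * (1 + dd y z) ^ (-s) ≤
      C * 2 ^ α * (1 + ∑ i ∈ Finset.range n, ((2 : ℝ) ^ (α - s)) ^ i) := by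
  have hC := hb.C_pos
  have hα : 0 < α := by linarith [h.nu_pos, h.nu_le]
  induction n with
  | zero =>
    simp only [pow_zero, Finset.range_zero, Finset.sum_empty, add_zero, mul_one]
    calc ∑ z ∈ ballF dd y 1, lamTot lam z * (1 + dd y z) ^ (-s)
        ≤ ∑ z ∈ ballF dd y 1, lamTot lam z := by
          refine Finset.sum_le_sum fun z _ => ?_
          refine mul_le_of_le_one_right (h.lamTot_pos z).le ?_
          exact Real.rpow_le_one_of_one_le_of_nonpos (by linarith [h.dd_nonneg y z]) (by linarith)
      _ ≤ C * 1 ^ α := hb.vol_le y 1 le_rfl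
      _ ≤ C * 2 ^ α := mul_le_mul_of_nonneg_left
          (Real.rpow_le_rpow zero_le_one one_le_two hα.le) hC.le
  | succ n ih =>
    have h2n : (1 : ℝ) ≤ 2 ^ (n + 1) := one_le_pow₀ one_le_two
    have hsub : ballF dd y (2 ^ n) ⊆ ballF dd y (2 ^ (n + 1)) := by
      intro z hz
      rw [hb.mem_ballF] at hz ⊢
      exact hz.trans (pow_le_pow_right₀ one_le_two (Nat.le_succ n))
    rw [← Finset.sum_sdiff hsub, Finset.sum_range_succ]
    have h1 : ∑ z ∈ ballF dd y (2 ^ (n + 1)) \ ballF dd y (2 ^ n),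
        lamTot lam z * (1 + dd y z) ^ (-s) ≤ C * 2 ^ α * ((2 : ℝ) ^ (α - s)) ^ n := by
      calc ∑ z ∈ ballF dd y (2 ^ (n + 1)) \ ballF dd y (2 ^ n), lamTot lam z * (1 + dd y z) ^ (-s)
          ≤ ∑ z ∈ ballF dd y (2 ^ (n + 1)) \ ballF dd y (2 ^ n),
            lamTot lam z * ((2 : ℝ) ^ n) ^ (-s) := by
            refine Finset.sum_le_sum fun z hz => ?_
            rw [Finset.mem_sdiff, hb.mem_ballF, hb.mem_ballF, not_le] at hz
            refine mul_le_mul_of_nonneg_left ?_ (h.lamTot_pos z).le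
            exact Real.rpow_le_rpow_of_nonpos (by positivity) (by linarith [hz.2]) (by linarith)
        _ ≤ ∑ z ∈ ballF dd y (2 ^ (n + 1)), lamTot lam z * ((2 : ℝ) ^ n) ^ (-s) := by
            refine Finset.sum_le_sum_of_subset_of_nonneg Finset.sdiff_subset fun z _ _ => ?_
            exact mul_nonneg (h.lamTot_pos z).le (by positivity)
        _ ≤ (C * ((2 : ℝ) ^ (n + 1)) ^ α) * ((2 : ℝ) ^ n) ^ (-s) := by
            rw [← Finset.sum_mul]
            exact mul_le_mul_of_nonneg_right (hb.vol_le y _ h2n) (by positivity)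
        _ = _ := by
            rw [pow_succ, Real.mul_rpow (by positivity) (by positivity), sub_eq_add_neg,
              Real.rpow_add two_pos, mul_pow, ← Real.rpow_natCast, ← Real.rpow_natCast,
              ← Real.rpow_natCast, ← Real.rpow_mul two_pos.le, ← Real.rpow_mul two_pos.le,
              ← Real.rpow_mul two_pos.le, ← Real.rpow_mul two_pos.le, mul_comm (n : ℝ) α,
              mul_comm (n : ℝ) (-s)]
            ring
    nlinarith [ih, h1]

lemma exists_pow_two_near {r : ℝ} (hr : 1 ≤ r) :
    ∃ n : ℕ, r ≤ 2 ^ n ∧ (2 : ℝ) ^ n ≤ 2 * r ∧ (n : ℝ) ≤ 2 * (1 + Real.log r) := by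
  obtain ⟨n, h1, h2⟩ := exists_nat_pow_near hr one_lt_two
  refine ⟨n + 1, h2.le, by rw [pow_succ]; linarith, ?_⟩
  have h3 := Real.log_le_log (by positivity) h1
  rw [Real.log_pow] at h3
  have := Real.log_two_gt_d9
  have hn : (0 : ℝ) ≤ n := Nat.cast_nonneg n
  push_cast
  nlinarith

lemma Bounds.sum_ballF_mono (h : Standing lam dd P α ν c₃ C₃) (hb : Bounds lam dd P α ν c C)
    (y : V) {r r' s : ℝ} (hr : r ≤ r') :
    ∑ z ∈ ballF dd y r, lamTot lam z * (1 + dd y z) ^ (-s) ≤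
      ∑ z ∈ ballF dd y r', lamTot lam z * (1 + dd y z) ^ (-s) := by
  refine Finset.sum_le_sum_of_subset_of_nonneg (fun z hz => ?_) fun z _ _ => ?_
  · rw [hb.mem_ballF] at hz ⊢
    exact hz.trans hr
  · have := h.dd_nonneg y z
    exact mul_nonneg (h.lamTot_pos z).le (by positivity)

lemma Standing.kernel_sum_of_lt (h : Standing lam dd P α ν c₃ C₃)
    (hb : Bounds lam dd P α ν c C) {s : ℝ} (hs : 0 < s) (hsα : s < α) :
    ∃ K : ℝ, 0 < K ∧ ∀ y r, 1 ≤ r →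
      ∑ z ∈ ballF dd y r, lamTot lam z * (1 + dd y z) ^ (-s) ≤ K * r ^ (α - s) := by
  have hC := hb.C_pos
  set q : ℝ := 2 ^ (α - s) with hq
  have hq1 : 1 < q := Real.one_lt_rpow one_lt_two (by linarith)
  refine ⟨C * 2 ^ α * (1 + q / (q - 1)), ?_, fun y r hr => ?_⟩
  · have : 0 < q - 1 := by linarith
    positivity
  obtain ⟨n, hn1, hn2, -⟩ := exists_pow_two_near hr
  refine (Bounds.sum_ballF_mono h hb y hn1).trans ((h.shell_sum hb hs y n).trans ?_)
  rw [mul_assoc (C * 2 ^ α)]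
  refine mul_le_mul_of_nonneg_left ?_ (by positivity)
  have hr1 : 1 ≤ r ^ (α - s) := Real.one_le_rpow hr (by linarith)
  have hqn : q ^ n ≤ q * r ^ (α - s) := by
    rw [hq, ← Real.rpow_natCast, ← Real.rpow_mul two_pos.le, mul_comm, Real.rpow_mul two_pos.le,
      Real.rpow_natCast, ← Real.mul_rpow two_pos.le (by linarith)]
    exact Real.rpow_le_rpow (by positivity) hn2 (by linarith)
  have hgeo : ∑ i ∈ Finset.range n, q ^ i ≤ q / (q - 1) * r ^ (α - s) := by
    rw [geom_sum_eq hq1.ne', div_mul_eq_mul_div]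
    exact div_le_div_of_nonneg_right (by linarith) (by linarith)
  nlinarith

lemma Standing.kernel_sum_of_eq (h : Standing lam dd P α ν c₃ C₃)
    (hb : Bounds lam dd P α ν c C) {s : ℝ} (hs : 0 < s) (hsα : s = α) :
    ∃ K : ℝ, 0 < K ∧ ∀ y r, 1 ≤ r →
      ∑ z ∈ ballF dd y r, lamTot lam z * (1 + dd y z) ^ (-s) ≤ K * (1 + Real.log r) := by
  have hC := hb.C_pos
  refine ⟨C * 2 ^ α * 3, by positivity, fun y r hr => ?_⟩
  obtain ⟨n, hn1, -, hn2⟩ := exists_pow_two_near hr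
  refine (Bounds.sum_ballF_mono h hb y hn1).trans ((h.shell_sum hb hs y n).trans ?_)
  rw [mul_assoc (C * 2 ^ α)]
  refine mul_le_mul_of_nonneg_left ?_ (by positivity)
  have : 0 ≤ Real.log r := Real.log_nonneg hr
  simp [hsα]
  linarith

lemma Standing.kernel_sum_of_gt (h : Standing lam dd P α ν c₃ C₃)
    (hb : Bounds lam dd P α ν c C) {s : ℝ} (hs : 0 < s) (hsα : α < s) :
    ∃ K : ℝ, 0 < K ∧ ∀ y r, 1 ≤ r →
      ∑ z ∈ ballF dd y r, lamTot lam z * (1 + dd y z) ^ (-s) ≤ K := by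
  have hC := hb.C_pos
  set q : ℝ := 2 ^ (α - s) with hq
  have hq1 : q < 1 := Real.rpow_lt_one_of_one_lt_of_neg one_lt_two (by linarith)
  have hq0 : 0 < q := by positivity
  have : 0 < 1 - q := by linarith
  refine ⟨C * 2 ^ α * (1 + 1 / (1 - q)), by positivity, fun y r hr => ?_⟩
  obtain ⟨n, hn1, -, -⟩ := exists_pow_two_near hr
  refine (Bounds.sum_ballF_mono h hb y hn1).trans ((h.shell_sum hb hs y n).trans ?_)
  refine mul_le_mul_of_nonneg_left ?_ (by positivity)
  have hgeo : ∑ i ∈ Finset.range n, q ^ i ≤ 1 / (1 - q) := by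
    rw [geom_sum_eq hq1.ne, ← neg_div_neg_eq, neg_sub, neg_sub]
    exact div_le_div_of_nonneg_right (by linarith [pow_pos hq0 n]) this.le
  linarith

/-- Traces in balls of radius `R` have capacity of order `R ^ (α - ν)` over the kernel sum, with
uniformly positive probability. -/
lemma Standing.exists_piece (h : Standing lam dd P α ν c₃ C₃) (hb : Bounds lam dd P α ν c C) :
    ∃ R₀ θ p : ℝ, 1 ≤ R₀ ∧ 0 < θ ∧ 0 < p ∧ p ≤ 1 ∧ ∀ R, R₀ ≤ R → ∀ Sg, 0 < Sg →
      (∀ w, ∑ z ∈ ballF dd w (2 * R), lamTot lam z * (1 + dd w z) ^ (-(2 * ν)) ≤ Sg) →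
      ∀ y, ENNReal.ofReal p ≤
        P y {ω | θ * R ^ (α - ν) / Sg ≤ capa lam P (visited (vball dd y R) ω)} := by
  have hν := h.nu_pos
  have hαν : 2 ≤ α - ν := by linarith [h.nu_le]
  have hc := hb.c_pos
  have hC := hb.C_pos
  obtain ⟨K, hK, hker⟩ := h.kernel_sum_of_lt hb hν (by linarith)
  set a₁ : ℝ := c * c * 2 ^ (-ν) with ha₁
  have ha₁0 : 0 < a₁ := by positivity
  set δ : ℝ := min (1 / 2) ((a₁ / (2 * (C * C * 2 ^ ν))) ^ (1 / ν)) with hδ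
  have hδ0 : 0 < δ := lt_min (by norm_num) (by positivity)
  have hδ2 : δ ≤ 1 / 2 := min_le_left _ _
  have hδν : C * C * 2 ^ ν * δ ^ ν ≤ a₁ / 2 := by
    have : δ ^ ν ≤ a₁ / (2 * (C * C * 2 ^ ν)) := by
      calc δ ^ ν ≤ ((a₁ / (2 * (C * C * 2 ^ ν))) ^ (1 / ν)) ^ ν :=
            Real.rpow_le_rpow hδ0.le (min_le_right _ _) hν.le
        _ = _ := by rw [← Real.rpow_mul (by positivity), one_div_mul_cancel hν.ne', Real.rpow_one]
    rw [le_div_iff₀ (by positivity)] at this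
    linarith
  set κ : ℝ := a₁ * δ ^ (α - ν) / 4 with hκ
  have hκ0 : 0 < κ := by positivity
  set a₃ : ℝ := C * K + C * C with ha₃
  have ha₃0 : 0 < a₃ := by positivity
  set p₀ : ℝ := min 1 (κ / a₃) with hp₀
  have hp₀0 : 0 < p₀ := lt_min one_pos (by positivity)
  refine ⟨max 1 (max (1 / δ) (1 / κ)), κ * p₀ / (32 * (C * C)), p₀ / 2, le_max_left _ _,
    by positivity, by positivity, by linarith [min_le_left 1 (κ / a₃)],
    fun R hR Sg hSg hSgker y => ?_⟩
  have hR1 : 1 ≤ R := (le_max_left _ _).trans hR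
  have hR0 : 0 < R := by linarith
  have hRδ : 1 ≤ δ * R := by
    have : 1 / δ ≤ R := (le_max_left _ _).trans ((le_max_right _ _).trans hR)
    rw [div_le_iff₀ hδ0] at this
    linarith
  have hRκ : 1 ≤ κ * R ^ (α - ν) := by
    have h1 : 1 / κ ≤ R := (le_max_right _ _).trans ((le_max_right _ _).trans hR)
    rw [div_le_iff₀ hκ0] at h1
    have h2 : R ≤ R ^ (α - ν) := by
      calc R = R ^ (1 : ℝ) := (Real.rpow_one R).symm
        _ ≤ R ^ (α - ν) := Real.rpow_le_rpow_of_exponent_le hR1 (by linarith)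
    nlinarith
  have hsplit : R ^ α = R ^ (α - ν) * R ^ ν := by rw [← Real.rpow_add hR0]; ring_nf
  have hdsplit : δ ^ α = δ ^ (α - ν) * δ ^ ν := by rw [← Real.rpow_add hδ0]; ring_nf
  have hRν : R ^ ν * R ^ (-ν) = 1 := by rw [← Real.rpow_add hR0]; simp
  have hδν' : δ ^ ν * δ ^ (-ν) = 1 := by rw [← Real.rpow_add hδ0]; simp
  set s := ballF dd y (δ * R) with hs
  have hvol1 : c * (δ * R) ^ α ≤ ∑ z ∈ s, lamTot lam z := hb.vol_ge y _ hRδ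
  have hvol2 : ∑ z ∈ s, lamTot lam z ≤ C * (δ * R) ^ α := hb.vol_le y _ hRδ
  have hG₁ : 4 * κ * R ^ (α - ν) ≤ ∑ z ∈ s, green lam P y z * lamTot lam z := by
    calc 4 * κ * R ^ (α - ν) = c * (2 * (δ * R)) ^ (-ν) * (c * (δ * R) ^ α) := by
          rw [Real.mul_rpow two_pos.le (by positivity), Real.mul_rpow hδ0.le hR0.le,
            Real.mul_rpow hδ0.le hR0.le, hsplit, hdsplit, hκ, ha₁]
          linear_combination (-(c * c * 2 ^ (-ν) * δ ^ (α - ν) * R ^ (α - ν))) * (hRν * 1) +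
            (-(c * c * 2 ^ (-ν) * δ ^ (α - ν) * R ^ (α - ν) * (R ^ ν * R ^ (-ν)))) * hδν'
      _ ≤ c * (2 * (δ * R)) ^ (-ν) * ∑ z ∈ s, lamTot lam z :=
          mul_le_mul_of_nonneg_left hvol1 (by positivity)
      _ ≤ _ := by
          rw [Finset.mul_sum]
          refine Finset.sum_le_sum fun z hz => ?_
          refine mul_le_mul_of_nonneg_right ?_ (h.lamTot_pos z).le
          refine le_trans (mul_le_mul_of_nonneg_left ?_ hc.le) (hb.green_ge y z)
          have hz' := hb.mem_ballF.1 hz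
          have := h.dd_nonneg y z
          exact Real.rpow_le_rpow_of_nonpos (by linarith) (by linarith) (by linarith)
  have hG₂ : ∀ w, w ∉ vball dd y R →
      ∑ z ∈ s, green lam P w z * lamTot lam z ≤ 2 * κ * R ^ (α - ν) := by
    intro w hw
    have hw' : R < dd y w := not_le.1 hw
    calc ∑ z ∈ s, green lam P w z * lamTot lam z
        ≤ ∑ z ∈ s, C * (R / 2) ^ (-ν) * lamTot lam z := by
          refine Finset.sum_le_sum fun z hz => ?_
          refine mul_le_mul_of_nonneg_right ?_ (h.lamTot_pos z).le
          refine (hb.green_le w z).trans (mul_le_mul_of_nonneg_left ?_ hC.le)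
          have hz' := hb.mem_ballF.1 hz
          have h1 := h.dd_triangle y z w
          rw [h.dd_symm z w] at h1
          exact Real.rpow_le_rpow_of_nonpos (by positivity) (by nlinarith) (by linarith)
      _ = C * (R / 2) ^ (-ν) * ∑ z ∈ s, lamTot lam z := by rw [Finset.mul_sum]
      _ ≤ C * (R / 2) ^ (-ν) * (C * (δ * R) ^ α) :=
          mul_le_mul_of_nonneg_left hvol2 (by positivity)
      _ = (C * C * 2 ^ ν * δ ^ ν) * (δ ^ (α - ν) * R ^ (α - ν)) := by
          rw [Real.div_rpow hR0.le two_pos.le, Real.rpow_neg two_pos.le, div_inv_eq_mul,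
            Real.mul_rpow hδ0.le hR0.le, hsplit, hdsplit]
          linear_combination (C * C * 2 ^ ν * δ ^ ν * δ ^ (α - ν) * R ^ (α - ν)) * hRν
      _ ≤ a₁ / 2 * (δ ^ (α - ν) * R ^ (α - ν)) :=
          mul_le_mul_of_nonneg_right hδν (by positivity)
      _ = _ := by rw [hκ]; ring
  have hG₃ : ∀ w, ∑ z ∈ s, green lam P w z * lamTot lam z ≤ a₃ * R ^ (α - ν) := by
    intro w
    rw [← Finset.sum_filter_add_sum_filter_not s (fun z => dd w z ≤ R), ha₃, add_mul]
    refine add_le_add ?_ ?_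
    · calc ∑ z ∈ s with dd w z ≤ R, green lam P w z * lamTot lam z
          ≤ ∑ z ∈ ballF dd w R, C * (lamTot lam z * (1 + dd w z) ^ (-ν)) := by
            refine (Finset.sum_le_sum fun z _ => ?_).trans
              (Finset.sum_le_sum_of_subset_of_nonneg (fun z hz => ?_) fun z _ _ => ?_)
            · calc green lam P w z * lamTot lam z ≤ (C * (1 + dd w z) ^ (-ν)) * lamTot lam z :=
                    mul_le_mul_of_nonneg_right (hb.green_le w z) (h.lamTot_pos z).le
                _ = _ := by ring
            · exact hb.mem_ballF.2 (Finset.mem_filter.1 hz).2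
            · have := h.dd_nonneg w z
              have := h.lamTot_pos z
              positivity
        _ ≤ C * (K * R ^ (α - ν)) := by
            rw [← Finset.mul_sum]
            exact mul_le_mul_of_nonneg_left (hker w R hR1) hC.le
        _ = _ := by ring
    · calc ∑ z ∈ s with ¬ dd w z ≤ R, green lam P w z * lamTot lam z
          ≤ ∑ z ∈ s, C * R ^ (-ν) * lamTot lam z := by
            refine (Finset.sum_le_sum fun z hz => ?_).trans
              (Finset.sum_le_sum_of_subset_of_nonneg (Finset.filter_subset _ _) fun z _ _ => ?_)
            · refine mul_le_mul_of_nonneg_right ?_ (h.lamTot_pos z).le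
              refine (hb.green_le w z).trans (mul_le_mul_of_nonneg_left ?_ hC.le)
              have := (Finset.mem_filter.1 hz).2
              exact Real.rpow_le_rpow_of_nonpos hR0 (by linarith) (by linarith)
            · exact mul_nonneg (by positivity) (h.lamTot_pos z).le
        _ = C * R ^ (-ν) * ∑ z ∈ s, lamTot lam z := by rw [Finset.mul_sum]
        _ ≤ C * R ^ (-ν) * (C * (δ * R) ^ α) :=
            mul_le_mul_of_nonneg_left hvol2 (by positivity)
        _ ≤ C * R ^ (-ν) * (C * R ^ α) := by
            refine mul_le_mul_of_nonneg_left ?_ (by positivity)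
            refine mul_le_mul_of_nonneg_left ?_ hC.le
            exact Real.rpow_le_rpow (by positivity) (by nlinarith) (by linarith)
        _ = C * C * R ^ (α - ν) := by
            rw [hsplit]
            linear_combination (C * C * R ^ (α - ν)) * hRν
  set m : ℕ := ⌊κ * R ^ (α - ν)⌋₊ with hm
  have hm1 : (m : ℝ) ≤ κ * R ^ (α - ν) := Nat.floor_le (by positivity)
  have hm0 : 0 < m := Nat.floor_pos.2 hRκ
  have hm2 : κ * R ^ (α - ν) / 2 ≤ m := by
    have h1 := Nat.lt_floor_add_one (κ * R ^ (α - ν))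
    have h2 : (1 : ℝ) ≤ m := by exact_mod_cast hm0
    linarith
  have hRp : 0 < R ^ (α - ν) := by positivity
  have hstay := h.stay_prob y (vball dd y R) s m (by positivity) (by positivity) hG₁ hG₂ hG₃
  have hstay' : ENNReal.ofReal p₀ ≤ P y {ω | ∀ j ≤ m, ω j ∈ vball dd y R} := by
    refine le_trans (ENNReal.ofReal_le_ofReal ?_) hstay
    refine (min_le_right _ _).trans ?_
    rw [div_le_div_iff₀ ha₃0 (by positivity)]
    have : κ * R ^ (α - ν) ≤ 4 * κ * R ^ (α - ν) - 2 * κ * R ^ (α - ν) - m := by linarith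
    calc κ * (a₃ * R ^ (α - ν)) = κ * R ^ (α - ν) * a₃ := by ring
      _ ≤ _ := mul_le_mul_of_nonneg_right this ha₃0.le
  have hfin := h.capa_visited_of_stay hb y R m (Sg := C * C * Sg) hm0 (by positivity) hp₀0
    (fun w => ?_) hstay'
  · refine hfin.trans (measure_mono fun ω hω => ?_)
    rw [Set.mem_ofPred_eq] at hω ⊢
    refine le_trans ?_ hω
    rw [div_le_div_iff₀ hSg (by positivity)]
    calc κ * p₀ / (32 * (C * C)) * R ^ (α - ν) * (16 * (C * C * Sg))
        = κ * R ^ (α - ν) / 2 * (p₀ * Sg) := by field_simp; ring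
      _ ≤ m * (p₀ * Sg) := mul_le_mul_of_nonneg_right hm2 (by positivity)
      _ = _ := by ring
  · calc ∑ z ∈ ballF dd w (2 * R), green lam P w z * lamTot lam z * green lam P w z
        ≤ ∑ z ∈ ballF dd w (2 * R), C * C * (lamTot lam z * (1 + dd w z) ^ (-(2 * ν))) := by
          refine Finset.sum_le_sum fun z _ => ?_
          have h0 := h.dd_nonneg w z
          have h1 := hb.green_le w z
          have h2 := (h.green_pos w z).le
          have h3 : (1 + dd w z) ^ (-(2 * ν)) = (1 + dd w z) ^ (-ν) * (1 + dd w z) ^ (-ν) := by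
            rw [← Real.rpow_add (by positivity)]; ring_nf
          rw [h3]
          calc green lam P w z * lamTot lam z * green lam P w z
              = (green lam P w z * green lam P w z) * lamTot lam z := by ring
            _ ≤ ((C * (1 + dd w z) ^ (-ν)) * (C * (1 + dd w z) ^ (-ν))) * lamTot lam z :=
                mul_le_mul_of_nonneg_right (mul_le_mul h1 h1 h2 (h2.trans h1)) (h.lamTot_pos z).le
            _ = _ := by ring
      _ ≤ C * C * Sg := by
          rw [← Finset.mul_sum]
          exact mul_le_mul_of_nonneg_left (hSgker w) (by positivity)

end Shells

section Exits

variable {lam dd : V → V → ℝ} {P : V → Measure (ℕ → V)} {α ν c₃ C₃ c C : ℝ}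
variable [Countable V] [MeasurableSingletonClass V]

/-- First time at distance at least `r` from `x`. -/
def etime (dd : V → V → ℝ) (x : V) (r : ℝ) (ω : ℕ → V) : ℕ := sInf {n | r ≤ dd x (ω n)}

/-- The trajectory after reaching distance `r` from `x`. -/
def eshift (dd : V → V → ℝ) (x : V) (r : ℝ) (ω : ℕ → V) : ℕ → V := pshift (etime dd x r ω) ω

/-- `ω` reaches distance `r` from `x` for the first time at `n`. -/
def firstAt (dd : V → V → ℝ) (x : V) (r : ℝ) (n : ℕ) (ω : ℕ → V) : Prop :=
  (∀ i < n, dd x (ω i) < r) ∧ r ≤ dd x (ω n)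

lemma firstAt.etime_eq {x : V} {r : ℝ} {n : ℕ} {ω : ℕ → V} (hn : firstAt dd x r n ω) :
    etime dd x r ω = n := by
  refine le_antisymm (Nat.sInf_le hn.2) ?_
  by_contra! hlt
  have hne : {n | r ≤ dd x (ω n)}.Nonempty := ⟨n, hn.2⟩
  exact absurd (Nat.sInf_mem hne) (not_le.2 (hn.1 _ hlt))

lemma firstAt_etime {x : V} {r : ℝ} {ω : ℕ → V} (hω : ∃ n, r ≤ dd x (ω n)) :
    firstAt dd x r (etime dd x r ω) ω :=
  ⟨fun _ hi => not_le.1 fun hc => Nat.notMem_of_lt_sInf hi hc, Nat.sInf_mem hω⟩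

lemma firstAt.congr {x : V} {r : ℝ} {n m : ℕ} {ω ω' : ℕ → V} (hn : firstAt dd x r n ω)
    (hnm : n ≤ m) (hω : ∀ i ≤ m, ω i = ω' i) : firstAt dd x r n ω' := by
  refine ⟨fun i hi => ?_, ?_⟩
  · rw [← hω i (hi.le.trans hnm)]; exact hn.1 i hi
  · rw [← hω n hnm]; exact hn.2

/-- Reaching a larger distance takes longer. -/
lemma firstAt.exists_le {x : V} {r r' : ℝ} {n : ℕ} {ω : ℕ → V} (hn : firstAt dd x r n ω)
    (hr : r' ≤ r) : ∃ m ≤ n, firstAt dd x r' m ω :=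
  ⟨etime dd x r' ω, Nat.sInf_le (hr.trans hn.2), firstAt_etime ⟨n, hr.trans hn.2⟩⟩

lemma Standing.ae_reach (h : Standing lam dd P α ν c₃ C₃) (hb : Bounds lam dd P α ν c C)
    (x y : V) : ∀ᵐ ω ∂(P y), ∀ r, ∃ n, r ≤ dd x (ω n) := by
  have h1 : ∀ᵐ ω ∂(P y), ∀ k : ℕ, ∃ n, (k : ℝ) ≤ dd x (ω n) := by
    rw [ae_all_iff]
    intro k
    filter_upwards [h.ae_eventually_notMem_finite y (hb.finite x k)] with ω hω
    obtain ⟨n, hn⟩ := hω.exists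
    exact ⟨n, (not_le.1 hn).le⟩
  filter_upwards [h1] with ω hω r
  obtain ⟨k, hk⟩ := exists_nat_ge r
  obtain ⟨n, hn⟩ := hω k
  exact ⟨n, hk.trans hn⟩

/-- At the first time at distance `r` the walk overshoots by at most one step. -/
lemma firstAt.dist_le (h : Standing lam dd P α ν c₃ C₃) (hb : Bounds lam dd P α ν c C) {x : V}
    {r : ℝ} {n : ℕ} {ω : ℕ → V} (hn : firstAt dd x r n ω) (hr : 0 ≤ r) (h0 : ω 0 = x)
    (hnn : ∀ i < n, 0 < lam (ω i) (ω (i + 1))) : dd x (ω n) ≤ r + C := by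
  cases n with
  | zero =>
    rw [h0, h.dd_self]
    linarith [hb.C_pos]
  | succ n =>
    have h1 := hn.1 n (Nat.lt_succ_self n)
    have h2 := hb.step_le _ _ (hnn n (Nat.lt_succ_self n))
    have h3 := h.dd_triangle x (ω n) (ω (n + 1))
    linarith

lemma visited_congr {A : Set V} {ω ω' : ℕ → V} {n : ℕ} (hn : ω n ∉ A)
    (hω : ∀ i ≤ n, ω i = ω' i) : visited A ω = visited A ω' := by
  ext v
  constructor
  · rintro ⟨k, hk, rfl⟩
    have hkn : k < n := by
      by_contra! hc
      exact hn (hk n hc)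
    exact ⟨k, fun i hi => by rw [← hω i (hi.trans hkn.le)]; exact hk i hi, (hω k hkn.le).symm⟩
  · rintro ⟨k, hk, rfl⟩
    have hkn : k < n := by
      by_contra! hc
      exact hn (by rw [hω n le_rfl]; exact hk n hc)
    exact ⟨k, fun i hi => by rw [hω i (hi.trans hkn.le)]; exact hk i hi, hω k hkn.le⟩

/-- Evaluation of a functional of the starting point and of the trace in the ball around it. -/
def ballTrace {β : Type*} (dd : V → V → ℝ) (R : ℝ) (φ : V → Set V → β) (ω : ℕ → V) : β :=
  φ (ω 0) (visited (vball dd (ω 0) R) ω)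

lemma measurable_ballTrace (hb : Bounds lam dd P α ν c C) {β : Type*} [MeasurableSpace β]
    (R : ℝ) (φ : V → Set V → β) : Measurable (ballTrace dd R φ) := by
  have h1 : ∀ y, Measurable fun ω : ℕ → V => φ y (visited (vball dd y R) ω) := fun y =>
    measurable_visited (hb.finite y R) (φ y)
  intro S hS
  have : ballTrace dd R φ ⁻¹' S =
      ⋃ y, {ω : ℕ → V | ω 0 = y} ∩ (fun ω => φ y (visited (vball dd y R) ω)) ⁻¹' S := by
    ext ω; simp [ballTrace]
  rw [this]
  exact MeasurableSet.iUnion fun y => (measurableSet_eval_eq 0 y).inter (h1 y hS)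

/-- Moment bound for functionals of the traces in balls around well separated exit points. -/
lemma Standing.lintegral_prod_ballTrace_le (h : Standing lam dd P α ν c₃ C₃)
    (hb : Bounds lam dd P α ν c C) (x : V) {L R : ℝ} (hR : 0 ≤ R) (hL : C + R < L)
    (φ : V → Set V → ℝ≥0∞) {q : ℝ≥0∞}
    (hq : ∀ y, ∫⁻ ω, φ y (visited (vball dd y R) ω) ∂(P y) ≤ q) (M : ℕ) :
    ∫⁻ ω, ∏ k ∈ Finset.range M, ballTrace dd R φ (eshift dd x (k * L) ω) ∂(P x) ≤ q ^ M := by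
  have := h.prob x
  have hC := hb.C_pos
  have hL0 : 0 < L := by linarith
  induction M with
  | zero => simp
  | succ k ih =>
    set Q : (ℕ → V) → ℝ≥0∞ :=
      fun ω => ∏ j ∈ Finset.range k, ballTrace dd R φ (eshift dd x (j * L) ω) with hQ
    set cond : ℕ → (ℕ → V) → Prop := fun n ω =>
      ω 0 = x ∧ firstAt dd x (k * L) n ω ∧ ∀ i < n, 0 < lam (ω i) (ω (i + 1)) with hcond
    set F : ℕ → (ℕ → V) → ℝ≥0∞ := fun n ω => if cond n ω then Q ω else 0 with hF
    have hcong : ∀ n ω ω', (∀ i ≤ n, ω i = ω' i) → cond n ω → cond n ω' ∧ Q ω = Q ω' := by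
      intro n ω ω' hω hc
      refine ⟨⟨by rw [← hω 0 (Nat.zero_le n)]; exact hc.1, hc.2.1.congr le_rfl hω,
        fun i hi => ?_⟩, ?_⟩
      · rw [← hω i hi.le, ← hω (i + 1) hi]; exact hc.2.2 i hi
      · refine Finset.prod_congr rfl fun j hj => ?_
        have hjk : j < k := Finset.mem_range.1 hj
        have hjk' : ((j : ℝ) + 1) ≤ k := by exact_mod_cast hjk
        obtain ⟨m, hmn, hm⟩ := hc.2.1.exists_le (r' := j * L) (by nlinarith)
        have hm' := hm.congr hmn hω
        have hd := hm.dist_le h hb (by positivity) hc.1 fun i hi => hc.2.2 i (hi.trans_le hmn)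
        rw [eshift, eshift, hm.etime_eq, hm'.etime_eq, ballTrace, ballTrace]
        simp only [pshift_apply, add_zero]
        rw [hω m hmn]
        congr 1
        refine visited_congr (n := n - m) ?_ fun i hi => ?_
        · rw [pshift_apply, Nat.add_sub_cancel' hmn, ← hω m hmn]
          intro hin
          have h1 : dd (ω m) (ω n) ≤ R := hin
          have h2 := hc.2.1.2
          have h3 := h.dd_triangle x (ω m) (ω n)
          nlinarith
        · rw [pshift_apply, pshift_apply]
          exact hω _ (by omega)
    have hFd : ∀ n, DependsOn (F n) (Set.Iic n) := by
      intro n ω ω' hω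
      have hω' : ∀ i ≤ n, ω i = ω' i := fun i hi => hω i hi
      by_cases hc : cond n ω
      · obtain ⟨h1, h2⟩ := hcong n ω ω' hω' hc
        simp only [hF, if_pos hc, if_pos h1, h2]
      · have hc' : ¬ cond n ω' := fun hc' => hc (hcong n ω' ω (fun i hi => (hω' i hi).symm) hc').1
        simp only [hF, if_neg hc, if_neg hc']
    have hFm : ∀ n, Measurable (F n) := fun n => measurable_of_dependsOn (hFd n)
    have hφm : Measurable (ballTrace dd R φ) := measurable_ballTrace hb R φ
    have hφi : ∀ y, ∫⁻ ω, ballTrace dd R φ ω ∂(P y) ≤ q := by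
      intro y
      refine le_trans (le_of_eq (lintegral_congr_ae ?_)) (hq y)
      filter_upwards [h.ae_start y] with ω hω
      rw [ballTrace, hω]
    calc ∫⁻ ω, ∏ j ∈ Finset.range (k + 1), ballTrace dd R φ (eshift dd x (j * L) ω) ∂(P x)
        ≤ ∫⁻ ω, ∑' n, F n ω * ballTrace dd R φ (pshift n ω) ∂(P x) := by
          refine lintegral_mono_ae ?_
          filter_upwards [h.ae_start x, h.ae_nn x, h.ae_reach hb x x] with ω h0 hnn hre
          have hfa := firstAt_etime (hre (k * L))
          refine le_trans ?_ (ENNReal.le_tsum (etime dd x (k * L) ω))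
          rw [Finset.prod_range_succ]
          refine le_of_eq ?_
          simp only [hF]
          rw [if_pos ⟨h0, hfa, fun i _ => hnn i⟩]
          rfl
      _ = ∑' n, ∫⁻ ω, F n ω * ballTrace dd R φ (pshift n ω) ∂(P x) :=
          lintegral_tsum fun n => ((hFm n).mul (hφm.comp (measurable_pshift n))).aemeasurable
      _ ≤ ∑' n, ∫⁻ ω, F n ω * q ∂(P x) := by
          refine ENNReal.tsum_le_tsum fun n => ?_
          rw [h.markov_lintegral n x (hFd n) hφm]
          exact lintegral_mono fun ω => mul_le_mul' le_rfl (hφi _)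
      _ = (∫⁻ ω, ∑' n, F n ω ∂(P x)) * q := by
          rw [lintegral_tsum fun n => (hFm n).aemeasurable, ← ENNReal.tsum_mul_right]
          exact tsum_congr fun n => lintegral_mul_const _ (hFm n)
      _ ≤ (∫⁻ ω, Q ω ∂(P x)) * q := by
          refine mul_le_mul' (lintegral_mono fun ω => ?_) le_rfl
          rw [tsum_eq_single (etime dd x (k * L) ω)]
          · simp only [hF]
            split_ifs
            exacts [le_rfl, zero_le]
          · intro n hn
            simp only [hF]
            rw [if_neg]
            exact fun hc => hn hc.2.1.etime_eq.symm
      _ ≤ q ^ k * q := mul_le_mul' ih le_rfl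
      _ = q ^ (k + 1) := (pow_succ q k).symm

/-- Traces around exit points are part of the trace in a larger ball. -/
lemma visited_eshift_subset (h : Standing lam dd P α ν c₃ C₃) (hb : Bounds lam dd P α ν c C)
    {x : V} {r R N : ℝ} {ω : ℕ → V} (hr : 0 ≤ r) (hR : 0 ≤ R) (hN : r + C + R ≤ N) (h0 : ω 0 = x)
    (hnn : ∀ i, 0 < lam (ω i) (ω (i + 1))) (hre : ∃ n, r ≤ dd x (ω n)) :
    visited (vball dd (eshift dd x r ω 0) R) (eshift dd x r ω) ⊆ visited (vball dd x N) ω := by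
  have hC := hb.C_pos
  have hfa := firstAt_etime hre
  set T := etime dd x r ω with hT
  have hd := hfa.dist_le h hb hr h0 fun i _ => hnn i
  rintro _ ⟨k, hk, rfl⟩
  refine ⟨T + k, fun n hn => ?_, rfl⟩
  show dd x (ω n) ≤ N
  by_cases hnT : n < T
  · have := hfa.1 n hnT
    linarith
  · have h1 : dd (ω T) (ω n) ≤ R := by
      have := hk (n - T) (by omega)
      simp only [eshift, pshift_apply, ← hT, add_zero, Nat.add_sub_cancel' (not_lt.1 hnT)] at this
      exact this
    have := h.dd_triangle x (ω T) (ω n)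
    linarith

lemma dist_eshift (h : Standing lam dd P α ν c₃ C₃) (hb : Bounds lam dd P α ν c C)
    {x : V} {r : ℝ} {ω : ℕ → V} (hr : 0 ≤ r) (h0 : ω 0 = x)
    (hnn : ∀ i, 0 < lam (ω i) (ω (i + 1))) (hre : ∃ n, r ≤ dd x (ω n)) :
    r ≤ dd x (eshift dd x r ω 0) ∧ dd x (eshift dd x r ω 0) ≤ r + C := by
  have hfa := firstAt_etime hre
  exact ⟨hfa.2, hfa.dist_le h hb hr h0 fun i _ => hnn i⟩

end Exits

section Combination

variable {lam dd : V → V → ℝ} {P : V → Measure (ℕ → V)} {α ν c₃ C₃ c C : ℝ}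
variable [Countable V] [MeasurableSingletonClass V]

/-- Capacity of a union of pieces with small mutual Green interaction. -/
lemma Standing.card_le_mul_capa (h : Standing lam dd P α ν c₃ C₃) {A : Set V} (hA : A.Finite)
    {ι : Type*} [DecidableEq ι] (K : Finset ι) (D : ι → Set V) (hDA : ∀ k ∈ K, D k ⊆ A)
    {κ I : ℝ} (hκ : 0 < κ)
    (hI0 : 0 ≤ I) (hcap : ∀ k ∈ K, κ ≤ capa lam P (D k)) (G : ι → ι → ℝ)
    (hG : ∀ j ∈ K, ∀ k ∈ K, j ≠ k → ∀ z ∈ D j, ∀ w ∈ D k, green lam P z w ≤ G j k)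
    (hI : ∀ j ∈ K, ∑ k ∈ K.erase j, G j k ≤ I) :
    (K.card : ℝ) ≤ (1 / κ + I) * capa lam P A := by
  have hAk : ∀ k, (A ∩ D k).Finite := fun k => hA.subset inter_subset_left
  have hDk : ∀ k ∈ K, A ∩ D k = D k := fun k hk => inter_eq_right.2 (hDA k hk)
  set s : Finset (Σ _ : ι, V) := K.sigma fun k => (hAk k).toFinset with hs
  have hcap' : ∀ k ∈ K, κ ≤ capa lam P (A ∩ D k) := fun k hk => by
    rw [hDk k hk]; exact hcap k hk
  have hsum1 : ∀ k ∈ K, ∑ z ∈ (hAk k).toFinset,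
      equi lam P (A ∩ D k) z / capa lam P (A ∩ D k) = 1 := fun k hk => by
    rw [← Finset.sum_div, ← capa_eq_sum (hAk k), div_self]
    exact (hκ.trans_le (hcap' k hk)).ne'
  have hmain := h.sum_le_mul_capa hA s
    (fun p => equi lam P (A ∩ D p.1) p.2 / capa lam P (A ∩ D p.1)) (fun p => p.2)
    (fun p hp => by
      simp only [hs, Finset.mem_sigma, Set.Finite.mem_toFinset] at hp
      exact hp.2.1) (b := 1 / κ + I) (by positivity) ?_
  · rw [hs, Finset.sum_sigma, Finset.sum_congr rfl hsum1] at hmain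
    simpa using hmain
  · rintro ⟨j, z⟩ hjz
    simp only [hs, Finset.mem_sigma, Set.Finite.mem_toFinset] at hjz
    obtain ⟨hj, hz⟩ := hjz
    rw [hs, Finset.sum_sigma, ← Finset.add_sum_erase K _ hj]
    refine add_le_add ?_ ((Finset.sum_le_sum fun k hk => ?_).trans (hI j hj))
    · have h1 := h.sum_green_equi_le_one (hAk j) z
      have h2 := hcap' j hj
      calc _ = (∑ y ∈ (hAk j).toFinset, green lam P z y * equi lam P (A ∩ D j) y) /
            capa lam P (A ∩ D j) := by
            rw [Finset.sum_div]; exact Finset.sum_congr rfl fun y _ => by ring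
        _ ≤ 1 / κ := div_le_div₀ zero_le_one h1 hκ h2
    · have hk' := Finset.mem_of_mem_erase hk
      calc _ ≤ ∑ y ∈ (hAk k).toFinset,
            equi lam P (A ∩ D k) y / capa lam P (A ∩ D k) * G j k := by
            refine Finset.sum_le_sum fun y hy => ?_
            simp only [Set.Finite.mem_toFinset] at hy
            exact mul_le_mul_of_nonneg_left
              (hG j hj k hk' (Finset.ne_of_mem_erase hk).symm z hz.2 y hy.2)
              (div_nonneg (h.equi_nonneg _ _) (h.capa_nonneg _))
        _ = G j k := by rw [← Finset.sum_mul, hsum1 k hk', one_mul]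

lemma Standing.exists_green_ge (h : Standing lam dd P α ν c₃ C₃) (hb : Bounds lam dd P α ν c C)
    {η : ℝ} (h0 : 0 < η) :
    ∃ M : ℝ, 0 < M ∧ ∀ x y, (1 - η) * c₃ * (dd x y + M) ^ (-ν) ≤ green lam P x y := by
  obtain ⟨M, hM⟩ := h.greenAsymp η h0
  have hν := h.nu_pos
  have hc := hb.c_pos
  have hc₃ := h.c₃_pos
  by_cases hη : 1 ≤ η
  · refine ⟨1, one_pos, fun x y => ?_⟩
    have := Real.rpow_nonneg (add_nonneg (h.dd_nonneg x y) zero_le_one) (-ν)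
    have h2 := h.green_pos x y
    have : (1 - η) * c₃ * (dd x y + 1) ^ (-ν) ≤ 0 :=
      mul_nonpos_of_nonpos_of_nonneg (mul_nonpos_of_nonpos_of_nonneg (by linarith) hc₃.le) this
    linarith
  push Not at hη
  set B : ℝ := (c₃ / c) ^ (1 / ν) with hB
  have hB0 : 0 < B := by positivity
  have hBν : B ^ ν = c₃ / c := by
    rw [hB, ← Real.rpow_mul (by positivity), one_div_mul_cancel hν.ne', Real.rpow_one]
  set M0 := max M 0 with hM0
  have hM00 : 0 ≤ M0 := le_max_right _ _
  refine ⟨B * (1 + M0), by positivity, fun x y => ?_⟩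
  have hd := h.dd_nonneg x y
  rcases le_or_gt M0 (dd x y) with hle | hlt
  · by_cases hd0 : dd x y = 0
    · have hM0' : M0 = 0 := by linarith
      have := hb.green_ge x y
      refine le_trans ?_ this
      rw [hd0, hM0']
      simp only [add_zero, zero_add, mul_one, Real.one_rpow]
      rw [Real.rpow_neg hB0.le, hBν, inv_div]
      have : (1 - η) * c₃ * (c / c₃) = (1 - η) * c := by field_simp
      rw [this]; nlinarith
    have hd1 : 0 < dd x y := lt_of_le_of_ne hd (Ne.symm hd0)
    have h1 := (hM x y ((le_max_left _ _).trans hle)).1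
    have h2 : (1 - η) * c₃ * (dd x y) ^ (-ν) ≤ green lam P x y := by
      rw [Real.rpow_neg hd, ← div_eq_mul_inv, div_le_iff₀ (by positivity)]
      exact h1
    refine le_trans (mul_le_mul_of_nonneg_left ?_ (by nlinarith)) h2
    exact Real.rpow_le_rpow_of_nonpos hd1 (by nlinarith) (by linarith)
  · refine le_trans ?_ (hb.green_ge x y)
    have h1 : (dd x y + B * (1 + M0)) ^ (-ν) ≤ (B * (1 + M0)) ^ (-ν) :=
      Real.rpow_le_rpow_of_nonpos (by positivity) (by linarith) (by linarith)
    have h2 : (1 + M0) ^ (-ν) ≤ (1 + dd x y) ^ (-ν) :=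
      Real.rpow_le_rpow_of_nonpos (by positivity) (by linarith) (by linarith)
    have h3 : 0 ≤ (1 + M0) ^ (-ν) := by positivity
    calc (1 - η) * c₃ * (dd x y + B * (1 + M0)) ^ (-ν)
        ≤ (1 - η) * c₃ * (B * (1 + M0)) ^ (-ν) :=
          mul_le_mul_of_nonneg_left h1 (by nlinarith)
      _ = (1 - η) * c * (1 + M0) ^ (-ν) := by
          rw [Real.mul_rpow hB0.le (by positivity), Real.rpow_neg hB0.le, hBν, inv_div]
          field_simp
      _ ≤ c * (1 + M0) ^ (-ν) := by
          have : (1 - η) * c ≤ c := by nlinarith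
          exact mul_le_mul_of_nonneg_right this h3
      _ ≤ _ := mul_le_mul_of_nonneg_left h2 hc.le

lemma Standing.exists_green_le (h : Standing lam dd P α ν c₃ C₃) {η : ℝ} (h0 : 0 < η) :
    ∃ M : ℝ, 0 < M ∧ ∀ x y r, M ≤ r → r ≤ dd x y →
      green lam P x y ≤ (1 + η) * C₃ * r ^ (-ν) := by
  obtain ⟨M, hM⟩ := h.greenAsymp η h0
  have hν := h.nu_pos
  have hC₃ := h.c₃_pos.trans_le h.c₃_le_C₃
  refine ⟨max M 1, by positivity, fun x y r hr hrd => ?_⟩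
  have hr1 : 0 < r := one_pos.trans_le ((le_max_right _ _).trans hr)
  have hd : 0 < dd x y := hr1.trans_le hrd
  have h1 := (hM x y ((le_max_left _ _).trans (hr.trans hrd))).2
  have h2 : green lam P x y ≤ (1 + η) * C₃ * (dd x y) ^ (-ν) := by
    rw [Real.rpow_neg hd.le, ← div_eq_mul_inv, le_div_iff₀ (by positivity)]
    exact h1
  refine h2.trans (mul_le_mul_of_nonneg_left ?_ (by positivity))
  exact Real.rpow_le_rpow_of_nonpos hr1 hrd (by linarith)

/-- Trace in the ball of radius `R` around the first point at distance at least `r` from `x`. -/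
def pieceAt (dd : V → V → ℝ) (x : V) (R r : ℝ) (ω : ℕ → V) : Set V :=
  visited (vball dd (eshift dd x r ω 0) R) (eshift dd x r ω)

lemma dist_pieceAt (h : Standing lam dd P α ν c₃ C₃) (hb : Bounds lam dd P α ν c C)
    {x : V} {ω : ℕ → V} (h0 : ω 0 = x)
    (hnn : ∀ i, 0 < lam (ω i) (ω (i + 1))) (hre : ∀ r, ∃ n, r ≤ dd x (ω n))
    {R L : ℝ} (hL : 0 ≤ L) {j k : ℕ} {z w : V}
    (hz : z ∈ pieceAt dd x R (j * L) ω) (hw : w ∈ pieceAt dd x R (k * L) ω) :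
    |(j : ℝ) - k| * L - C - 2 * R ≤ dd z w := by
  have key : ∀ (j k : ℕ) (z w : V), j ≤ k → z ∈ pieceAt dd x R (j * L) ω →
      w ∈ pieceAt dd x R (k * L) ω → |(j : ℝ) - k| * L - C - 2 * R ≤ dd z w := by
    intro j k z w hjk hz hw
    have h1 := dist_eshift h hb (r := j * L) (by positivity) h0 hnn (hre _)
    have h2 := dist_eshift h hb (r := k * L) (by positivity) h0 hnn (hre _)
    have hz' : dd (eshift dd x (j * L) ω 0) z ≤ R :=
      visited_subset (vball dd _ R) _ hz
    have hw' : dd (eshift dd x (k * L) ω 0) w ≤ R :=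
      visited_subset (vball dd _ R) _ hw
    have t1 := h.dd_triangle x (eshift dd x (j * L) ω 0) z
    have t2 := h.dd_triangle x w (eshift dd x (k * L) ω 0)
    have t3 := h.dd_triangle x z w
    rw [h.dd_symm w] at t2
    have hjk' : (j : ℝ) ≤ k := by exact_mod_cast hjk
    rw [abs_sub_comm, abs_of_nonneg (by linarith)]
    nlinarith
  rcases le_total j k with hle | hle
  · exact key j k z w hle hz hw
  · rw [abs_sub_comm, h.dd_symm]
    exact key k j w z hle hw hz

lemma pieceAt_subset (h : Standing lam dd P α ν c₃ C₃) (hb : Bounds lam dd P α ν c C)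
    {x : V} {r R N : ℝ} {ω : ℕ → V} (hr : 0 ≤ r) (hR : 0 ≤ R) (hN : r + C + R ≤ N) (h0 : ω 0 = x)
    (hnn : ∀ i, 0 < lam (ω i) (ω (i + 1))) (hre : ∃ n, r ≤ dd x (ω n)) :
    pieceAt dd x R r ω ⊆ visited (vball dd x N) ω :=
  visited_eshift_subset h hb hr hR hN h0 hnn hre

end Combination

section UpperBounds

variable {lam dd : V → V → ℝ} {P : V → Measure (ℕ → V)} {α ν c₃ C₃ c C : ℝ}
variable [Countable V] [MeasurableSingletonClass V]

lemma sum_erase_dist_le (f : ℕ → ℝ) (hf : ∀ n, 0 ≤ f n) {j M : ℕ} (hj : j < M) :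
    ∑ k ∈ (Finset.range M).erase j, f (Nat.dist j k) ≤ 2 * ∑ i ∈ Finset.range M, f (i + 1) := by
  classical
  have hsub : (Finset.range M).erase j = Finset.range j ∪ Finset.Ico (j + 1) M := by
    ext k; simp only [Finset.mem_erase, Finset.mem_range, Finset.mem_union, Finset.mem_Ico]; omega
  have hdis : Disjoint (Finset.range j) (Finset.Ico (j + 1) M) := by
    rw [Finset.disjoint_left]; intro k; simp only [Finset.mem_range, Finset.mem_Ico]; omega
  rw [hsub, Finset.sum_union hdis, two_mul]
  refine add_le_add ?_ ?_
  · rw [← Finset.sum_range_reflect]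
    calc _ = ∑ i ∈ Finset.range j, f (i + 1) := by
          refine Finset.sum_congr rfl fun i hi => ?_
          rw [Finset.mem_range] at hi
          congr 1
          rw [Nat.dist_eq_sub_of_le_right (by omega)]; omega
      _ ≤ _ := Finset.sum_le_sum_of_subset_of_nonneg
          (Finset.range_subset_range.2 hj.le) fun i _ _ => hf _
  · rw [Finset.sum_Ico_eq_sum_range]
    calc _ = ∑ i ∈ Finset.range (M - (j + 1)), f (i + 1) := by
          refine Finset.sum_congr rfl fun i _ => ?_
          congr 1
          rw [Nat.dist_eq_sub_of_le (by omega)]; omega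
      _ ≤ _ := Finset.sum_le_sum_of_subset_of_nonneg
          (Finset.range_subset_range.2 (by omega)) fun i _ _ => hf _

lemma cast_dist (j k : ℕ) : ((Nat.dist j k : ℕ) : ℝ) = |(j : ℝ) - k| := by
  rcases le_total j k with hle | hle
  · rw [Nat.dist_eq_sub_of_le hle, Nat.cast_sub hle, abs_sub_comm, abs_of_nonneg]
    have : (j : ℝ) ≤ k := by exact_mod_cast hle
    linarith
  · rw [Nat.dist_eq_sub_of_le_right hle, Nat.cast_sub hle, abs_of_nonneg]
    have : (k : ℝ) ≤ j := by exact_mod_cast hle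
    linarith

lemma Standing.ae_regular (h : Standing lam dd P α ν c₃ C₃) (hb : Bounds lam dd P α ν c C) (x : V) :
    ∀ᵐ ω ∂(P x), ω 0 = x ∧ (∀ i, 0 < lam (ω i) (ω (i + 1))) ∧ ∀ r, ∃ n, r ≤ dd x (ω n) := by
  filter_upwards [h.ae_start x, h.ae_nn x, h.ae_reach hb x x] with ω h1 h2 h3
  exact ⟨h1, h2, h3⟩

lemma lintegral_ite_le {Ω : Type*} [MeasurableSpace Ω] (μ : Measure Ω) [IsProbabilityMeasure μ]
    {S : Set Ω} (hS : MeasurableSet S) {a b p : ℝ} (ha : 0 ≤ a) (hab : a ≤ b)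
    (hp : ENNReal.ofReal p ≤ μ S) :
    ∫⁻ ω, (if ω ∈ S then ENNReal.ofReal a else ENNReal.ofReal b) ∂μ
      ≤ ENNReal.ofReal (b - (b - a) * p) := by
  have h1 : (fun ω => if ω ∈ S then ENNReal.ofReal a else ENNReal.ofReal b) =
      S.piecewise (fun _ => ENNReal.ofReal a) (fun _ => ENNReal.ofReal b) := by
    ext ω; simp [Set.piecewise]
  rw [h1, lintegral_piecewise hS]
  simp only [lintegral_const, Measure.restrict_apply MeasurableSet.univ, univ_inter]
  have h2 : μ S = ENNReal.ofReal (μ.real S) := (ofReal_measureReal).symm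
  have h3 : μ Sᶜ = ENNReal.ofReal (μ.real Sᶜ) := (ofReal_measureReal).symm
  have h4 : μ.real Sᶜ = 1 - μ.real S := by
    rw [measureReal_compl hS, probReal_univ]
  have h5 : p ≤ μ.real S := by
    rw [h2] at hp
    exact (ENNReal.ofReal_le_ofReal_iff measureReal_nonneg).1 hp
  have h6 : μ.real S ≤ 1 := measureReal_le_one
  rw [h2, h3, ← ENNReal.ofReal_mul ha, ← ENNReal.ofReal_mul (ha.trans hab),
    ← ENNReal.ofReal_add (mul_nonneg ha measureReal_nonneg)
      (mul_nonneg (ha.trans hab) measureReal_nonneg)]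
  refine ENNReal.ofReal_le_ofReal ?_
  rw [h4]
  nlinarith

lemma prod_ite_filter (s : Finset ℕ) (p : ℕ → Prop) [DecidablePred p] (a b : ℝ≥0∞) :
    ∏ k ∈ s, (if p k then a else b) =
      a ^ (s.filter p).card * b ^ (s.filter fun k => ¬ p k).card := by
  rw [Finset.prod_ite, Finset.prod_const, Finset.prod_const]

/-- Upper bound on the Laplace transform in terms of the energy of the walk at scale `R`. -/
lemma Standing.lintegral_exp_le_of_energy (h : Standing lam dd P α ν c₃ C₃)
    (hb : Bounds lam dd P α ν c C) (hν : 1 < ν) :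
    ∃ R₁ : ℝ, 1 ≤ R₁ ∧ ∀ T, 0 < T → ∃ c' : ℝ, 0 < c' ∧ ∀ u, 0 < u → ∀ R, R₁ ≤ R → ∀ Sg, 0 < Sg →
      R ^ (α - 2 * ν) ≤ Sg →
      (∀ w, ∑ z ∈ ballF dd w (2 * R), lamTot lam z * (1 + dd w z) ^ (-(2 * ν)) ≤ Sg) →
      u * R ^ ν ≤ T → ∀ N, 16 * R ≤ N → ∀ x,
      ∫⁻ ω, ENNReal.ofReal (Real.exp (-u * capa lam P (visited (vball dd x N) ω))) ∂(P x) ≤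
        ENNReal.ofReal (Real.exp (-(c' * (u * R ^ (α - ν) / Sg * (N / R))))) := by
  obtain ⟨R₀, θ, p, hR₀, hθ, hp0, hp1, hpiece⟩ := h.exists_piece hb
  have hC := hb.C_pos
  have hsm : Summable fun i : ℕ => ((i : ℝ) + 1) ^ (-ν) := by
    have := (summable_nat_add_iff 1).2 (Real.summable_nat_rpow.2 (by linarith : -ν < -1))
    simpa using this
  set Z : ℝ := ∑' i : ℕ, ((i : ℝ) + 1) ^ (-ν) with hZ
  have hZ0 : 0 ≤ Z := tsum_nonneg fun i => by positivity
  set B : ℝ := 1 + 2 * C * Z * θ with hB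
  have hB1 : 1 ≤ B := by
    have : 0 ≤ 2 * C * Z * θ := by positivity
    linarith
  refine ⟨max R₀ C, hR₀.trans (le_max_left _ _), fun T hT =>
    ⟨p * Real.exp (-(T * θ)) * θ / (32 * B), by positivity, ?_⟩⟩
  intro u hu R hR Sg hSg hRSg henergy huR N hN x
  have := h.prob x
  have hRR₀ : R₀ ≤ R := (le_max_left _ _).trans hR
  have hRC : C ≤ R := (le_max_right _ _).trans hR
  have hR1 : 1 ≤ R := hR₀.trans hRR₀
  have hR0 : 0 < R := by linarith
  set κ : ℝ := θ * R ^ (α - ν) / Sg with hκ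
  have hκ0 : 0 < κ := by positivity
  have hκle : κ ≤ θ * R ^ ν := by
    rw [hκ, div_le_iff₀ hSg, mul_assoc]
    refine mul_le_mul_of_nonneg_left ?_ hθ.le
    calc R ^ (α - ν) = R ^ ν * R ^ (α - 2 * ν) := by
          rw [← Real.rpow_add hR0]; congr 1; ring
      _ ≤ _ := mul_le_mul_of_nonneg_left hRSg (by positivity)
  set s : ℝ := u * κ / B with hs
  have hs0 : 0 < s := by positivity
  have hsT : s ≤ T * θ := by
    rw [hs, div_le_iff₀ (by positivity)]
    have h1 : u * κ ≤ T * θ := by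
      calc u * κ ≤ u * (θ * R ^ ν) := mul_le_mul_of_nonneg_left hκle hu.le
        _ = u * R ^ ν * θ := by ring
        _ ≤ _ := mul_le_mul_of_nonneg_right huR hθ.le
    have h2 : 0 ≤ T * θ := by positivity
    nlinarith
  set M : ℕ := ⌊N / (16 * R)⌋₊ with hM
  have hNR : 1 ≤ N / (16 * R) := by rw [le_div_iff₀ (by positivity)]; linarith
  have hMle : (M : ℝ) ≤ N / (16 * R) := Nat.floor_le (by linarith)
  have hMge : N / (32 * R) ≤ M := by
    have h1 : (1 : ℝ) ≤ M := by
      exact_mod_cast Nat.one_le_iff_ne_zero.2 (Nat.floor_pos.2 hNR).ne'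
    have h2 := Nat.lt_floor_add_one (N / (16 * R))
    have h3 : N / (32 * R) = N / (16 * R) / 2 := by field_simp; ring
    rw [h3]; linarith
  set L : ℝ := 8 * R with hL
  have hML : ∀ k : ℕ, k < M → k * L + C + R ≤ N := by
    intro k hk
    have h1 : (k : ℝ) + 1 ≤ M := by exact_mod_cast hk
    have h2 : (M : ℝ) * (16 * R) ≤ N := by rwa [le_div_iff₀ (by positivity)] at hMle
    rw [hL]; nlinarith [Nat.cast_nonneg (α := ℝ) k]
  set φ : V → Set V → ℝ≥0∞ := fun _ S =>
    if κ ≤ capa lam P S then ENNReal.ofReal (Real.exp (-s)) else ENNReal.ofReal 1 with hφ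
  set q : ℝ := 1 - (1 - Real.exp (-s)) * p with hq
  have hexp1 : Real.exp (-s) ≤ 1 := Real.exp_le_one_iff.2 (by linarith)
  have hq0 : 0 ≤ q := by
    have := Real.exp_pos (-s)
    rw [hq]; nlinarith
  have hmom := h.lintegral_prod_ballTrace_le hb x hR0.le (by rw [hL]; linarith : C + R < L) φ
    (q := ENNReal.ofReal q) (fun y => by
      have := h.prob y
      have hmeas : MeasurableSet {ω | κ ≤ capa lam P (visited (vball dd y R) ω)} :=
        measurableSet_le measurable_const (measurable_visited (hb.finite y R) (capa lam P))
      have := lintegral_ite_le (P y) hmeas (Real.exp_pos (-s)).le hexp1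
        (hpiece R hRR₀ Sg hSg henergy y)
      simpa only [Set.mem_ofPred_eq] using this) M
  have hpt : ∀ᵐ ω ∂(P x),
      ENNReal.ofReal (Real.exp (-u * capa lam P (visited (vball dd x N) ω))) ≤
        ∏ k ∈ Finset.range M, ballTrace dd R φ (eshift dd x (k * L) ω) := by
    filter_upwards [h.ae_regular hb x] with ω hω
    obtain ⟨h0, hnn, hre⟩ := hω
    have hprod : ∏ k ∈ Finset.range M, ballTrace dd R φ (eshift dd x (k * L) ω) =
        ∏ k ∈ Finset.range M, if κ ≤ capa lam P (pieceAt dd x R (k * L) ω) then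
          ENNReal.ofReal (Real.exp (-s)) else ENNReal.ofReal 1 := rfl
    rw [hprod, prod_ite_filter, ENNReal.ofReal_one, one_pow, mul_one]
    set K : Finset ℕ := (Finset.range M).filter fun k : ℕ =>
    κ ≤ capa lam P (pieceAt dd x R (k * L) ω) with hK
    have hKM : ∀ k ∈ K, k < M ∧ κ ≤ capa lam P (pieceAt dd x R (k * L) ω) := fun k hk => by
      simpa [hK] using hk
    have hcard := h.card_le_mul_capa (hb.visited_finite x N ω) K
      (fun k => pieceAt dd x R (k * L) ω)
      (fun k hk => pieceAt_subset h hb (by positivity) hR0.le (hML k (hKM k hk).1) h0 hnn (hre _))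
      hκ0 (I := 2 * C * Z * R ^ (-ν)) (by positivity) (fun k hk => (hKM k hk).2)
      (fun j k => C * R ^ (-ν) * (Nat.dist j k : ℝ) ^ (-ν)) ?_ ?_
    · have hBκ : 1 / κ + 2 * C * Z * R ^ (-ν) ≤ B / κ := by
        rw [hB, add_div]
        refine add_le_add le_rfl ?_
        rw [le_div_iff₀ hκ0]
        have h1 : R ^ (-ν) * R ^ ν = 1 := by
          rw [← Real.rpow_add hR0]; simp
        calc 2 * C * Z * R ^ (-ν) * κ ≤ 2 * C * Z * R ^ (-ν) * (θ * R ^ ν) :=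
              mul_le_mul_of_nonneg_left hκle (by positivity)
          _ = 2 * C * Z * θ * (R ^ (-ν) * R ^ ν) := by ring
          _ = _ := by rw [h1, mul_one]
      have h1 := hcard.trans (mul_le_mul_of_nonneg_right hBκ (h.capa_nonneg _))
      rw [← ENNReal.ofReal_pow (Real.exp_pos _).le, ← Real.exp_nat_mul]
      refine ENNReal.ofReal_le_ofReal (Real.exp_le_exp.2 ?_)
      have h2 : (K.card : ℝ) * s ≤ u * capa lam P (visited (vball dd x N) ω) := by
        calc (K.card : ℝ) * s ≤ B / κ * capa lam P (visited (vball dd x N) ω) * s :=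
              mul_le_mul_of_nonneg_right h1 hs0.le
          _ = _ := by rw [hs]; field_simp
      linarith
    · intro j _ k _ hjk z hz w hw
      have h1 := dist_pieceAt h hb h0 hnn hre (by positivity : 0 ≤ L) hz hw
      have h2 : (1 : ℝ) ≤ Nat.dist j k := by
        exact_mod_cast Nat.dist_pos_of_ne hjk
      rw [← cast_dist] at h1
      have h3 : (Nat.dist j k : ℝ) * R ≤ 1 + dd z w := by rw [hL] at h1; nlinarith
      calc green lam P z w ≤ C * (1 + dd z w) ^ (-ν) := hb.green_le z w
        _ ≤ C * ((Nat.dist j k : ℝ) * R) ^ (-ν) :=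
            mul_le_mul_of_nonneg_left
              (Real.rpow_le_rpow_of_nonpos (by positivity) h3 (by linarith)) hC.le
        _ = _ := by rw [Real.mul_rpow (by positivity) hR0.le]; ring
    · intro j hj
      have hj' := (hKM j hj).1
      rw [← Finset.mul_sum]
      have h1 : ∑ k ∈ K.erase j, (Nat.dist j k : ℝ) ^ (-ν) ≤ 2 * Z := by
        calc _ ≤ ∑ k ∈ (Finset.range M).erase j, (Nat.dist j k : ℝ) ^ (-ν) :=
              Finset.sum_le_sum_of_subset_of_nonneg
                (Finset.erase_subset_erase _ (Finset.filter_subset _ _))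
                fun i _ _ => by positivity
          _ ≤ 2 * ∑ i ∈ Finset.range M, (((i + 1 : ℕ) : ℝ)) ^ (-ν) :=
              sum_erase_dist_le (fun n => (n : ℝ) ^ (-ν)) (fun n => by positivity) hj'
          _ ≤ 2 * Z := by
              refine mul_le_mul_of_nonneg_left ?_ (by norm_num)
              simp only [Nat.cast_add, Nat.cast_one]
              exact hsm.sum_le_tsum _ fun i _ => by positivity
      calc _ ≤ C * R ^ (-ν) * (2 * Z) := mul_le_mul_of_nonneg_left h1 (by positivity)
        _ = _ := by ring
  refine (lintegral_mono_ae hpt).trans (hmom.trans ?_)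
  rw [← ENNReal.ofReal_pow hq0]
  refine ENNReal.ofReal_le_ofReal ?_
  have hq1 : q ≤ Real.exp (-(p * Real.exp (-(T * θ)) * s)) := by
    have h1 : s * Real.exp (-s) ≤ 1 - Real.exp (-s) := by
      have h2 := Real.add_one_le_exp s
      have h3 : Real.exp s * Real.exp (-s) = 1 := by rw [← Real.exp_add]; simp
      have h4 := Real.exp_pos (-s)
      nlinarith
    have h2 : Real.exp (-(T * θ)) ≤ Real.exp (-s) := Real.exp_le_exp.2 (by linarith)
    have h3 := Real.add_one_le_exp (-(p * Real.exp (-(T * θ)) * s))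
    have h4 : s * Real.exp (-(T * θ)) ≤ 1 - Real.exp (-s) :=
      (mul_le_mul_of_nonneg_left h2 hs0.le).trans h1
    rw [hq]; nlinarith
  calc q ^ M ≤ Real.exp (-(p * Real.exp (-(T * θ)) * s)) ^ M := pow_le_pow_left₀ hq0 hq1 M
    _ = Real.exp (-(p * Real.exp (-(T * θ)) * s * M)) := by
        rw [← Real.exp_nat_mul]; congr 1; ring
    _ ≤ _ := by
        refine Real.exp_le_exp.2 (neg_le_neg ?_)
        calc _ = p * Real.exp (-(T * θ)) * s * (N / (32 * R)) := by
              rw [hs, hκ]; field_simp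
          _ ≤ _ := mul_le_mul_of_nonneg_left hMge (by positivity)

end UpperBounds

section UpperGtOne

variable {lam dd : V → V → ℝ} {P : V → Measure (ℕ → V)} {α ν c₃ C₃ c C : ℝ}
variable [Countable V] [MeasurableSingletonClass V]

/-- Upper bounds on the Laplace transform when `1 < ν`. -/
lemma Standing.upper_of_one_lt (h : Standing lam dd P α ν c₃ C₃)
    (hb : Bounds lam dd P α ν c C) (hν : 1 < ν) {u₀ : ℝ} (hu₀ : 0 < u₀) :
    ∃ C' c' : ℝ, 0 < C' ∧ 0 < c' ∧ ∀ u, 0 < u → u ≤ u₀ → ∀ N, C' * u ^ (-(1 / ν)) ≤ N → ∀ x,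
      (2 * ν < α →
        ∫⁻ ω, ENNReal.ofReal (Real.exp (-u * capa lam P (visited (vball dd x N) ω))) ∂(P x) ≤
        ENNReal.ofReal (Real.exp (-(c' * (N * u ^ (1 / ν)))))) ∧
      (α = 2 * ν →
        ∫⁻ ω, ENNReal.ofReal (Real.exp (-u * capa lam P (visited (vball dd x N) ω))) ∂(P x) ≤
        ENNReal.ofReal (Real.exp (-(c' * (N * u ^ (1 / ν) / max 1 (Real.log (1 / u))))))) ∧
      (α < 2 * ν →
        ∫⁻ ω, ENNReal.ofReal (Real.exp (-u * capa lam P (visited (vball dd x N) ω))) ∂(P x) ≤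
        ENNReal.ofReal (Real.exp (-(c' * (N * u ^ ((1 - α + 2 * ν) / ν)))))) := by
  have hν0 := h.nu_pos
  obtain ⟨R₁, hR₁, hmain⟩ := h.lintegral_exp_le_of_energy hb hν
  have hR₁0 : 0 < R₁ := by linarith
  set K : ℝ := R₁ * u₀ ^ (1 / ν) with hK
  have hK0 : 0 < K := by positivity
  obtain ⟨c₁, hc₁, hmain⟩ := hmain (K ^ ν) (by positivity)
  have hRge : ∀ u, 0 < u → u ≤ u₀ → R₁ ≤ K * u ^ (-(1 / ν)) := by
    intro u hu huu
    have h1 : u₀ ^ (-(1 / ν)) ≤ u ^ (-(1 / ν)) :=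
      Real.rpow_le_rpow_of_nonpos hu huu (by simp; positivity)
    calc R₁ = R₁ * (u₀ ^ (1 / ν) * u₀ ^ (-(1 / ν))) := by
          rw [← Real.rpow_add hu₀]; simp
      _ ≤ R₁ * (u₀ ^ (1 / ν) * u ^ (-(1 / ν))) := by gcongr
      _ = _ := by rw [hK]; ring
  have hpow : ∀ u, 0 < u → ∀ b : ℝ, (K * u ^ (-(1 / ν))) ^ b = K ^ b * u ^ (-(b / ν)) := by
    intro u hu b
    rw [Real.mul_rpow hK0.le (by positivity), ← Real.rpow_mul hu.le]
    congr 2; ring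
  have huR : ∀ u, 0 < u → u * (K * u ^ (-(1 / ν))) ^ ν = K ^ ν := by
    intro u hu
    rw [hpow u hu, div_self hν0.ne', Real.rpow_neg_one]; field_simp
  have key : ∃ A : ℝ, 1 ≤ A ∧ (2 * ν < α → ∀ y r, 1 ≤ r → ∑ z ∈ ballF dd y (2 * r),
        lamTot lam z * (1 + dd y z) ^ (-(2 * ν)) ≤ A * r ^ (α - 2 * ν)) ∧
      (α = 2 * ν → ∀ y r, 1 ≤ r → ∑ z ∈ ballF dd y (2 * r),
        lamTot lam z * (1 + dd y z) ^ (-(2 * ν)) ≤ A * (1 + Real.log (2 * r))) ∧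
      (α < 2 * ν → ∀ y r, 1 ≤ r → ∑ z ∈ ballF dd y (2 * r),
        lamTot lam z * (1 + dd y z) ^ (-(2 * ν)) ≤ A) := by
    rcases lt_trichotomy (2 * ν) α with hlt | heq | hgt
    · obtain ⟨A, hA, hsum⟩ := h.kernel_sum_of_lt hb (by positivity : 0 < 2 * ν) hlt
      refine ⟨max 1 (A * 2 ^ (α - 2 * ν)), le_max_left _ _, fun _ y r hr => ?_,
        fun h1 => absurd h1 (by linarith), fun h1 => absurd h1 (by linarith)⟩
      refine (hsum y (2 * r) (by linarith)).trans ?_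
      rw [Real.mul_rpow (by norm_num) (by linarith), ← mul_assoc]
      exact mul_le_mul_of_nonneg_right (le_max_right _ _) (Real.rpow_nonneg (by linarith) _)
    · obtain ⟨A, hA, hsum⟩ := h.kernel_sum_of_eq hb (by positivity : 0 < 2 * ν) heq
      refine ⟨max 1 A, le_max_left _ _, fun h1 => absurd h1 (by linarith), fun _ y r hr => ?_,
        fun h1 => absurd h1 (by linarith)⟩
      refine (hsum y (2 * r) (by linarith)).trans ?_
      have := Real.log_nonneg (by linarith : 1 ≤ 2 * r)
      exact mul_le_mul_of_nonneg_right (le_max_right _ _) (by linarith)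
    · obtain ⟨A, hA, hsum⟩ := h.kernel_sum_of_gt hb (by positivity : 0 < 2 * ν) hgt
      exact ⟨max 1 A, le_max_left _ _, fun h1 => absurd h1 (by linarith),
        fun h1 => absurd h1 (by linarith),
        fun _ y r hr => (hsum y (2 * r) (by linarith)).trans (le_max_right _ _)⟩
  obtain ⟨A, hA1, hA⟩ := key
  have hA0 : 0 < A := by linarith
  set Bl : ℝ := 1 + |Real.log (2 * K)| + 1 / ν with hBl
  have hBl0 : 0 < Bl := by positivity
  refine ⟨16 * K, c₁ / A * min (K ^ (ν - 1)) (min (K ^ (ν - 1) / Bl) (K ^ (α - ν - 1))),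
    by positivity, by positivity, fun u hu huu N hN x => ?_⟩
  set R : ℝ := K * u ^ (-(1 / ν)) with hR
  have hRR₁ := hRge u hu huu
  have hR1 : 1 ≤ R := hR₁.trans hRR₁
  have hR0 : 0 < R := by linarith
  have hNR : 16 * R ≤ N := by rw [hR]; linarith
  have hN0 : 0 < N := by linarith
  have hdivR : ∀ b : ℝ, R ^ b * (N / R) = R ^ (b - 1) * N := by
    intro b; rw [Real.rpow_sub_one hR0.ne']; field_simp
  refine ⟨fun hlt => ?_, fun heq => ?_, fun hgt => ?_⟩
  · refine (hmain u hu R hRR₁ (A * R ^ (α - 2 * ν)) (by positivity) ?_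
      (fun w => hA.1 hlt w R hR1) (huR u hu).le N hNR x).trans
      (ENNReal.ofReal_le_ofReal (Real.exp_le_exp.2 (neg_le_neg ?_)))
    · exact le_mul_of_one_le_left (by positivity) hA1
    · have e1 : u * R ^ (α - ν) / (A * R ^ (α - 2 * ν)) * (N / R) =
          1 / A * (K ^ (ν - 1) * (N * u ^ (1 / ν))) := by
        have : R ^ (α - ν) = R ^ ν * R ^ (α - 2 * ν) := by
          rw [← Real.rpow_add hR0]; congr 1; ring
        have h2 : u * R ^ (α - ν) / (A * R ^ (α - 2 * ν)) * (N / R) =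
          1 / A * (u * (R ^ ν * (N / R))) := by rw [this]; field_simp
        rw [h2, hdivR, hR, hpow u hu]
        have h3 : u * u ^ (-((ν - 1) / ν)) = u ^ (1 / ν) := by
          nth_rewrite 1 [← Real.rpow_one u]
          rw [← Real.rpow_add hu]; congr 1; field_simp; ring
        rw [← h3]; ring
      rw [e1]
      calc c₁ / A * min (K ^ (ν - 1)) _ * (N * u ^ (1 / ν))
          ≤ c₁ / A * K ^ (ν - 1) * (N * u ^ (1 / ν)) := by
            gcongr; exact min_le_left _ _
        _ = _ := by ring
  · set Λ := max 1 (Real.log (1 / u)) with hΛ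
    have hΛ1 : 1 ≤ Λ := le_max_left _ _
    have hlog : 1 + Real.log (2 * R) ≤ Bl * Λ := by
      have h1 : Real.log (2 * R) = Real.log (2 * K) + 1 / ν * Real.log (1 / u) := by
        rw [hR, ← mul_assoc, Real.log_mul (by positivity) (by positivity), Real.log_rpow hu,
          one_div u, Real.log_inv]; ring
      have h2 : Real.log (1 / u) ≤ Λ := le_max_right _ _
      have h3 := le_abs_self (Real.log (2 * K))
      have h4 : 1 / ν * Real.log (1 / u) ≤ 1 / ν * Λ :=
        mul_le_mul_of_nonneg_left h2 (by positivity)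
      have h5 := abs_nonneg (Real.log (2 * K))
      rw [h1, hBl]; nlinarith
    have hlog0 := Real.log_nonneg (by linarith : 1 ≤ 2 * R)
    refine (hmain u hu R hRR₁ (A * (Bl * Λ)) (by positivity) ?_
      (fun w => (hA.2.1 heq w R hR1).trans (mul_le_mul_of_nonneg_left hlog hA0.le))
      (huR u hu).le N hNR x).trans
      (ENNReal.ofReal_le_ofReal (Real.exp_le_exp.2 (neg_le_neg ?_)))
    · rw [heq, sub_self, Real.rpow_zero]; nlinarith
    · have e1 : u * R ^ (α - ν) / (A * (Bl * Λ)) * (N / R) =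
          1 / A * (K ^ (ν - 1) / Bl * (N * u ^ (1 / ν) / Λ)) := by
        have h2 : u * R ^ (α - ν) / (A * (Bl * Λ)) * (N / R) =
          1 / A / Bl / Λ * (u * (R ^ (α - ν) * (N / R))) := by field_simp
        rw [h2, hdivR, hR, hpow u hu]
        have h3 : u * u ^ (-((α - ν - 1) / ν)) = u ^ (1 / ν) := by
          nth_rewrite 1 [← Real.rpow_one u]
          rw [← Real.rpow_add hu, heq]; congr 1; field_simp; ring
        have h4 : α - ν - 1 = ν - 1 := by linarith
        rw [← h3, h4]; field_simp
      rw [e1]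
      calc c₁ / A * min (K ^ (ν - 1)) (min (K ^ (ν - 1) / Bl) _) * (N * u ^ (1 / ν) / Λ)
          ≤ c₁ / A * (K ^ (ν - 1) / Bl) * (N * u ^ (1 / ν) / Λ) := by
            gcongr; exact (min_le_right _ _).trans (min_le_left _ _)
        _ = _ := by ring
  · refine (hmain u hu R hRR₁ A hA0 ?_
      (fun w => hA.2.2 hgt w R hR1) (huR u hu).le N hNR x).trans
      (ENNReal.ofReal_le_ofReal (Real.exp_le_exp.2 (neg_le_neg ?_)))
    · exact (Real.rpow_le_one_of_one_le_of_nonpos hR1 (by linarith)).trans hA1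
    · have e1 : u * R ^ (α - ν) / A * (N / R) =
          1 / A * (K ^ (α - ν - 1) * (N * u ^ ((1 - α + 2 * ν) / ν))) := by
        have h2 : u * R ^ (α - ν) / A * (N / R) =
          1 / A * (u * (R ^ (α - ν) * (N / R))) := by field_simp
        rw [h2, hdivR, hR, hpow u hu]
        have h3 : u * u ^ (-((α - ν - 1) / ν)) = u ^ ((1 - α + 2 * ν) / ν) := by
          nth_rewrite 1 [← Real.rpow_one u]
          rw [← Real.rpow_add hu]; congr 1; field_simp; ring
        rw [← h3]; ring
      rw [e1]
      calc c₁ / A * min (K ^ (ν - 1)) (min (K ^ (ν - 1) / Bl) (K ^ (α - ν - 1))) * (N * _)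
          ≤ c₁ / A * (K ^ (α - ν - 1)) * (N * u ^ ((1 - α + 2 * ν) / ν)) := by
            gcongr; exact (min_le_right _ _).trans (min_le_right _ _)
        _ = _ := by ring

end UpperGtOne

section UpperEqOne

variable {lam dd : V → V → ℝ} {P : V → Measure (ℕ → V)} {α ν c₃ C₃ c C : ℝ}
variable [Countable V] [MeasurableSingletonClass V]

/-- With probability close to one the trace in a ball has capacity comparable to the ball. -/
lemma Standing.exists_capa_lt_le (h : Standing lam dd P α ν c₃ C₃)
    (hb : Bounds lam dd P α ν c C) (hα : 2 * ν < α) {q : ℝ} (hq : 0 < q) :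
    ∃ R₀ κ : ℝ, 1 ≤ R₀ ∧ 0 < κ ∧ ∀ R, R₀ ≤ R → ∀ y,
      P y {ω | capa lam P (visited (vball dd y R) ω) < κ * R ^ ν} ≤ ENNReal.ofReal q := by
  have hν := h.nu_pos
  have hC := hb.C_pos
  obtain ⟨R₁, θ, p, hR₁, hθ, hp0, hp1, hpiece⟩ := h.exists_piece hb
  obtain ⟨A, hA, hsum⟩ := h.kernel_sum_of_lt hb (by positivity : 0 < 2 * ν) hα
  obtain ⟨m', hm'⟩ := exists_pow_lt_of_lt_one hq (by linarith : 1 - p < 1)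
  set m := m' + 1 with hm
  have hmq : (1 - p) ^ m ≤ q :=
    (pow_le_pow_of_le_one (by linarith) (by linarith) (Nat.le_succ m')).trans hm'.le
  have hm1 : (1 : ℝ) ≤ m := by exact_mod_cast Nat.le_add_left 1 m'
  set κ₀ : ℝ := θ / (A * 2 ^ (α - 2 * ν)) with hκ₀
  have hκ₀0 : 0 < κ₀ := by positivity
  refine ⟨3 * m * max R₁ C, κ₀ * (1 / (3 * m)) ^ ν, ?_, by positivity, fun R hR x => ?_⟩
  · have : 1 ≤ max R₁ C := hR₁.trans (le_max_left _ _)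
    nlinarith
  have := h.prob x
  set r := R / (3 * m) with hr
  have hrm : max R₁ C ≤ r := by rw [hr, le_div_iff₀ (by positivity)]; linarith
  have hrR₁ : R₁ ≤ r := (le_max_left _ _).trans hrm
  have hrC : C ≤ r := (le_max_right _ _).trans hrm
  have hr1 : 1 ≤ r := hR₁.trans hrR₁
  have hr0 : 0 < r := by linarith
  have hRr : R = 3 * m * r := by rw [hr]; field_simp
  have hκR : κ₀ * (1 / (3 * m)) ^ ν * R ^ ν = κ₀ * r ^ ν := by
    rw [mul_assoc, ← Real.mul_rpow (by positivity) (by rw [hRr]; positivity), hr]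
    congr 2; ring
  rw [hκR]
  set φ : V → Set V → ℝ≥0∞ := fun _ S =>
    if κ₀ * r ^ ν ≤ capa lam P S then ENNReal.ofReal 0 else ENNReal.ofReal 1 with hφ
  have hmom := h.lintegral_prod_ballTrace_le hb x hr0.le (by linarith : C + r < 3 * r) φ
    (q := ENNReal.ofReal (1 - p)) (fun y => by
      have := h.prob y
      have hmeas : MeasurableSet {ω | κ₀ * r ^ ν ≤ capa lam P (visited (vball dd y r) ω)} :=
        measurableSet_le measurable_const (measurable_visited (hb.finite y r) (capa lam P))
      have h1 := hpiece r hrR₁ (A * (2 * r) ^ (α - 2 * ν)) (by positivity)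
        (fun w => hsum w (2 * r) (by linarith)) y
      have h2 : θ * r ^ (α - ν) / (A * (2 * r) ^ (α - 2 * ν)) = κ₀ * r ^ ν := by
        have h3 : r ^ (α - ν) = r ^ ν * r ^ (α - 2 * ν) := by
          rw [← Real.rpow_add hr0]; congr 1; ring
        rw [Real.mul_rpow (by norm_num) hr0.le, h3, hκ₀]; field_simp
      rw [h2] at h1
      have := lintegral_ite_le (P y) hmeas le_rfl zero_le_one h1
      simpa only [Set.mem_ofPred_eq, sub_zero, one_mul] using this) m
  have hmeas' : MeasurableSet {ω | capa lam P (visited (vball dd x R) ω) < κ₀ * r ^ ν} :=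
    measurableSet_lt (measurable_visited (hb.finite x R) (capa lam P)) measurable_const
  rw [← lintegral_indicator_one hmeas']
  refine (lintegral_mono_ae ?_).trans (hmom.trans ?_)
  · filter_upwards [h.ae_regular hb x] with ω hω
    obtain ⟨h0, hnn, hre⟩ := hω
    by_cases hlt : capa lam P (visited (vball dd x R) ω) < κ₀ * r ^ ν
    · rw [Set.indicator_of_mem (by exact hlt)]
      refine le_of_eq ?_
      symm
      refine Finset.prod_eq_one fun k hk => ?_
      have hk' : (k : ℝ) + 1 ≤ m := by exact_mod_cast Finset.mem_range.1 hk
      have hsub := pieceAt_subset h hb (r := k * (3 * r)) (R := r) (N := R) (by positivity) hr0.le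
        (by rw [hRr]; nlinarith) h0 hnn (hre _)
      have hle := (h.capa_mono hsub (hb.visited_finite x R ω)).trans_lt hlt
      have : ballTrace dd r φ (eshift dd x (k * (3 * r)) ω) =
        if κ₀ * r ^ ν ≤ capa lam P (pieceAt dd x r (k * (3 * r)) ω) then ENNReal.ofReal 0
          else ENNReal.ofReal 1 := rfl
      rw [this, if_neg (not_le.2 hle), ENNReal.ofReal_one]
    · rw [Set.indicator_of_notMem (by exact hlt)]
      exact zero_le
  · rw [← ENNReal.ofReal_pow (by linarith)]
    exact ENNReal.ofReal_le_ofReal hmq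

lemma eventually_exp_add_exp_le {K a b ε γ : ℝ} (hK : 0 < K) (ha : 0 < a)
    (hγ : γ < (1 - ε) / a) :
    ∀ᶠ X in atTop, Real.exp (-((1 - ε) * (X - K) / (b + a * Real.log X))) +
      Real.exp (-(X / K - 1)) ≤ Real.exp (-(γ * (X / Real.log X))) := by
  obtain ⟨γ₁, hγ₁, hγ₁'⟩ := exists_between hγ
  have hlog := Real.tendsto_log_atTop
  have hinv : Tendsto (fun X : ℝ => X⁻¹) atTop (𝓝 0) := tendsto_inv_atTop_zero
  have hlinv : Tendsto (fun X : ℝ => (Real.log X)⁻¹) atTop (𝓝 0) :=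
    tendsto_inv_atTop_zero.comp hlog
  have t1 : Tendsto (fun X : ℝ => (1 - ε) * (1 - K * X⁻¹) / (b * (Real.log X)⁻¹ + a)) atTop
      (𝓝 ((1 - ε) * (1 - K * 0) / (b * 0 + a))) := by
    refine Tendsto.div ((tendsto_const_nhds).mul (tendsto_const_nhds.sub (hinv.const_mul K)))
      ((hlinv.const_mul b).add_const a) (by simpa using ha.ne')
  simp only [mul_zero, sub_zero, mul_one, zero_add] at t1
  have t2 : Tendsto (fun X : ℝ => K⁻¹ - X⁻¹ - γ₁ * (Real.log X)⁻¹) atTop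
      (𝓝 (K⁻¹ - 0 - γ₁ * 0)) := (tendsto_const_nhds.sub hinv).sub (hlinv.const_mul γ₁)
  simp only [sub_zero, mul_zero] at t2
  have t3 : Tendsto (fun X : ℝ => (X * (Real.log X)⁻¹)) atTop atTop := by
    have hl0 : Tendsto (fun X : ℝ => Real.log X / X) atTop (𝓝[>] 0) := by
      refine tendsto_nhdsWithin_iff.2 ⟨Real.isLittleO_log_id_atTop.tendsto_div_nhds_zero, ?_⟩
      filter_upwards [eventually_gt_atTop 1] with X hX
      exact div_pos (Real.log_pos hX) (by linarith)
    refine (tendsto_inv_nhdsGT_zero.comp hl0).congr fun X => ?_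
    simp [div_eq_mul_inv, mul_comm]
  filter_upwards [t1.eventually_const_lt hγ₁', t2.eventually_const_lt (inv_pos.2 hK),
    (t3.const_mul_atTop (sub_pos.2 hγ₁)).eventually_ge_atTop (Real.log 2),
    hlog.eventually_gt_atTop 0, eventually_gt_atTop 0,
    (hlog.const_mul_atTop ha).eventually_gt_atTop (-b)] with X h1 h2 h3 h4 h5 h6
  rw [← div_eq_mul_inv] at h3
  have hd : 0 < b + a * Real.log X := by linarith
  have e1 : γ₁ * (X / Real.log X) ≤ (1 - ε) * (X - K) / (b + a * Real.log X) := by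
    have : (1 - ε) * (X - K) / (b + a * Real.log X) =
        (1 - ε) * (1 - K * X⁻¹) / (b * (Real.log X)⁻¹ + a) * (X / Real.log X) := by
      have hne : b * (Real.log X)⁻¹ + a ≠ 0 := by
        have : b * (Real.log X)⁻¹ + a = (b + a * Real.log X) / Real.log X := by field_simp
        rw [this]; positivity
      field_simp
    rw [this]
    exact mul_le_mul_of_nonneg_right h1.le (by positivity)
  have e2 : γ₁ * (X / Real.log X) ≤ X / K - 1 := by
    have : X / K - 1 - γ₁ * (X / Real.log X) = X * (K⁻¹ - X⁻¹ - γ₁ * (Real.log X)⁻¹) := by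
      field_simp
    have h7 : 0 ≤ X * (K⁻¹ - X⁻¹ - γ₁ * (Real.log X)⁻¹) := by positivity
    linarith
  calc _ ≤ Real.exp (-(γ₁ * (X / Real.log X))) + Real.exp (-(γ₁ * (X / Real.log X))) :=
        add_le_add (Real.exp_le_exp.2 (by linarith)) (Real.exp_le_exp.2 (by linarith))
    _ = Real.exp (Real.log 2 + -(γ₁ * (X / Real.log X))) := by
        rw [Real.exp_add, Real.exp_log two_pos]; ring
    _ ≤ _ := Real.exp_le_exp.2 (by linarith)

end UpperEqOne

section UpperEqOneMain

variable {lam dd : V → V → ℝ} {P : V → Measure (ℕ → V)} {α ν c₃ C₃ c C : ℝ}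
variable [Countable V] [MeasurableSingletonClass V]

lemma sum_inv_range_le (M : ℕ) :
    ∑ i ∈ Finset.range M, (((i + 1 : ℕ) : ℝ))⁻¹ ≤ 1 + Real.log M := by
  have := harmonic_le_one_add_log M
  rw [harmonic] at this
  push_cast at this ⊢
  exact this

set_option maxHeartbeats 1000000 in
/-- Upper bound on the Laplace transform when `ν = 1`. -/
lemma Standing.upper_of_eq_one (h : Standing lam dd P α ν c₃ C₃)
    (hb : Bounds lam dd P α ν c C) (hν : ν = 1) {u₀ η : ℝ} (hη0 : 0 < η)
    (hη : η ≤ 1 / 4) :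
    ∃ C' : ℝ, 0 < C' ∧ ∀ u, 0 < u → u ≤ u₀ → ∀ N, C' ≤ N * u → ∀ x,
      ∫⁻ ω, ENNReal.ofReal (Real.exp (-u * capa lam P (visited (vball dd x N) ω))) ∂(P x) ≤
        ENNReal.ofReal (Real.exp (-(1 / 2 / C₃ / (1 + η) *
          (N * u / max 1 (Real.log (N * u)))))) := by
  have hC := hb.C_pos
  have hC₃ := h.c₃_pos.trans_le h.c₃_le_C₃
  set ε : ℝ := η / 10 with hε
  have hε0 : 0 < ε := by positivity
  have hε1 : ε ≤ 1 / 40 := by rw [hε]; linarith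
  set s : ℝ := 2 / ε with hs
  have hs0 : 0 < s := by positivity
  have hsε : s * ε = 2 := by rw [hs]; field_simp
  obtain ⟨R₀, κ, hR₀, hκ, hcapa⟩ := h.exists_capa_lt_le hb
    (by have := h.nu_le; rw [hν] at *; linarith) (Real.exp_pos (-s))
  obtain ⟨D, hD, hgreen⟩ := h.exists_green_le hε0
  have hε3 : 0 < 1 - 3 * ε := by linarith
  set a : ℝ := 2 * ((1 + ε) * C₃ / (1 - 3 * ε)) with ha
  have ha0 : 0 < a := by positivity
  set b : ℝ := 1 / (κ * ε) + a with hbdef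
  have hb0 : 0 < b := by positivity
  set K : ℝ := max 1 (u₀ * (max (max R₀ C) D / ε / (1 - 3 * ε))) with hK
  have hK1 : 1 ≤ K := le_max_left _ _
  have hK0 : 0 < K := by linarith
  have hγ : 1 / 2 / C₃ / (1 + η) < (1 - ε) / a := by
    have e : (1 - ε) / a = (1 - ε) * (1 - 3 * ε) / (1 + ε) * (1 / 2 / C₃) := by
      rw [ha]; field_simp
    rw [e, div_eq_mul_inv _ (1 + η), mul_comm]
    refine mul_lt_mul_of_pos_right ?_ (by positivity)
    rw [inv_lt_iff_one_lt_mul₀ (by positivity), div_mul_eq_mul_div, one_lt_div (by positivity), hε]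
    nlinarith [mul_pos hη0 (by linarith : 0 < 1 / 2 - 37 / 100 * η), pow_pos hη0 3]
  have hev := (eventually_exp_add_exp_le (b := b) hK0 ha0 hγ).and
    ((Real.tendsto_log_atTop.eventually_ge_atTop 1).and
      (eventually_ge_atTop K))
  obtain ⟨C', hC'⟩ := (hev.and (eventually_ge_atTop 1)).exists_forall_of_atTop
  refine ⟨max C' 1, by positivity, fun u hu huu N hN x => ?_⟩
  set X : ℝ := N * u with hX
  obtain ⟨⟨hX1, hX2, hX3⟩, hX5⟩ := hC' X ((le_max_left _ _).trans hN)
  rw [max_eq_right hX2]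
  refine le_trans ?_ (ENNReal.ofReal_le_ofReal hX1)
  have := h.prob x
  set L : ℝ := K / u with hL
  have hL0 : 0 < L := by positivity
  set R : ℝ := ε * L with hR
  have hLge : max (max R₀ C) D / ε / (1 - 3 * ε) ≤ L := by
    rw [hL, le_div_iff₀ hu, mul_comm]
    exact (mul_le_mul_of_nonneg_right huu (by positivity)).trans (le_max_right _ _)
  have hmax : max (max R₀ C) D ≤ ε * ((1 - 3 * ε) * L) := by
    rw [div_div, div_le_iff₀ (by positivity)] at hLge
    linarith
  have hRge : max (max R₀ C) D ≤ R := by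
    refine hmax.trans (mul_le_mul_of_nonneg_left ?_ hε0.le)
    nlinarith
  have hRR₀ : R₀ ≤ R := (le_max_left _ _).trans ((le_max_left _ _).trans hRge)
  have hRC : C ≤ R := (le_max_right _ _).trans ((le_max_left _ _).trans hRge)
  have hLD : D ≤ (1 - 3 * ε) * L := by
    refine (le_max_right _ _).trans (hmax.trans ?_)
    have : 0 ≤ (1 - 3 * ε) * L := by positivity
    nlinarith
  have hR0 : 0 < R := by positivity
  set M : ℕ := ⌊X / K⌋₊ with hM
  have hXK : 1 ≤ X / K := by rwa [le_div_iff₀ hK0, one_mul]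
  have hMle : (M : ℝ) ≤ X / K := Nat.floor_le (by linarith)
  have hMge : X / K - 1 ≤ M := (Nat.sub_one_lt_floor _).le
  have hM1 : (1 : ℝ) ≤ M := by
    exact_mod_cast Nat.one_le_iff_ne_zero.2 (Nat.floor_pos.2 hXK).ne'
  have hMN : (M : ℝ) * L ≤ N := by
    rw [le_div_iff₀ hK0] at hMle
    rw [hL, ← mul_div_assoc, div_le_iff₀ hu]; exact hMle
  have hRL : C + 2 * R ≤ 3 * ε * L := by rw [hR] at *; linarith
  have hML : ∀ k : ℕ, k < M → k * L + C + R ≤ N := by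
    intro k hk
    have h1 : (k : ℝ) + 1 ≤ M := by exact_mod_cast hk
    nlinarith
  set κ' : ℝ := κ * R with hκ'
  have hκ'0 : 0 < κ' := by positivity
  set φ : V → Set V → ℝ≥0∞ := fun _ S =>
    if κ' ≤ capa lam P S then ENNReal.ofReal 1 else ENNReal.ofReal (Real.exp s) with hφ
  have hexp1 : 1 ≤ Real.exp s := Real.one_le_exp hs0.le
  have hmom := h.lintegral_prod_ballTrace_le hb x hR0.le (by nlinarith : C + R < L) φ
    (q := ENNReal.ofReal 2) (fun y => by
      have := h.prob y
      have hmeas : MeasurableSet {ω | κ' ≤ capa lam P (visited (vball dd y R) ω)} :=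
        measurableSet_le measurable_const (measurable_visited (hb.finite y R) (capa lam P))
      have h1 := hcapa R hRR₀ y
      rw [hν, Real.rpow_one] at h1
      have h2 : ENNReal.ofReal (1 - Real.exp (-s)) ≤
          P y {ω | κ' ≤ capa lam P (visited (vball dd y R) ω)} := by
        have h3 : {ω | κ' ≤ capa lam P (visited (vball dd y R) ω)} =
            {ω | capa lam P (visited (vball dd y R) ω) < κ * R}ᶜ := by
          ext ω; simp [hκ']
        rw [h3, prob_compl_eq_one_sub (measurableSet_lt
          (measurable_visited (hb.finite y R) (capa lam P)) measurable_const),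
          ENNReal.ofReal_sub _ (Real.exp_pos _).le, ENNReal.ofReal_one]
        exact tsub_le_tsub_left h1 1
      have h4 := lintegral_ite_le (P y) hmeas zero_le_one hexp1 h2
      simp only [Set.mem_ofPred_eq] at h4
      refine h4.trans (ENNReal.ofReal_le_ofReal ?_)
      have h5 : Real.exp s * Real.exp (-s) = 1 := by rw [← Real.exp_add]; simp
      nlinarith [Real.exp_pos (-s)]) M
  have hlogM : Real.log M ≤ Real.log X :=
    Real.log_le_log (by positivity) (hMle.trans (div_le_self (by linarith) hK1))
  have hlogM0 : 0 ≤ Real.log M := Real.log_nonneg hM1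
  have hden : 0 < b + a * Real.log X := by nlinarith
  set E₁ : ℝ := Real.exp (-((1 - ε) * (X - K) / (b + a * Real.log X))) with hE₁
  have hpt : ∀ᵐ ω ∂(P x),
      ENNReal.ofReal (Real.exp (-u * capa lam P (visited (vball dd x N) ω))) ≤
        ENNReal.ofReal E₁ + ENNReal.ofReal (Real.exp (-2 * M)) *
          ∏ k ∈ Finset.range M, ballTrace dd R φ (eshift dd x (k * L) ω) := by
    filter_upwards [h.ae_regular hb x] with ω hω
    obtain ⟨h0, hnn, hre⟩ := hω
    have hprod : ∏ k ∈ Finset.range M, ballTrace dd R φ (eshift dd x (k * L) ω) =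
        ∏ k ∈ Finset.range M, if κ' ≤ capa lam P (pieceAt dd x R (k * L) ω) then
          ENNReal.ofReal 1 else ENNReal.ofReal (Real.exp s) := rfl
    rw [hprod, prod_ite_filter, ENNReal.ofReal_one, one_pow, one_mul]
    have hcount := Finset.card_filter_add_card_filter_not (s := Finset.range M)
      (fun k : ℕ => κ' ≤ capa lam P (pieceAt dd x R (k * L) ω))
    rw [Finset.card_range] at hcount
    set J : Finset ℕ :=
      (Finset.range M).filter fun k : ℕ => κ' ≤ capa lam P (pieceAt dd x R (k * L) ω) with hJ
    set m := ((Finset.range M).filter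
      fun k : ℕ => ¬ κ' ≤ capa lam P (pieceAt dd x R (k * L) ω)).card with hm
    have hcount' : (J.card : ℝ) + m = M := by exact_mod_cast hcount
    have hcap0 := h.capa_nonneg (visited (vball dd x N) ω)
    by_cases hJM : (1 - ε) * M ≤ J.card
    · refine le_add_right (ENNReal.ofReal_le_ofReal (Real.exp_le_exp.2 ?_))
      have hKM : ∀ k ∈ J, k < M ∧ κ' ≤ capa lam P (pieceAt dd x R (k * L) ω) := fun k hk => by
        simpa [hJ] using hk
      have hcard := h.card_le_mul_capa (hb.visited_finite x N ω) J
        (fun k => pieceAt dd x R (k * L) ω)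
        (fun k hk => pieceAt_subset h hb (by positivity) hR0.le (hML k (hKM k hk).1) h0 hnn
          (hre _))
        hκ'0 (I := a / L * (1 + Real.log M)) (by positivity) (fun k hk => (hKM k hk).2)
        (fun j k => a / 2 / L * (Nat.dist j k : ℝ)⁻¹) ?_ ?_
      · have e1 : 1 / κ' + a / L * (1 + Real.log M) ≤ (b + a * Real.log X) / L := by
          have : 1 / κ' + a / L * (1 + Real.log M) = (b + a * Real.log M) / L := by
            rw [hκ', hR, hbdef]; field_simp; ring
          rw [this]
          gcongr
        have e2 := hcard.trans (mul_le_mul_of_nonneg_right e1 hcap0)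
        have e3 : X - K ≤ M * K := by
          have := mul_le_mul_of_nonneg_right hMge hK0.le
          rw [sub_mul, div_mul_cancel₀ _ hK0.ne', one_mul] at this
          exact this
        have e4 : (1 - ε) * (X - K) / (b + a * Real.log X) ≤
            u * capa lam P (visited (vball dd x N) ω) := by
          rw [div_le_iff₀ hden]
          have e5 := hJM.trans e2
          calc (1 - ε) * (X - K) ≤ (1 - ε) * (M * K) :=
                mul_le_mul_of_nonneg_left e3 (by linarith)
            _ = (1 - ε) * M * K := by ring
            _ ≤ (b + a * Real.log X) / L * capa lam P (visited (vball dd x N) ω) * K :=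
                mul_le_mul_of_nonneg_right e5 hK0.le
            _ = _ := by rw [hL]; field_simp
        linarith
      · intro j _ k _ hjk z hz w hw
        have h1 := dist_pieceAt h hb h0 hnn hre hL0.le hz hw
        have h2 : (1 : ℝ) ≤ Nat.dist j k := by
          exact_mod_cast Nat.dist_pos_of_ne hjk
        rw [← cast_dist] at h1
        have h3 : (Nat.dist j k : ℝ) * ((1 - 3 * ε) * L) ≤ dd z w := by nlinarith
        have h4 : D ≤ (Nat.dist j k : ℝ) * ((1 - 3 * ε) * L) :=
          hLD.trans (le_mul_of_one_le_left (by positivity) h2)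
        refine (hgreen z w _ h4 h3).trans (le_of_eq ?_)
        rw [hν, Real.rpow_neg_one, ha]
        field_simp
      · intro j hj
        have hj' := (hKM j hj).1
        rw [← Finset.mul_sum]
        have h1 : ∑ k ∈ J.erase j, (Nat.dist j k : ℝ)⁻¹ ≤ 2 * (1 + Real.log M) := by
          calc _ ≤ ∑ k ∈ (Finset.range M).erase j, (Nat.dist j k : ℝ)⁻¹ :=
                Finset.sum_le_sum_of_subset_of_nonneg
                  (Finset.erase_subset_erase _ (Finset.filter_subset _ _))
                  fun i _ _ => by positivity
            _ ≤ 2 * ∑ i ∈ Finset.range M, (((i + 1 : ℕ) : ℝ))⁻¹ :=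
                sum_erase_dist_le (fun n => (n : ℝ)⁻¹) (fun n => by positivity) hj'
            _ ≤ _ := mul_le_mul_of_nonneg_left (sum_inv_range_le M) (by norm_num)
        calc _ ≤ a / 2 / L * (2 * (1 + Real.log M)) :=
              mul_le_mul_of_nonneg_left h1 (by positivity)
          _ = _ := by ring
    · refine le_add_left ?_
      rw [← ENNReal.ofReal_pow (Real.exp_pos _).le, ← Real.exp_nat_mul,
        ← ENNReal.ofReal_mul (Real.exp_pos _).le, ← Real.exp_add]
      refine ENNReal.ofReal_le_ofReal (Real.exp_le_exp.2 ?_)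
      have h1 : ε * M ≤ m := by push Not at hJM; linarith
      have h2 : s * (ε * M) ≤ s * m := mul_le_mul_of_nonneg_left h1 hs0.le
      rw [← mul_assoc, hsε] at h2
      have h3 : 0 ≤ u * capa lam P (visited (vball dd x N) ω) := by positivity
      linarith
  refine (lintegral_mono_ae hpt).trans ?_
  rw [lintegral_add_left measurable_const, lintegral_const, measure_univ, mul_one,
    lintegral_const_mul' _ _ ENNReal.ofReal_ne_top,
    ENNReal.ofReal_add (Real.exp_pos _).le (Real.exp_pos _).le]
  refine add_le_add le_rfl ((mul_le_mul_right hmom _).trans ?_)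
  rw [← ENNReal.ofReal_pow (by norm_num), ← ENNReal.ofReal_mul (Real.exp_pos _).le]
  refine ENNReal.ofReal_le_ofReal ?_
  have h2e : (2 : ℝ) ^ M ≤ Real.exp M := by
    rw [← mul_one (M : ℝ), Real.exp_nat_mul]
    exact pow_le_pow_left₀ (by norm_num) (by linarith [Real.add_one_le_exp 1]) M
  calc Real.exp (-2 * M) * 2 ^ M ≤ Real.exp (-2 * M) * Real.exp M :=
        mul_le_mul_of_nonneg_left h2e (Real.exp_pos _).le
    _ = Real.exp (-M) := by rw [← Real.exp_add]; congr 1; ring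
    _ ≤ _ := Real.exp_le_exp.2 (by linarith)

end UpperEqOneMain

section Tube

variable {lam dd : V → V → ℝ} {P : V → Measure (ℕ → V)} {α ν c₃ C₃ c C : ℝ}
variable [Countable V] [MeasurableSingletonClass V]

/-- Strong Markov property for a disjoint family of stopping events. -/
lemma Standing.strong_markov (h : Standing lam dd P α ν c₃ C₃) (x : V) (F : ℕ → Set (ℕ → V))
    (hF : ∀ n, DependsOn (fun ω => ω ∈ F n) (Set.Iic n))
    (hdisj : Pairwise fun m n => Disjoint (F m) (F n)) {S : Set (ℕ → V)} (hS : MeasurableSet S) :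
    (∀ n, MeasurableSet (F n)) ∧
    P x (⋃ n, F n ∩ {ω | pshift n ω ∈ S}) =
      ∑' n, ∫⁻ ω, (F n).indicator 1 ω * P (ω n) S ∂(P x) := by
  have hFm : ∀ n, MeasurableSet (F n) := fun n =>
    measurableSet_setOfPred.2 (measurable_of_dependsOn (hF n))
  refine ⟨hFm, ?_⟩
  have hSn : ∀ n, MeasurableSet {ω : ℕ → V | pshift n ω ∈ S} := fun n => measurable_pshift n hS
  rw [measure_iUnion (fun m n hmn => (hdisj hmn).mono inter_subset_left inter_subset_left)
    fun n => (hFm n).inter (hSn n)]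
  refine tsum_congr fun n => ?_
  have hd : DependsOn ((F n).indicator (1 : (ℕ → V) → ℝ≥0∞)) (Set.Iic n) := by
    intro ω ω' hω
    have := hF n hω
    simp only [Set.indicator, this]
    rfl
  have h1 := h.markov_lintegral n x hd (measurable_one.indicator hS (β := ℝ≥0∞))
  simp only [lintegral_indicator_one hS] at h1
  rw [← h1, ← lintegral_indicator_one ((hFm n).inter (hSn n))]
  refine lintegral_congr fun ω => ?_
  by_cases h1 : ω ∈ F n <;> by_cases h2 : pshift n ω ∈ S <;> simp [h1, h2, Set.indicator]

lemma Standing.strong_markov_ge (h : Standing lam dd P α ν c₃ C₃) (x : V) (F : ℕ → Set (ℕ → V))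
    (hF : ∀ n, DependsOn (fun ω => ω ∈ F n) (Set.Iic n))
    (hdisj : Pairwise fun m n => Disjoint (F m) (F n)) {S : Set (ℕ → V)} (hS : MeasurableSet S)
    {q : ℝ≥0∞} (hq : ∀ n, ∀ ω ∈ F n, q ≤ P (ω n) S) :
    q * P x (⋃ n, F n) ≤ P x (⋃ n, F n ∩ {ω | pshift n ω ∈ S}) := by
  obtain ⟨hFm, heq⟩ := h.strong_markov x F hF hdisj hS
  rw [heq, measure_iUnion hdisj hFm, ← ENNReal.tsum_mul_left]
  refine ENNReal.tsum_le_tsum fun n => ?_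
  rw [← lintegral_indicator_one (hFm n), ← lintegral_const_mul _ (measurable_one.indicator (hFm n))]
  refine lintegral_mono fun ω => ?_
  by_cases h1 : ω ∈ F n
  · simpa [h1] using hq n ω h1
  · simp [h1]

lemma Standing.strong_markov_le (h : Standing lam dd P α ν c₃ C₃) (x : V) (F : ℕ → Set (ℕ → V))
    (hF : ∀ n, DependsOn (fun ω => ω ∈ F n) (Set.Iic n))
    (hdisj : Pairwise fun m n => Disjoint (F m) (F n)) {S : Set (ℕ → V)} (hS : MeasurableSet S)
    {q : ℝ≥0∞} (hq : ∀ n, ∀ ω ∈ F n, P (ω n) S ≤ q) :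
    P x (⋃ n, F n ∩ {ω | pshift n ω ∈ S}) ≤ q := by
  have := h.prob x
  obtain ⟨hFm, heq⟩ := h.strong_markov x F hF hdisj hS
  calc _ ≤ ∑' n, q * P x (F n) := by
        rw [heq]
        refine ENNReal.tsum_le_tsum fun n => ?_
        rw [← lintegral_indicator_one (hFm n),
          ← lintegral_const_mul _ (measurable_one.indicator (hFm n))]
        refine lintegral_mono fun ω => ?_
        by_cases h1 : ω ∈ F n
        · simpa [h1] using hq n ω h1
        · simp [h1]
    _ = q * P x (⋃ n, F n) := by rw [ENNReal.tsum_mul_left, measure_iUnion hdisj hFm]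
    _ ≤ q * 1 := by gcongr; exact prob_le_one
    _ = q := mul_one q

/-- The walk reaches `B` at some time and stays in `A` strictly before its first visit. -/
def hitIn (A B : Set V) : Set (ℕ → V) :=
  ⋃ n, {ω | ω n ∈ B ∧ ∀ k < n, ω k ∉ B ∧ ω k ∈ A}

lemma Standing.exists_hitIn (h : Standing lam dd P α ν c₃ C₃) (hb : Bounds lam dd P α ν c C) :
    ∃ p K : ℝ, 0 < p ∧ p < 1 ∧ 1 ≤ K ∧ ∀ R, 1 ≤ R → ∀ a b y, dd a b ≤ 3 * R → dd a y ≤ R →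
      ENNReal.ofReal p ≤ P y (hitIn (vball dd a (K * R)) (vball dd b R)) := by
  have hν := h.nu_pos
  have hc := hb.c_pos
  have hC := hb.C_pos
  obtain ⟨K₀, hK₀, hker⟩ := h.kernel_sum_of_lt hb hν (by linarith [h.nu_le])
  set κ : ℝ := c / (C * K₀ * 2 ^ (α - ν)) with hκ
  have hκ0 : 0 < κ := by positivity
  have hcap : ∀ R, 1 ≤ R → ∀ b, κ * R ^ ν ≤ capa lam P (vball dd b R) := by
    intro R hR b
    have hR0 : 0 < R := by linarith
    have h1 := h.sum_le_mul_capa (hb.finite b R) (ballF dd b R) (lamTot lam) id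
      (fun z hz => hb.mem_ballF.1 hz) (b := C * (K₀ * (2 * R) ^ (α - ν))) (by positivity) ?_
    · have h2 := (hb.vol_ge b R hR).trans h1
      rw [Real.mul_rpow (by norm_num) hR0.le] at h2
      have h3 : R ^ α = R ^ ν * R ^ (α - ν) := by rw [← Real.rpow_add hR0]; ring_nf
      have h4 : 0 < R ^ (α - ν) := by positivity
      rw [hκ, div_mul_eq_mul_div, div_le_iff₀ (by positivity)]
      refine le_of_mul_le_mul_right ?_ h4
      rw [h3] at h2
      linarith
    · intro z hz
      have hz' := hb.mem_ballF.1 hz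
      refine le_trans ?_ (mul_le_mul_of_nonneg_left (hker z (2 * R) (by linarith)) hC.le)
      rw [Finset.mul_sum]
      calc _ ≤ ∑ k ∈ ballF dd b R, C * (lamTot lam k * (1 + dd z k) ^ (-ν)) := by
            refine Finset.sum_le_sum fun k _ => ?_
            have := mul_le_mul_of_nonneg_left (hb.green_le z k) (h.lamTot_pos k).le
            simp only [id]; linarith
        _ ≤ _ := by
            refine Finset.sum_le_sum_of_subset_of_nonneg (fun k hk => ?_) fun k _ _ => ?_
            · have hk' := hb.mem_ballF.1 hk
              rw [hb.mem_ballF]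
              have := h.dd_triangle z b k
              rw [h.dd_symm z b] at this
              linarith
            · have := h.lamTot_pos k
              have := h.dd_nonneg z k
              positivity
  set L : ℝ := (2 * C / c) ^ (1 / ν) with hL
  have hL0 : 0 < L := by positivity
  have hLν : L ^ ν = 2 * C / c := by
    rw [hL, ← Real.rpow_mul (by positivity), one_div_mul_cancel hν.ne', Real.rpow_one]
  set p : ℝ := min (c / 2 * 6 ^ (-ν) * κ) (1 / 2) with hp
  have hp0 : 0 < p := by positivity
  refine ⟨p, 4 + 6 * L, hp0, (min_le_right _ _).trans_lt (by norm_num), by linarith,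
    fun R hR a b y hab hay => ?_⟩
  have := h.prob y
  have hR0 : 0 < R := by linarith
  set A := vball dd a ((4 + 6 * L) * R) with hA
  set B := vball dd b R with hB
  have hBf : B.Finite := hb.finite b R
  have hcapB := hcap R hR b
  have hcap0 := h.capa_nonneg (A := B)
  have hlow : c * (6 * R) ^ (-ν) * capa lam P B ≤ (P y (hitSet B)).toReal := by
    rw [← h.sum_green_equi hBf, capa_eq_sum hBf, Finset.mul_sum]
    refine Finset.sum_le_sum fun z hz => mul_le_mul_of_nonneg_right ?_ (h.equi_nonneg _ _)
    have hz' : dd b z ≤ R := hBf.mem_toFinset.1 hz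
    refine le_trans (mul_le_mul_of_nonneg_left ?_ hc.le) (hb.green_ge y z)
    have h1 := h.dd_triangle y a z
    have h2 := h.dd_triangle a b z
    rw [h.dd_symm y a] at h1
    have := h.dd_nonneg y z
    exact Real.rpow_le_rpow_of_nonpos (by positivity) (by linarith) (by linarith)
  have hup : ∀ w, w ∉ A → (P w (hitSet B)).toReal ≤ C * (6 * L * R) ^ (-ν) * capa lam P B := by
    intro w hw
    rw [← h.sum_green_equi hBf, capa_eq_sum hBf, Finset.mul_sum]
    refine Finset.sum_le_sum fun z hz => mul_le_mul_of_nonneg_right ?_ (h.equi_nonneg _ _)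
    have hz' : dd b z ≤ R := hBf.mem_toFinset.1 hz
    refine (hb.green_le w z).trans (mul_le_mul_of_nonneg_left ?_ hC.le)
    have hw' : (4 + 6 * L) * R < dd a w := not_le.1 hw
    have h1 := h.dd_triangle a z w
    have h2 := h.dd_triangle a b z
    rw [h.dd_symm z w] at h1
    exact Real.rpow_le_rpow_of_nonpos (by positivity) (by nlinarith) (by linarith)
  set q : ℝ := C * (6 * L * R) ^ (-ν) * capa lam P B with hq
  have hq0 : 0 ≤ q := by positivity
  set F : ℕ → Set (ℕ → V) := fun n => {ω | ω n ∉ A ∧ ∀ k < n, ω k ∈ A} with hF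
  have hFdep : ∀ n, DependsOn (fun ω => ω ∈ F n) (Set.Iic n) := by
    intro n ω ω' hω
    have hn : ω n = ω' n := hω n (Set.mem_Iic.2 le_rfl)
    have hk : ∀ k < n, ω k = ω' k := fun k hk => hω k (Set.mem_Iic.2 hk.le)
    simp only [hF, Set.mem_ofPred_eq, hn, eq_iff_iff]
    refine and_congr_right fun _ => forall₂_congr fun k hkn => by rw [hk k hkn]
  have hFdisj : Pairwise fun m n => Disjoint (F m) (F n) := by
    intro m n hmn
    rw [Set.disjoint_left]
    intro ω h1 h2
    rcases lt_or_gt_of_ne hmn with hlt | hlt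
    · exact h1.1 (h2.2 m hlt)
    · exact h2.1 (h1.2 n hlt)
  have hexit : P y (⋃ n, F n ∩ {ω | pshift n ω ∈ hitSet B}) ≤ ENNReal.ofReal q := by
    refine h.strong_markov_le y F hFdep hFdisj (measurableSet_hitSet B) fun n ω hω => ?_
    have := h.prob (ω n)
    exact (ENNReal.le_ofReal_iff_toReal_le (measure_ne_top _ _) hq0).2 (hup _ hω.1)
  have hsub : hitSet B ⊆ hitIn A B ∪ ⋃ n, F n ∩ {ω | pshift n ω ∈ hitSet B} := by
    intro ω hω
    have hω' : ∃ k, ω k ∈ B := hω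
    have hfind := Nat.find_spec hω'
    by_cases hall : ∀ k < Nat.find hω', ω k ∈ A
    · left
      exact mem_iUnion.2 ⟨Nat.find hω', hfind, fun k hk => ⟨Nat.find_min hω' hk, hall k hk⟩⟩
    · right
      push Not at hall
      obtain ⟨k, hk, hkA⟩ := hall
      have hex : ∃ k, ω k ∉ A := ⟨k, hkA⟩
      refine mem_iUnion.2 ⟨Nat.find hex, ⟨Nat.find_spec hex, fun j hj => ?_⟩, ?_⟩
      · by_contra hc; exact Nat.find_min hex hj hc
      · have hle : Nat.find hex ≤ Nat.find hω' := (Nat.find_min' hex hkA).trans hk.le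
        refine ⟨Nat.find hω' - Nat.find hex, ?_⟩
        rw [pshift_apply, Nat.add_sub_cancel' hle]
        exact hfind
  have hmain : P y (hitSet B) ≤ P y (hitIn A B) + ENNReal.ofReal q :=
    (measure_mono hsub).trans ((measure_union_le _ _).trans (by gcongr))
  have hmain' : (P y (hitSet B)).toReal ≤ (P y (hitIn A B)).toReal + q := by
    have := ENNReal.toReal_mono (by finiteness) hmain
    rwa [ENNReal.toReal_add (measure_ne_top _ _) ENNReal.ofReal_ne_top,
      ENNReal.toReal_ofReal hq0] at this
  rw [ENNReal.ofReal_le_iff_le_toReal (measure_ne_top _ _)]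
  have hq' : q = c / 2 * (6 * R) ^ (-ν) * capa lam P B := by
    have : (6 * L * R) ^ (-ν) = (6 * R) ^ (-ν) * (c / (2 * C)) := by
      rw [show 6 * L * R = (6 * R) * L by ring, Real.mul_rpow (by positivity) hL0.le,
        Real.rpow_neg hL0.le, hLν, inv_div]
    rw [hq, this]; field_simp
  have hfin : c / 2 * (6 * R) ^ (-ν) * capa lam P B ≤ (P y (hitIn A B)).toReal := by
    rw [hq'] at hmain'; linarith
  refine (min_le_left _ _).trans (le_trans ?_ hfin)
  rw [Real.mul_rpow (by norm_num) hR0.le]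
  have hRR : R ^ (-ν) * R ^ ν = 1 := by rw [← Real.rpow_add hR0]; simp
  calc c / 2 * 6 ^ (-ν) * κ = c / 2 * (6 ^ (-ν) * R ^ (-ν)) * (κ * R ^ ν) := by
        rw [show c / 2 * (6 ^ (-ν) * R ^ (-ν)) * (κ * R ^ ν) =
          c / 2 * 6 ^ (-ν) * κ * (R ^ (-ν) * R ^ ν) by ring, hRR, mul_one]
    _ ≤ _ := by gcongr

/-- The walk follows the chain of balls `B(b i, K R)`, `i < m`, and then visits `B(b m, R)`. -/
def chainSet (dd : V → V → ℝ) (K R : ℝ) (m : ℕ) (b : ℕ → V) : Set (ℕ → V) :=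
  {ω | ∃ n, ω n ∈ vball dd (b m) R ∧ ∀ k < n, ∃ i < m, ω k ∈ vball dd (b i) (K * R)}

lemma measurableSet_chainSet (K R : ℝ) (m : ℕ) (b : ℕ → V) :
    MeasurableSet (chainSet dd K R m b) := by
  have : chainSet dd K R m b = ⋃ n, {ω | ω n ∈ vball dd (b m) R} ∩
      ⋂ k, ⋂ (_ : k < n), {ω | ω k ∈ ⋃ i, ⋃ (_ : i < m), vball dd (b i) (K * R)} := by
    ext ω; simp [chainSet]
  rw [this]
  exact MeasurableSet.iUnion fun n => (measurableSet_eval n _).inter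
    (MeasurableSet.iInter fun k => MeasurableSet.iInter fun _ => measurableSet_eval k _)

lemma Standing.chainSet_ge (h : Standing lam dd P α ν c₃ C₃) {p : ℝ≥0∞} {K R : ℝ}
    (hp : ∀ a b y, dd a b ≤ 3 * R → dd a y ≤ R →
      p ≤ P y (hitIn (vball dd a (K * R)) (vball dd b R)))
    (m : ℕ) (b : ℕ → V) (hb3 : ∀ i, dd (b i) (b (i + 1)) ≤ 3 * R) (y : V) (hy : dd (b 0) y ≤ R) :
    p ^ m ≤ P y (chainSet dd K R m b) := by
  induction m generalizing b y with
  | zero =>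
    rw [pow_zero, ← h.start y]
    refine measure_mono fun ω hω => ⟨0, ?_, by simp⟩
    rw [show ω 0 = y from hω]; exact hy
  | succ m ih =>
    set A := vball dd (b 0) (K * R)
    set B := vball dd (b 1) R
    set F : ℕ → Set (ℕ → V) := fun n => {ω | ω n ∈ B ∧ ∀ k < n, ω k ∉ B ∧ ω k ∈ A} with hF
    set S := chainSet dd K R m fun i => b (i + 1)
    have hFdep : ∀ n, DependsOn (fun ω => ω ∈ F n) (Set.Iic n) := by
      intro n ω ω' hω
      have hn : ω n = ω' n := hω n (Set.mem_Iic.2 le_rfl)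
      have hk : ∀ k < n, ω k = ω' k := fun k hk => hω k (Set.mem_Iic.2 hk.le)
      simp only [hF, Set.mem_ofPred_eq, hn, eq_iff_iff]
      refine and_congr_right fun _ => forall₂_congr fun k hkn => by rw [hk k hkn]
    have hFdisj : Pairwise fun m n => Disjoint (F m) (F n) := by
      intro m n hmn
      rw [Set.disjoint_left]
      intro ω h1 h2
      rcases lt_or_gt_of_ne hmn with hlt | hlt
      · exact (h2.2 m hlt).1 h1.1
      · exact (h1.2 n hlt).1 h2.1
    have h1 := h.strong_markov_ge y F hFdep hFdisj (measurableSet_chainSet K R m _)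
      (q := p ^ m) fun n ω hω => ih (fun i => b (i + 1)) (fun i => hb3 (i + 1)) (ω n) hω.1
    calc p ^ (m + 1) = p ^ m * p := pow_succ p m
      _ ≤ p ^ m * P y (⋃ n, F n) := by
          gcongr
          exact hp _ _ _ (hb3 0) hy
      _ ≤ _ := h1
      _ ≤ _ := by
          refine measure_mono ?_
          refine iUnion_subset fun n ω hω => ?_
          obtain ⟨⟨hn, hk⟩, n', hn', hk'⟩ := hω
          refine ⟨n + n', hn', fun k hkn => ?_⟩
          by_cases hlt : k < n
          · exact ⟨0, Nat.succ_pos m, (hk k hlt).2⟩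
          · obtain ⟨i, hi, hmem⟩ := hk' (k - n) (by omega)
            rw [pshift_apply, Nat.add_sub_cancel' (not_lt.1 hlt)] at hmem
            exact ⟨i + 1, by omega, hmem⟩

end Tube

section TubeBound

variable {lam dd : V → V → ℝ} {P : V → Measure (ℕ → V)} {α ν c₃ C₃ c C : ℝ}
variable [Countable V] [MeasurableSingletonClass V]

lemma lintegral_ge_of_subset {μ : Measure (ℕ → V)} {S : Set (ℕ → V)} (hS : MeasurableSet S)
    {f : (ℕ → V) → ℝ≥0∞} {q : ℝ≥0∞} (hf : ∀ ω ∈ S, q ≤ f ω) : q * μ S ≤ ∫⁻ ω, f ω ∂μ := by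
  rw [← setLIntegral_const]
  exact (setLIntegral_mono' hS hf).trans (setLIntegral_le_lintegral S f)

/-- Lower bound on the Laplace transform of the capacity obtained by forcing the walk to stay in a
tube of radius `R` around a geodesic. -/
lemma Standing.exists_tube (h : Standing lam dd P α ν c₃ C₃) (hb : Bounds lam dd P α ν c C)
    {c₄ C₄ : ℝ} (hc₄ : 0 < c₄) (hC₄ : 0 < C₄) (hgeo : Geodesic lam dd c₄ C₄)
    {η : ℝ} (hη : 0 < η) (hη1 : η < 1) :
    ∃ R₀ K Λ : ℝ, 1 ≤ R₀ ∧ c₄ ≤ R₀ ∧ 1 ≤ K ∧ 0 < Λ ∧ ∀ R, R₀ ≤ R → ∀ N, 0 ≤ N →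
      ∀ (s : Finset ℕ) (w : ℕ → ℝ), (∀ j, 0 ≤ w j) →
      (∀ k : ℕ, c₄ * k ≤ N + 3 * R →
        1 ≤ ∑ j ∈ s, w j * ((1 - η) * c₃ * (c₄ * |(k : ℝ) - j| + K * R) ^ (-ν))) →
      ∀ u, 0 ≤ u → ∀ x : V, ENNReal.ofReal (Real.exp (-(Λ * (N / R + 1)) - u * ∑ j ∈ s, w j)) ≤
        ∫⁻ ω, ENNReal.ofReal (Real.exp (-u * capa lam P (visited (vball dd x N) ω))) ∂(P x) := by
  obtain ⟨p, K, hp0, hp1, hK, hhit⟩ := h.exists_hitIn hb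
  obtain ⟨M, hM, hgr⟩ := h.exists_green_ge hb hη
  have hν := h.nu_pos
  have hc₃ := h.c₃_pos
  set Λ₀ := -Real.log p with hΛ₀
  have hΛ₀0 : 0 < Λ₀ := by have := Real.log_neg hp0 hp1; linarith
  refine ⟨1 + M + C₄ + 2 * c₄, K + 2, 5 * Λ₀, by linarith, by linarith, by linarith, by positivity,
    fun R hR N hN s w hw hpot u hu x => ?_⟩
  obtain ⟨γ, hγ0, -, hγ⟩ := hgeo x
  have hR0 : 0 < R := by linarith
  set r : ℕ := ⌊R / c₄⌋₊ with hr
  have hr1 : c₄ * r ≤ R := by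
    have := Nat.floor_le (show 0 ≤ R / c₄ by positivity)
    rw [le_div_iff₀ hc₄] at this
    linarith
  have hr2 : R / 2 ≤ c₄ * r := by
    have := Nat.lt_floor_add_one (R / c₄)
    rw [div_lt_iff₀ hc₄] at this
    linarith
  have hcr : 0 < c₄ * r := by linarith
  set m : ℕ := ⌊(N + R + C₄) / (c₄ * r)⌋₊ + 1 with hm
  have hm1 : N + R + C₄ < c₄ * r * m := by
    have := Nat.lt_floor_add_one ((N + R + C₄) / (c₄ * r))
    rw [div_lt_iff₀ hcr] at this
    rw [hm]; push_cast; linarith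
  have hm2 : c₄ * r * (m - 1 : ℝ) ≤ N + R + C₄ := by
    have := Nat.floor_le (show 0 ≤ (N + R + C₄) / (c₄ * r) by positivity)
    rw [le_div_iff₀ hcr] at this
    rw [hm]; push_cast; linarith
  have hm3 : (m : ℝ) ≤ 5 * (N / R + 1) := by
    have h1 : (m - 1 : ℝ) ≤ 2 * (N / R) + 4 := by
      have h2 : (m - 1 : ℝ) * (R / 2) ≤ N + 2 * R := by
        have : (0 : ℝ) ≤ m - 1 := by rw [hm]; push_cast; simp
        nlinarith
      have h3 : (2 * (N / R) + 4) * (R / 2) = N + 2 * R := by field_simp; ring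
      exact le_of_mul_le_mul_right (h2.trans_eq h3.symm) (by positivity)
    have : 0 ≤ N / R := by positivity
    linarith
  set b : ℕ → V := fun i => γ (i * r) with hbdef
  have hb3 : ∀ i, dd (b i) (b (i + 1)) ≤ 3 * R := by
    intro i
    have h1 := (hγ (i * r) ((i + 1) * r)).2
    have h2 : |((i * r : ℕ) : ℝ) - (((i + 1) * r : ℕ) : ℝ)| = r := by
      push_cast
      rw [show (i : ℝ) * r - (i + 1) * r = -r by ring, abs_neg, Nat.abs_cast]
    rw [h2] at h1
    simp only [hbdef]; linarith
  have hb0 : dd (b 0) x ≤ R := by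
    simp only [hbdef, zero_mul, hγ0, h.dd_self]; exact hR0.le
  have hprob := h.chainSet_ge (hhit R (by linarith)) m b hb3 x hb0
  have hcapa : ∀ ω ∈ chainSet dd K R m b,
      capa lam P (visited (vball dd x N) ω) ≤ ∑ j ∈ s, w j := by
    rintro ω ⟨n, hn, hk⟩
    refine h.capa_le_sum ((hb.finite x N).subset (visited_subset _ ω)) s w γ (fun j _ => hw j) ?_
    rintro z ⟨k, hkA, rfl⟩
    have hkn : k < n := by
      by_contra! hnk
      have h1 : dd x (ω n) ≤ N := hkA n hnk
      have h2 : dd (b m) (ω n) ≤ R := hn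
      have h3 := (hγ 0 (m * r)).1
      rw [hγ0] at h3
      have h4 : |((0 : ℕ) : ℝ) - ((m * r : ℕ) : ℝ)| = m * r := by
        push_cast
        rw [zero_sub, abs_neg, abs_of_nonneg (by positivity)]
      rw [h4] at h3
      have h5 := h.dd_triangle x (ω n) (b m)
      rw [h.dd_symm (ω n) (b m)] at h5
      simp only [hbdef] at h5 h2
      nlinarith
    obtain ⟨i, him, hi⟩ := hk k hkn
    have hi' : dd (γ (i * r)) (ω k) ≤ K * R := hi
    refine (hpot (i * r) ?_).trans (Finset.sum_le_sum fun j _ => ?_)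
    · have h1 : (i : ℝ) ≤ m - 1 := by
        have : i + 1 ≤ m := him
        have : ((i : ℝ) + 1) ≤ m := by exact_mod_cast this
        linarith
      push_cast
      nlinarith
    · refine mul_le_mul_of_nonneg_left (le_trans ?_ (hgr (ω k) (γ j))) (hw j)
      refine mul_le_mul_of_nonneg_left ?_ (mul_nonneg (by linarith) hc₃.le)
      have h1 := h.dd_triangle (ω k) (γ (i * r)) (γ j)
      have h2 := (hγ (i * r) j).2
      have h3 := h.dd_nonneg (ω k) (γ j)
      rw [h.dd_symm (ω k) (γ (i * r))] at h1
      exact Real.rpow_le_rpow_of_nonpos (by linarith) (by linarith) (by linarith)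
  refine le_trans ?_ (lintegral_ge_of_subset (measurableSet_chainSet (dd := dd) K R m b)
    (q := ENNReal.ofReal (Real.exp (-(u * ∑ j ∈ s, w j)))) fun ω hω => ?_)
  · refine le_trans ?_ (mul_le_mul_right hprob _)
    rw [← ENNReal.ofReal_pow hp0.le, ← ENNReal.ofReal_mul (Real.exp_nonneg _)]
    refine ENNReal.ofReal_le_ofReal ?_
    have : p ^ m = Real.exp (-(Λ₀ * m)) := by
      rw [hΛ₀, neg_mul, neg_neg, mul_comm, Real.exp_nat_mul, Real.exp_log hp0]
    rw [this, ← Real.exp_add]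
    refine Real.exp_le_exp.2 ?_
    nlinarith
  · refine ENNReal.ofReal_le_ofReal (Real.exp_le_exp.2 ?_)
    have := mul_le_mul_of_nonneg_left (hcapa ω hω) hu
    linarith

end TubeBound

section LowerTransientPath

variable {lam dd : V → V → ℝ} {P : V → Measure (ℕ → V)} {α ν c₃ C₃ c C : ℝ}
variable [Countable V] [MeasurableSingletonClass V]

lemma Standing.lower_of_one_lt (h : Standing lam dd P α ν c₃ C₃) (hb : Bounds lam dd P α ν c C)
    {c₄ C₄ : ℝ} (hc₄ : 0 < c₄) (hC₄ : 0 < C₄) (hgeo : Geodesic lam dd c₄ C₄)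
    {u₀ : ℝ} (hu₀ : 0 < u₀) :
    ∃ C' C₆ : ℝ, 0 < C' ∧ 0 < C₆ ∧ ∀ u, 0 < u → u ≤ u₀ → ∀ N, C' * u ^ (-(1 / ν)) ≤ N → ∀ x,
      ENNReal.ofReal (Real.exp (-(C₆ * (N * u ^ (1 / ν))))) ≤
        ∫⁻ ω, ENNReal.ofReal (Real.exp (-u * capa lam P (visited (vball dd x N) ω))) ∂(P x) := by
  obtain ⟨R₀, K, Λ, hR₀, hR₀c, hK, hΛ, htube⟩ :=
    h.exists_tube hb hc₄ hC₄ hgeo (η := 1 / 2) (by norm_num) (by norm_num)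
  have hν := h.nu_pos
  have hc₃ := h.c₃_pos
  set R₁ : ℝ := R₀ * u₀ ^ (1 / ν) with hR₁
  have hR₁0 : 0 < R₁ := by positivity
  refine ⟨R₁, 2 * Λ / R₁ + 7 * (2 / c₃) * (2 + K) ^ ν * R₁ ^ ν / R₁, hR₁0, by positivity,
    fun u hu huu N hN x => ?_⟩
  set R : ℝ := R₁ * u ^ (-(1 / ν)) with hR
  have hRR₀ : R₀ ≤ R := by
    have h1 : u ^ (1 / ν) ≤ u₀ ^ (1 / ν) := Real.rpow_le_rpow hu.le huu (by positivity)
    have h2 : 0 < u ^ (1 / ν) := by positivity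
    rw [hR, Real.rpow_neg hu.le, ← div_eq_mul_inv, le_div_iff₀ h2, hR₁]
    gcongr
  have hR0 : 0 < R := by linarith
  have hN0 : 0 < N := hR0.trans_le hN
  have hinv : 1 / R = u ^ (1 / ν) / R₁ := by
    rw [hR, Real.rpow_neg hu.le]; field_simp
  have hpow : u * R ^ ν = R₁ ^ ν := by
    rw [hR, Real.mul_rpow hR₁0.le (by positivity), ← Real.rpow_mul hu.le, neg_mul,
      one_div_mul_cancel hν.ne', Real.rpow_neg_one]
    field_simp
  set J : ℕ := ⌊R / c₄⌋₊ + 1 with hJ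
  have hJ1 : R / c₄ ≤ J := by
    rw [hJ]; push_cast; exact (Nat.lt_floor_add_one _).le
  have hJ2 : c₄ * J ≤ 2 * R := by
    have := Nat.floor_le (show 0 ≤ R / c₄ by positivity)
    rw [le_div_iff₀ hc₄] at this
    rw [hJ]; push_cast; linarith
  set n : ℕ := ⌊(N + 5 * R) / c₄⌋₊ + 1 with hn
  have hn1 : (n : ℝ) ≤ 7 * N / c₄ := by
    have := Nat.floor_le (show 0 ≤ (N + 5 * R) / c₄ by positivity)
    rw [le_div_iff₀ hc₄] at this
    rw [le_div_iff₀ hc₄, hn]; push_cast; linarith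
  set W : ℝ := c₄ / R * (2 / c₃) * ((2 + K) * R) ^ ν with hW
  have hW0 : 0 < W := by positivity
  have hmain := htube R hRR₀ N hN0.le (Finset.range n) (fun _ => W) (fun _ => hW0.le) ?_ u hu.le x
  · refine le_trans (ENNReal.ofReal_le_ofReal (Real.exp_le_exp.2 ?_)) hmain
    rw [Finset.sum_const, Finset.card_range, nsmul_eq_mul]
    have h1 : Λ * (N / R + 1) ≤ 2 * Λ / R₁ * (N * u ^ (1 / ν)) := by
      have : 1 ≤ N / R := (one_le_div hR0).2 hN
      calc Λ * (N / R + 1) ≤ Λ * (2 * (N * (1 / R))) := by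
            rw [mul_one_div]; gcongr; linarith
        _ = _ := by rw [hinv]; ring
    have h2 : u * (n * W) ≤ 7 * (2 / c₃) * (2 + K) ^ ν * R₁ ^ ν / R₁ * (N * u ^ (1 / ν)) := by
      calc u * (n * W) ≤ u * (7 * N / c₄ * W) := by gcongr
        _ = 7 * (2 / c₃) * (2 + K) ^ ν * (u * R ^ ν) * (1 / R) * N := by
            rw [hW, Real.mul_rpow (by linarith) hR0.le]; field_simp
        _ = _ := by rw [hpow, hinv]; ring
    linarith
  · intro k hk
    have hsub : Finset.Ico k (k + J) ⊆ Finset.range n := by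
      intro j hj
      rw [Finset.mem_Ico] at hj
      rw [Finset.mem_range, hn, Nat.lt_add_one_iff, Nat.le_floor_iff (by positivity),
        le_div_iff₀ hc₄]
      have : (j : ℝ) ≤ k + J := by exact_mod_cast hj.2.le
      nlinarith
    refine le_trans ?_ (Finset.sum_le_sum_of_subset_of_nonneg hsub fun j _ _ => by positivity)
    have hterm : ∀ j ∈ Finset.Ico k (k + J), c₄ / R ≤
        W * ((1 - 1 / 2) * c₃ * (c₄ * |(k : ℝ) - j| + K * R) ^ (-ν)) := by
      intro j hj
      rw [Finset.mem_Ico] at hj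
      have h1 : |(k : ℝ) - j| ≤ J := by
        have h2 : (k : ℝ) ≤ j := by exact_mod_cast hj.1
        have h3 : (j : ℝ) ≤ k + J := by exact_mod_cast hj.2.le
        rw [abs_le]; constructor <;> linarith
      have h4 : ((2 + K) * R) ^ (-ν) ≤ (c₄ * |(k : ℝ) - j| + K * R) ^ (-ν) := by
        refine Real.rpow_le_rpow_of_nonpos (by positivity) ?_ (by linarith)
        nlinarith
      calc c₄ / R = W * ((1 - 1 / 2) * c₃ * ((2 + K) * R) ^ (-ν)) := by
            have : 0 < ((2 + K) * R) ^ ν := by positivity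
            rw [hW, Real.rpow_neg (by positivity)]; field_simp
            norm_num
        _ ≤ _ := by gcongr
    have := Finset.card_nsmul_le_sum _ _ _ hterm
    rw [Nat.card_Ico, Nat.add_sub_cancel_left, nsmul_eq_mul] at this
    refine le_trans ?_ this
    rw [div_le_iff₀ hc₄] at hJ1
    rw [mul_div_assoc', le_div_iff₀ hR0]
    linarith

end LowerTransientPath

lemma log_le_sum_inv {c₄ B : ℝ} (hc₄ : 0 < c₄) (hB : 0 < B) (J : ℕ) :
    Real.log ((c₄ * (J + 1) + B) / (c₄ + B)) ≤
      c₄ * ∑ i ∈ Finset.range J, (c₄ * ((i : ℝ) + 1) + B)⁻¹ := by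
  induction J with
  | zero => simp [div_self (by positivity : c₄ + B ≠ 0)]
  | succ J ih =>
    rw [Finset.sum_range_succ]
    have hA : 0 < c₄ * ((J : ℝ) + 1) + B := by positivity
    have h1 : (c₄ * (((J + 1 : ℕ) : ℝ) + 1) + B) / (c₄ + B) =
        (c₄ * ((J : ℝ) + 1) + B) / (c₄ + B) * (1 + c₄ * (c₄ * ((J : ℝ) + 1) + B)⁻¹) := by
      push_cast; field_simp; ring
    rw [h1, Real.log_mul (by positivity) (by positivity)]
    have := Real.log_le_sub_one_of_pos
      (show 0 < 1 + c₄ * (c₄ * ((J : ℝ) + 1) + B)⁻¹ by positivity)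
    linarith

/-- A radial kernel summed against weights doubled near the origin. -/
lemma sum_two_sided_ge {J n k : ℕ} {w : ℝ} (hw : 0 ≤ w) (g : ℝ → ℝ)
    (hg : ∀ d, 0 ≤ d → 0 ≤ g d) (hn : k + J < n) :
    2 * w * ∑ i ∈ Finset.range J, g ((i : ℝ) + 1) ≤
      ∑ j ∈ Finset.range n, (w * if j ≤ 2 * J then 2 else 1) * g |(k : ℝ) - j| := by
  have hpos : ∀ j : ℕ, 0 ≤ (w * if j ≤ 2 * J then 2 else 1) * g |(k : ℝ) - j| := fun j => by
    have := hg |(k : ℝ) - j| (abs_nonneg _)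
    split_ifs <;> positivity
  have hright : ∀ i : ℕ, |(k : ℝ) - (k + 1 + i : ℕ)| = (i : ℝ) + 1 := fun i => by
    push_cast
    rw [show (k : ℝ) - (k + 1 + i) = -((i : ℝ) + 1) by ring, abs_neg, abs_of_nonneg (by positivity)]
  rcases le_or_gt k J with hk | hk
  · have hsub : Finset.Ico (k + 1) (k + 1 + J) ⊆ Finset.range n := fun j hj => by
      rw [Finset.mem_Ico] at hj; rw [Finset.mem_range]; omega
    refine le_trans (le_of_eq ?_) (Finset.sum_le_sum_of_subset_of_nonneg hsub fun j _ _ => hpos j)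
    rw [Finset.sum_Ico_eq_sum_range, Nat.add_sub_cancel_left, Finset.mul_sum]
    refine Finset.sum_congr rfl fun i hi => ?_
    rw [Finset.mem_range] at hi
    rw [hright, if_pos (by omega)]; ring
  · have hdisj : Disjoint (Finset.Ico (k + 1) (k + 1 + J)) (Finset.Ico (k - J) k) := by
      rw [Finset.disjoint_left]
      intro j h1 h2
      rw [Finset.mem_Ico] at h1 h2; omega
    have hsub : Finset.Ico (k + 1) (k + 1 + J) ∪ Finset.Ico (k - J) k ⊆ Finset.range n := by
      intro j hj
      rw [Finset.mem_union, Finset.mem_Ico, Finset.mem_Ico] at hj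
      rw [Finset.mem_range]; omega
    refine le_trans ?_ (Finset.sum_le_sum_of_subset_of_nonneg hsub fun j _ _ => hpos j)
    rw [Finset.sum_union hdisj, two_mul, add_mul, Finset.mul_sum]
    have hge : ∀ j : ℕ, w * g |(k : ℝ) - j| ≤ (w * if j ≤ 2 * J then 2 else 1) * g |(k : ℝ) - j| :=
      fun j => by
        have := hg |(k : ℝ) - j| (abs_nonneg _)
        refine mul_le_mul_of_nonneg_right (le_mul_of_one_le_right hw ?_) this
        split_ifs <;> norm_num
    refine add_le_add ?_ ?_
    · refine le_trans (le_of_eq ?_) (Finset.sum_le_sum fun j _ => hge j)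
      rw [Finset.sum_Ico_eq_sum_range, Nat.add_sub_cancel_left]
      exact Finset.sum_congr rfl fun i _ => by rw [hright]
    · refine le_trans (le_of_eq ?_) (Finset.sum_le_sum fun j _ => hge j)
      rw [Finset.sum_Ico_eq_sum_range, Nat.sub_sub_self hk.le, ← Finset.sum_range_reflect]
      refine Finset.sum_congr rfl fun i hi => ?_
      rw [Finset.mem_range] at hi
      have hcast : ((J - 1 - i : ℕ) : ℝ) + 1 = J - i := by
        rw [Nat.sub_sub, Nat.cast_sub (by omega)]; push_cast; ring
      have hcast2 : ((k - J + i : ℕ) : ℝ) = k - J + i := by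
        push_cast [Nat.cast_sub hk.le]; ring
      rw [hcast, hcast2, show (k : ℝ) - (k - J + i) = J - i by ring,
        abs_of_nonneg (by have : (i : ℝ) < J := by exact_mod_cast hi
                          linarith)]

lemma eventually_log_bounds {a b ε : ℝ} (ha : 0 < a) (hε : 0 < ε) :
    ∀ᶠ E : ℝ in atTop, b ≤ Real.log E ∧ Real.log E ^ 2 ≤ a * E ∧ Real.log E ^ 2 ≤ a * E ^ ε := by
  have h1 := Real.tendsto_log_atTop.eventually_ge_atTop b
  have h2 : ∀ ε : ℝ, 0 < ε → ∀ᶠ E : ℝ in atTop, Real.log E ^ 2 ≤ a * E ^ ε := by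
    intro ε hε
    have := (isLittleO_log_rpow_rpow_atTop 2 hε).bound ha
    filter_upwards [this, eventually_ge_atTop 1] with E hE hE1
    rwa [Real.norm_of_nonneg (Real.rpow_nonneg (Real.log_nonneg hE1) _),
      Real.norm_of_nonneg (by positivity), Real.rpow_two] at hE
  filter_upwards [h1, h2 1 one_pos, h2 ε hε] with E e1 e2 e3
  exact ⟨e1, by rwa [Real.rpow_one] at e2, e3⟩

lemma lower_coef_le {η c₃ : ℝ} (hc₃ : 0 < c₃) (hη0 : 0 < η) (hη : η ≤ 1 / 4) :
    (1 + 4 * (η / 16)) / (2 * (1 - η / 4) ^ 2 * c₃) + η / (8 * c₃) ≤ 1 / 2 / c₃ / (1 - η) := by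
  have h1η : 0 < 1 - η := by linarith
  have h1ε : 0 < 1 - η / 4 := by linarith
  have h2 : (1 + 4 * (η / 16)) / (1 - η / 4) ^ 2 + η / 4 ≤ 1 / (1 - η) := by
    rw [div_add' _ _ _ (by positivity), div_le_div_iff₀ (by positivity) h1η]
    have h3 : (1 - η / 4) ^ 2 ≤ 1 := by nlinarith
    have h4 : 1 - η / 2 ≤ (1 - η / 4) ^ 2 := by nlinarith
    have h5 : η / 4 * (1 - η / 4) ^ 2 ≤ η / 4 := by nlinarith
    nlinarith
  calc _ = ((1 + 4 * (η / 16)) / (1 - η / 4) ^ 2 + η / 4) * (1 / (2 * c₃)) := by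
        field_simp; ring
    _ ≤ 1 / (1 - η) * (1 / (2 * c₃)) := by gcongr
    _ = _ := by field_simp

section LowerCriticalPath

variable {lam dd : V → V → ℝ} {P : V → Measure (ℕ → V)} {α ν c₃ C₃ c C : ℝ}
variable [Countable V] [MeasurableSingletonClass V]

set_option maxHeartbeats 1000000 in
lemma Standing.lower_of_eq_one (h : Standing lam dd P α ν c₃ C₃) (hb : Bounds lam dd P α ν c C)
    {c₄ C₄ : ℝ} (hc₄ : 0 < c₄) (hC₄ : 0 < C₄) (hgeo : Geodesic lam dd c₄ C₄) (hν1 : ν = 1)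
    {u₀ η : ℝ} (hu₀ : 0 < u₀) (hη0 : 0 < η) (hη : η ≤ 1 / 4) :
    ∃ C' : ℝ, 0 < C' ∧ ∀ u, 0 < u → u ≤ u₀ → ∀ N, C' ≤ N * u → ∀ x,
      ENNReal.ofReal (Real.exp (-(1 / 2 / c₃ / (1 - η) * (N * u / max 1 (Real.log (N * u)))))) ≤
        ∫⁻ ω, ENNReal.ofReal (Real.exp (-u * capa lam P (visited (vball dd x N) ω))) ∂(P x) := by
  set ε := η / 4 with hε
  have hε0 : 0 < ε := by positivity
  have hε1 : ε ≤ 1 / 16 := by linarith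
  obtain ⟨R₀, K, Λ, hR₀, hR₀c, hK, hΛ, htube⟩ :=
    h.exists_tube hb hc₄ hC₄ hgeo (η := ε) hε0 (by linarith)
  have hc₃ := h.c₃_pos
  set δ := η / 16 with hδ
  have hδ0 : 0 < δ := by positivity
  obtain ⟨E₀, hE₀⟩ := eventually_atTop.1 (eventually_log_bounds (a := min (δ / 5) (δ / (K + 1)))
    (b := 1 + R₀ * u₀ + 16 * Λ * c₃ / η) (ε := ε) (by positivity) hε0)
  refine ⟨max E₀ 1, by positivity, fun u hu huu N hN x => ?_⟩
  set E := N * u with hE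
  obtain ⟨hL, hL1, hL2⟩ := hE₀ E ((le_max_left _ _).trans hN)
  have hE1 : 1 ≤ E := (le_max_right _ _).trans hN
  have hE0 : 0 < E := by linarith
  have hN0 : 0 < N := pos_of_mul_pos_left hE0 hu.le
  set Lg := Real.log E with hLg
  have hx1 : 0 < R₀ * u₀ := by positivity
  have hx2 : 0 < 16 * Λ * c₃ / η := by positivity
  have hLg1 : 1 ≤ Lg := by linarith
  have hLg0 : 0 < Lg := by linarith
  rw [max_eq_right hLg1]
  have hL1' : 5 * Lg ^ 2 ≤ δ * E := by
    have : Lg ^ 2 ≤ δ / 5 * E := hL1.trans (by gcongr; exact min_le_left _ _)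
    linarith
  have hL2' : (K + 1) * Lg ^ 2 ≤ δ * E ^ ε := by
    have : Lg ^ 2 ≤ δ / (K + 1) * E ^ ε := hL2.trans (by gcongr; exact min_le_right _ _)
    rw [div_mul_eq_mul_div, le_div_iff₀ (by positivity)] at this
    linarith
  set R := Lg ^ 2 / u with hR
  have hRR₀ : R₀ ≤ R := by
    rw [hR, le_div_iff₀ hu]
    have : R₀ * u ≤ R₀ * u₀ := by gcongr
    nlinarith
  have hR0 : 0 < R := by positivity
  have hRN : 5 * R ≤ δ * N := by
    rw [hR, mul_div_assoc', div_le_iff₀ hu]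
    linarith
  set J : ℕ := ⌊δ * N / c₄⌋₊ with hJ
  have hJ1 : c₄ * J ≤ δ * N := by
    have := Nat.floor_le (show 0 ≤ δ * N / c₄ by positivity)
    rw [le_div_iff₀ hc₄] at this; linarith
  have hJ2 : δ * N ≤ c₄ * (J + 1) := by
    have := Nat.lt_floor_add_one (δ * N / c₄)
    rw [div_lt_iff₀ hc₄] at this; linarith
  set n₀ : ℕ := ⌊(N + 3 * R) / c₄⌋₊ with hn₀
  have hn₀1 : c₄ * n₀ ≤ N + 3 * R := by
    have := Nat.floor_le (show 0 ≤ (N + 3 * R) / c₄ by positivity)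
    rw [le_div_iff₀ hc₄] at this; linarith
  set w : ℝ := c₄ / (2 * (1 - ε) ^ 2 * c₃ * Lg) with hw
  have h1ε : 0 < 1 - ε := by linarith
  have hw0 : 0 < w := by positivity
  set g : ℝ → ℝ := fun d => (1 - ε) * c₃ * (c₄ * d + K * R) ^ (-ν) with hg
  have hg0 : ∀ d, 0 ≤ d → 0 ≤ g d := fun d hd => by simp only [hg]; positivity
  have hS : 1 ≤ 2 * w * ∑ i ∈ Finset.range J, g ((i : ℝ) + 1) := by
    have h1 : ∀ i ∈ Finset.range J, g ((i : ℝ) + 1) =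
        (1 - ε) * c₃ * (c₄ * ((i : ℝ) + 1) + K * R)⁻¹ := fun i _ => by
      simp only [hg, hν1, Real.rpow_neg_one]
    rw [Finset.sum_congr rfl h1, ← Finset.mul_sum]
    have h2 := log_le_sum_inv hc₄ (show 0 < K * R by positivity) J
    have h3 : (1 - ε) * Lg ≤ Real.log ((c₄ * (J + 1) + K * R) / (c₄ + K * R)) := by
      rw [hLg, ← Real.log_rpow hE0]
      refine Real.log_le_log (by positivity) ?_
      rw [le_div_iff₀ (by positivity)]
      calc E ^ (1 - ε) * (c₄ + K * R) ≤ E ^ (1 - ε) * ((K + 1) * R) := by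
            gcongr; linarith
        _ = E ^ (1 - ε) * ((K + 1) * Lg ^ 2) / u := by rw [hR]; ring
        _ ≤ E ^ (1 - ε) * (δ * E ^ ε) / u := by gcongr
        _ = δ * (E ^ (1 - ε) * E ^ ε) / u := by ring
        _ = δ * N := by
            rw [← Real.rpow_add hE0, sub_add_cancel, Real.rpow_one, hE]; field_simp
        _ ≤ _ := by
            have : 0 < K * R := by positivity
            linarith
    set T := ∑ i ∈ Finset.range J, (c₄ * ((i : ℝ) + 1) + K * R)⁻¹
    calc (1 : ℝ) = 2 * w / c₄ * ((1 - ε) * c₃) * ((1 - ε) * Lg) := by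
          rw [hw]; field_simp
      _ ≤ 2 * w / c₄ * ((1 - ε) * c₃) * (c₄ * T) := by
          refine mul_le_mul_of_nonneg_left (h3.trans h2) (by positivity)
      _ = _ := by field_simp
  have hmain := htube R hRR₀ N hN0.le (Finset.range (n₀ + J + 1))
    (fun j => w * if j ≤ 2 * J then 2 else 1) (fun j => by split_ifs <;> positivity)
    (fun k hk => hS.trans (sum_two_sided_ge hw0.le g hg0 ?_)) u hu.le x
  · refine le_trans (ENNReal.ofReal_le_ofReal (Real.exp_le_exp.2 ?_)) hmain
    have hsum : ∑ j ∈ Finset.range (n₀ + J + 1), (w * if j ≤ 2 * J then 2 else 1) ≤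
        w * ((n₀ + J + 1) + (2 * J + 1)) := by
      rw [← Finset.mul_sum]
      refine mul_le_mul_of_nonneg_left ?_ hw0.le
      calc ∑ j ∈ Finset.range (n₀ + J + 1), (if j ≤ 2 * J then (2 : ℝ) else 1)
          = ∑ j ∈ Finset.range (n₀ + J + 1), (1 + if j ≤ 2 * J then (1 : ℝ) else 0) :=
            Finset.sum_congr rfl fun j _ => by split_ifs <;> norm_num
        _ = (n₀ + J + 1) + ((Finset.range (n₀ + J + 1)).filter fun j : ℕ => j ≤ 2 * J).card := by
            rw [Finset.sum_add_distrib, Finset.sum_boole]; simp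
        _ ≤ _ := by
            have : ((Finset.range (n₀ + J + 1)).filter fun j : ℕ => j ≤ 2 * J).card ≤
                2 * J + 1 := by
              rw [← Finset.card_range (2 * J + 1)]
              refine Finset.card_le_card fun j hj => ?_
              rw [Finset.mem_filter] at hj
              exact Finset.mem_range.2 (by omega)
            have : (((Finset.range (n₀ + J + 1)).filter fun j : ℕ => j ≤ 2 * J).card : ℝ) ≤
                2 * J + 1 := by exact_mod_cast this
            linarith
    have hsum2 : u * ∑ j ∈ Finset.range (n₀ + J + 1), (w * if j ≤ 2 * J then 2 else 1) ≤
        (1 + 4 * δ) / (2 * (1 - ε) ^ 2 * c₃) * (E / Lg) := by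
      calc _ ≤ u * (w * ((n₀ + J + 1) + (2 * J + 1))) := by gcongr
        _ = u * (w / c₄) * (c₄ * n₀ + 3 * (c₄ * J) + 2 * c₄) := by field_simp; ring
        _ ≤ u * (w / c₄) * (N * (1 + 4 * δ)) := by gcongr; linarith
        _ = _ := by rw [hw, hE]; field_simp
    have hΛ1 : Λ * (N / R + 1) ≤ η / (8 * c₃) * (E / Lg) := by
      have h1 : 1 ≤ N / R := by
        rw [one_le_div hR0]; nlinarith
      calc Λ * (N / R + 1) ≤ Λ * (2 * (N / R)) := by gcongr; linarith
        _ = (2 * Λ / Lg) * (E / Lg) := by rw [hR, hE]; field_simp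
        _ ≤ _ := by
            refine mul_le_mul_of_nonneg_right ?_ (by positivity)
            rw [div_le_div_iff₀ hLg0 (by positivity)]
            have : 16 * Λ * c₃ / η ≤ Lg := by linarith
            rw [div_le_iff₀ hη0] at this
            linarith
    have hcoef : (1 + 4 * δ) / (2 * (1 - ε) ^ 2 * c₃) + η / (8 * c₃) ≤ 1 / 2 / c₃ / (1 - η) :=
      lower_coef_le hc₃ hη0 hη
    have := mul_le_mul_of_nonneg_right hcoef (show 0 ≤ E / Lg by positivity)
    linarith
  · have : k ≤ n₀ := by
      rw [hn₀, Nat.le_floor_iff (by positivity), le_div_iff₀ hc₄]; linarith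
    omega

end LowerCriticalPath

lemma lintegral_beta {p q : ℝ} (hp : 0 < p) (hq : 0 < q) :
    ∫⁻ s in Ioo (0 : ℝ) 1, ENNReal.ofReal (s ^ (p - 1) * (1 - s) ^ (q - 1)) =
      ENNReal.ofReal (ProbabilityTheory.beta p q) := by
  have hB := ProbabilityTheory.beta_pos hp hq
  have h1 := ProbabilityTheory.lintegral_betaPDF_eq_one hp hq
  rw [ProbabilityTheory.lintegral_betaPDF] at h1
  have h2 : ∀ s : ℝ, ENNReal.ofReal (s ^ (p - 1) * (1 - s) ^ (q - 1)) =
      ENNReal.ofReal (ProbabilityTheory.beta p q) *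
        ENNReal.ofReal (1 / ProbabilityTheory.beta p q * s ^ (p - 1) * (1 - s) ^ (q - 1)) := by
    intro s
    rw [← ENNReal.ofReal_mul hB.le]
    congr 1
    field_simp
  simp_rw [h2]
  rw [lintegral_const_mul' _ _ ENNReal.ofReal_ne_top, h1, mul_one]

/-- The change of variables straightening the equilibrium potential of an interval. -/
def arcChart (t s : ℝ) : ℝ := (s - t) / √(s * (1 - s))

/-- The density produced by `arcChart`. -/
def arcDensity (a t σ : ℝ) : ℝ :=
  |σ| ^ (2 * a - 1) * (1 + (1 - 2 * t) * (σ / √(σ ^ 2 + 4 * (t * (1 - t))))) / (1 + σ ^ 2)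

lemma hasDerivAt_arcChart {t s : ℝ} (hs : s ∈ Ioo (0 : ℝ) 1) :
    HasDerivAt (arcChart t)
      ((s + t - 2 * t * s) / (2 * (s * (1 - s)) * √(s * (1 - s)))) s := by
  have hD : 0 < s * (1 - s) := mul_pos hs.1 (by linarith [hs.2])
  have hq : 0 < √(s * (1 - s)) := Real.sqrt_pos.2 hD
  have h1 : HasDerivAt (fun s : ℝ => s * (1 - s)) (1 - 2 * s) s := by
    have := (hasDerivAt_id s).mul ((hasDerivAt_id s).const_sub 1)
    convert! this using 1
    simp; ring
  have h2 := ((hasDerivAt_id s).sub_const t).div (h1.sqrt hD.ne') hq.ne'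
  convert! h2 using 1
  have hsq := Real.sq_sqrt hD.le
  simp only [id]
  rw [hsq, div_eq_div_iff (by positivity) hD.ne']
  field_simp
  rw [hsq]
  ring

lemma arcChart_deriv_pos {t s : ℝ} (ht : t ∈ Icc (0 : ℝ) 1) (hs : s ∈ Ioo (0 : ℝ) 1) :
    0 < s + t - 2 * t * s := by
  obtain ⟨h1, h2⟩ := hs
  obtain ⟨h3, h4⟩ := ht
  nlinarith [mul_nonneg h3 (sub_nonneg.2 h2.le), mul_nonneg h1.le (sub_nonneg.2 h4),
    mul_pos h1 (sub_pos.2 h2)]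

lemma injOn_arcChart {t : ℝ} (ht : t ∈ Icc (0 : ℝ) 1) : InjOn (arcChart t) (Ioo 0 1) := by
  refine (strictMonoOn_of_deriv_pos (convex_Ioo 0 1)
    (fun s hs => (hasDerivAt_arcChart hs).continuousAt.continuousWithinAt) fun s hs => ?_).injOn
  rw [interior_Ioo] at hs
  rw [(hasDerivAt_arcChart hs).deriv]
  have hD : 0 < s * (1 - s) := mul_pos hs.1 (by linarith [hs.2])
  have := arcChart_deriv_pos ht hs
  positivity

lemma deriv_mul_arcDensity {a t s : ℝ} (ht : t ∈ Icc (0 : ℝ) 1) (hs : s ∈ Ioo (0 : ℝ) 1) :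
    (s + t - 2 * t * s) / (2 * (s * (1 - s)) * √(s * (1 - s))) * arcDensity a t (arcChart t s) =
      (s * (1 - s)) ^ (-a) * |s - t| ^ (2 * a - 1) := by
  have hm := arcChart_deriv_pos ht hs
  have hD : 0 < s * (1 - s) := mul_pos hs.1 (by linarith [hs.2])
  set D := s * (1 - s) with hDdef
  have hq : 0 < √D := Real.sqrt_pos.2 hD
  have hsq := Real.sq_sqrt hD.le
  set m := s + t - 2 * t * s with hmdef
  have hr : √(arcChart t s ^ 2 + 4 * (t * (1 - t))) = m / √D := by
    rw [Real.sqrt_eq_iff_mul_self_eq_of_pos (by positivity), arcChart, ← hDdef, div_pow, hsq,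
      div_mul_div_comm, ← sq √D, hsq]
    field_simp
    rw [hmdef, hDdef]; ring
  have he : 0 < D + (s - t) ^ 2 := by positivity
  have h1 : 1 + arcChart t s ^ 2 = (D + (s - t) ^ 2) / D := by
    rw [arcChart, ← hDdef, div_pow, hsq]; field_simp
  have h2 : 1 + (1 - 2 * t) * (arcChart t s / (m / √D)) = 2 * (D + (s - t) ^ 2) / m := by
    rw [arcChart, ← hDdef]
    field_simp
    rw [hmdef, hDdef]; ring
  have h3 : |arcChart t s| ^ (2 * a - 1) = |s - t| ^ (2 * a - 1) * (D ^ (-a) * √D) := by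
    rw [arcChart, ← hDdef, abs_div, abs_of_pos hq, Real.div_rpow (abs_nonneg _) hq.le,
      div_eq_mul_inv, ← Real.rpow_neg hq.le, Real.sqrt_eq_rpow, ← Real.rpow_mul hD.le,
      ← Real.rpow_add hD]
    congr 2; ring
  rw [arcDensity, hr, h1, h2, h3]
  field_simp

lemma arcDensity_nonneg {a t σ : ℝ} (ht : t ∈ Icc (0 : ℝ) 1) : 0 ≤ arcDensity a t σ := by
  have hk : 0 ≤ t * (1 - t) := mul_nonneg ht.1 (by linarith [ht.2])
  refine div_nonneg (mul_nonneg (by positivity) ?_) (by positivity)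
  have h1 : |(1 - 2 * t) * (σ / √(σ ^ 2 + 4 * (t * (1 - t))))| ≤ 1 := by
    rw [abs_mul]
    refine mul_le_one₀ (abs_le.2 ⟨by linarith [ht.2], by linarith [ht.1]⟩) (abs_nonneg _) ?_
    rw [abs_div, abs_of_nonneg (Real.sqrt_nonneg _)]
    refine div_le_one_of_le₀ (Real.abs_le_sqrt (by linarith)) (Real.sqrt_nonneg _)
  linarith [neg_le_of_abs_le h1]

lemma arcDensity_add_neg (a t σ : ℝ) :
    arcDensity a t σ + arcDensity a t (-σ) = 2 * (|σ| ^ (2 * a - 1) / (1 + σ ^ 2)) := by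
  simp only [arcDensity, abs_neg, neg_sq]
  ring

lemma mem_image_arcChart {a t σ : ℝ} (ha : a < 1 / 2) (ht : t ∈ Icc (0 : ℝ) 1)
    (hσ : arcDensity a t σ ≠ 0) : σ ∈ arcChart t '' Ioo 0 1 := by
  have hσ0 : σ ≠ 0 := by
    rintro rfl
    apply hσ
    rw [arcDensity, abs_zero, Real.zero_rpow (by linarith)]; simp
  have hσ2 : 0 < σ ^ 2 := by positivity
  have key : ∀ s ∈ Ioo (0 : ℝ) 1, (s - t) ^ 2 = σ ^ 2 * (s * (1 - s)) → 0 ≤ (s - t) * σ →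
      σ ∈ arcChart t '' Ioo 0 1 := by
    intro s hs h1 h2
    refine ⟨s, hs, ?_⟩
    have hD : 0 < s * (1 - s) := mul_pos hs.1 (by linarith [hs.2])
    have hq : 0 < √(s * (1 - s)) := Real.sqrt_pos.2 hD
    have h3 : arcChart t s ^ 2 = σ ^ 2 := by
      rw [arcChart, div_pow, Real.sq_sqrt hD.le, h1, mul_div_cancel_right₀ _ hD.ne']
    rcases sq_eq_sq_iff_eq_or_eq_neg.1 h3 with h4 | h4
    · exact h4
    · have h5 : s - t = -σ * √(s * (1 - s)) := by
        rw [← h4, arcChart]; field_simp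
      rw [h5] at h2
      nlinarith [mul_pos hσ2 hq]
  have hQ : ContinuousOn (fun s : ℝ => (s - t) ^ 2 - σ ^ 2 * (s * (1 - s))) univ := by fun_prop
  rcases eq_or_lt_of_le ht.1 with h0 | h0
  · subst h0
    have hpos : 0 < σ := by
      by_contra! hneg
      apply hσ
      have : √(σ ^ 2 + 4 * (0 * (1 - 0))) = -σ := by
        rw [← abs_of_nonpos hneg, ← Real.sqrt_sq_eq_abs]; simp
      rw [arcDensity, this]
      field_simp; simp
    refine key (σ ^ 2 / (1 + σ ^ 2)) ⟨by positivity, ?_⟩ ?_ (by simp; positivity)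
    · rw [div_lt_one (by positivity)]; linarith
    · field_simp; ring
  rcases eq_or_lt_of_le ht.2 with h1 | h1
  · subst h1
    have hneg : σ < 0 := by
      by_contra! hpos
      apply hσ
      have : √(σ ^ 2 + 4 * (1 * (1 - 1))) = σ := by simp [Real.sqrt_sq hpos]
      rw [arcDensity, this]
      field_simp; norm_num
    refine key (1 / (1 + σ ^ 2)) ⟨by positivity, ?_⟩ ?_ ?_
    · rw [div_lt_one (by positivity)]; linarith
    · field_simp; ring
    · refine mul_nonneg_of_nonpos_of_nonpos ?_ hneg.le
      rw [sub_nonpos, div_le_one (by positivity)]; linarith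
  have hk : 0 < t * (1 - t) := mul_pos h0 (by linarith)
  rcases lt_or_gt_of_ne hσ0 with hneg | hpos
  · obtain ⟨s, hs, hs0⟩ := intermediate_value_Icc' h0.le (hQ.mono (subset_univ _))
      (show (0 : ℝ) ∈ _ from ⟨by simp; positivity, by simp; positivity⟩)
    have hs0' : (s - t) ^ 2 = σ ^ 2 * (s * (1 - s)) := by simpa [sub_eq_zero] using hs0
    refine key s ⟨lt_of_le_of_ne hs.1 ?_, by linarith [hs.2]⟩ hs0'
      (mul_nonneg_of_nonpos_of_nonpos (by linarith [hs.2]) hneg.le)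
    rintro rfl
    simp at hs0'
    exact h0.ne' hs0'
  · obtain ⟨s, hs, hs0⟩ := intermediate_value_Icc h1.le (hQ.mono (subset_univ _))
      (show (0 : ℝ) ∈ _ from ⟨by simp; positivity, by simp; positivity⟩)
    have hs0' : (s - t) ^ 2 = σ ^ 2 * (s * (1 - s)) := by simpa [sub_eq_zero] using hs0
    refine key s ⟨by linarith [hs.1], lt_of_le_of_ne hs.2 ?_⟩ hs0'
      (mul_nonneg (by linarith [hs.1]) hpos.le)
    rintro rfl
    simp at hs0'
    linarith

lemma measurable_arcDensity (a t : ℝ) : Measurable (arcDensity a t) := by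
  unfold arcDensity
  fun_prop

lemma lintegral_riesz_eq {a t : ℝ} (ha : a < 1 / 2) (ht : t ∈ Icc (0 : ℝ) 1) :
    ∫⁻ s in Ioo (0 : ℝ) 1, ENNReal.ofReal ((s * (1 - s)) ^ (-a) * |s - t| ^ (2 * a - 1)) =
      ∫⁻ σ : ℝ, ENNReal.ofReal (|σ| ^ (2 * a - 1) / (1 + σ ^ 2)) := by
  set S := arcChart t '' Ioo 0 1
  have h1 := lintegral_image_eq_lintegral_abs_deriv_mul measurableSet_Ioo
    (fun s hs => (hasDerivAt_arcChart (t := t) hs).hasDerivWithinAt) (injOn_arcChart ht)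
    (fun σ => ENNReal.ofReal (arcDensity a t σ))
  have h2 : ∫⁻ s in Ioo (0 : ℝ) 1,
      ENNReal.ofReal ((s * (1 - s)) ^ (-a) * |s - t| ^ (2 * a - 1)) =
      ∫⁻ σ in S, ENNReal.ofReal (arcDensity a t σ) := by
    rw [h1]
    refine setLIntegral_congr_fun measurableSet_Ioo fun s hs => ?_
    have hD : 0 < s * (1 - s) := mul_pos hs.1 (by linarith [hs.2])
    have hm := arcChart_deriv_pos ht hs
    rw [← deriv_mul_arcDensity ht hs, abs_of_pos (by positivity),
      ENNReal.ofReal_mul (by positivity)]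
  have hS : MeasurableSet S := measurableSet_Ioo.image_of_continuousOn_injOn
    (fun s hs => (hasDerivAt_arcChart hs).continuousAt.continuousWithinAt) (injOn_arcChart ht)
  have h3 : ∫⁻ σ in S, ENNReal.ofReal (arcDensity a t σ) =
      ∫⁻ σ, ENNReal.ofReal (arcDensity a t σ) := by
    rw [← lintegral_indicator hS]
    congr 1
    refine indicator_eq_self.2 fun σ hσ => mem_image_arcChart ha ht fun h0 => hσ ?_
    simp [h0]
  have h4 : ∫⁻ σ, ENNReal.ofReal (arcDensity a t (-σ)) =
      ∫⁻ σ, ENNReal.ofReal (arcDensity a t σ) :=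
    (Measure.measurePreserving_neg (volume : Measure ℝ)).lintegral_comp
      (f := fun σ => ENNReal.ofReal (arcDensity a t σ)) (measurable_arcDensity a t).ennreal_ofReal
  have h5 : 2 * ∫⁻ σ, ENNReal.ofReal (arcDensity a t σ) =
      2 * ∫⁻ σ : ℝ, ENNReal.ofReal (|σ| ^ (2 * a - 1) / (1 + σ ^ 2)) := by
    conv_lhs => rw [two_mul]
    nth_rewrite 2 [← h4]
    rw [← lintegral_add_left (measurable_arcDensity a t).ennreal_ofReal,
      ← lintegral_const_mul' _ _ (by simp)]
    refine lintegral_congr fun σ => ?_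
    rw [← ENNReal.ofReal_add (arcDensity_nonneg ht) (arcDensity_nonneg ht), arcDensity_add_neg,
      ENNReal.ofReal_mul (by norm_num)]
    simp
  rw [h2, h3]
  exact (ENNReal.mul_right_inj (by norm_num) (by norm_num)).1 h5

/-- The potential of the equilibrium density of the unit interval for the Riesz kernel is
constant on the interval. -/
lemma lintegral_riesz {a t : ℝ} (ha0 : 0 < a) (ha : a < 1 / 2) (ht : t ∈ Icc (0 : ℝ) 1) :
    ∫⁻ s in Ioo (0 : ℝ) 1, ENNReal.ofReal ((s * (1 - s)) ^ (-a) * |s - t| ^ (2 * a - 1)) =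
      ENNReal.ofReal (Real.pi / Real.sin (Real.pi * a)) := by
  rw [lintegral_riesz_eq ha ht, ← lintegral_riesz_eq ha (t := 0) (by simp)]
  have h1 := lintegral_beta ha0 (show 0 < 1 - a by linarith)
  rw [ProbabilityTheory.beta, Real.Gamma_mul_Gamma_one_sub, add_sub_cancel, Real.Gamma_one,
    div_one] at h1
  rw [← h1]
  refine setLIntegral_congr_fun measurableSet_Ioo fun s hs => ?_
  have h1s : 0 < 1 - s := by linarith [hs.2]
  have h0s := hs.1
  rw [sub_zero, abs_of_pos h0s, Real.mul_rpow h0s.le h1s.le, mul_right_comm, ← Real.rpow_add h0s]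
  congr 3 <;> ring

/-- Uniform lower bound on the regularized potential of the equilibrium density. -/
lemma exists_regularized_riesz_ge {a ε : ℝ} (ha0 : 0 < a) (ha : a < 1 / 2) (hε : 0 < ε) :
    ∃ h : ℝ, 0 < h ∧ ∀ t ∈ Icc (0 : ℝ) 1,
      ENNReal.ofReal ((1 - ε) * (Real.pi / Real.sin (Real.pi * a))) ≤
        ∫⁻ s in Ioo (0 : ℝ) 1,
          ENNReal.ofReal ((s * (1 - s)) ^ (-a) * (|s - t| + h) ^ (2 * a - 1)) := by
  by_contra! hcon
  set h : ℕ → ℝ := fun n => 1 / ((n : ℝ) + 1) with hh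
  have hpos : ∀ n, 0 < h n := fun n => by simp only [hh]; positivity
  choose t ht hlt using fun n => hcon (h n) (hpos n)
  obtain ⟨t₀, ht₀, φ, hφ, hlim⟩ := isCompact_Icc.tendsto_subseq ht
  have hsin : 0 < Real.sin (Real.pi * a) :=
    Real.sin_pos_of_pos_of_lt_pi (by positivity) (by nlinarith [Real.pi_pos])
  have hL : 0 < Real.pi / Real.sin (Real.pi * a) := div_pos Real.pi_pos hsin
  set L := Real.pi / Real.sin (Real.pi * a)
  have hmeas : ∀ n : ℕ, Measurable fun s : ℝ =>
      ENNReal.ofReal ((s * (1 - s)) ^ (-a) * (|s - t (φ n)| + h (φ n)) ^ (2 * a - 1)) :=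
    fun n => by fun_prop
  have hpt : ∀ᵐ s ∂(volume.restrict (Ioo (0 : ℝ) 1)),
      ENNReal.ofReal ((s * (1 - s)) ^ (-a) * |s - t₀| ^ (2 * a - 1)) ≤
      liminf (fun n => ENNReal.ofReal
        ((s * (1 - s)) ^ (-a) * (|s - t (φ n)| + h (φ n)) ^ (2 * a - 1))) atTop := by
    have hne : ∀ᵐ s ∂(volume : Measure ℝ), s ≠ t₀ := by
      simp [ae_iff]
    filter_upwards [ae_restrict_of_ae hne] with s hs
    have h1 : Tendsto (fun n => |s - t (φ n)| + h (φ n)) atTop (𝓝 (|s - t₀| + 0)) :=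
      ((tendsto_const_nhds.sub hlim).abs).add
        (tendsto_one_div_add_atTop_nhds_zero_nat.comp hφ.tendsto_atTop)
    rw [add_zero] at h1
    have h2 := (h1.rpow_const (p := 2 * a - 1)
      (Or.inl (abs_ne_zero.2 (sub_ne_zero.2 hs)))).const_mul ((s * (1 - s)) ^ (-a))
    exact (ENNReal.tendsto_ofReal h2).liminf_eq.ge
  have h1 := (lintegral_mono_ae hpt).trans (lintegral_liminf_le hmeas)
  rw [lintegral_riesz ha0 ha ht₀] at h1
  have h2 : liminf (fun n => ∫⁻ s in Ioo (0 : ℝ) 1, ENNReal.ofReal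
      ((s * (1 - s)) ^ (-a) * (|s - t (φ n)| + h (φ n)) ^ (2 * a - 1))) atTop ≤
      ENNReal.ofReal ((1 - ε) * L) := by
    refine (liminf_le_liminf (Eventually.of_forall fun n => (hlt (φ n)).le)).trans ?_
    rw [liminf_const]
  have h3 := h1.trans h2
  rw [ENNReal.ofReal_le_ofReal_iff'] at h3
  rcases h3 with h3 | h3
  · nlinarith [mul_pos hε hL]
  · linarith

/-- The `j`-th cell of mesh `q` in the unit interval. -/
def arcCell (q : ℝ) (j : ℕ) : Set ℝ := Ico (q * j) (q * (j + 1)) ∩ Ioo 0 1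

/-- The arcsine-type mass of the `j`-th cell of mesh `q`. -/
def arcMass (a q : ℝ) (j : ℕ) : ℝ :=
  (∫⁻ s in arcCell q j, ENNReal.ofReal ((s * (1 - s)) ^ (-a))).toReal

lemma arcMass_nonneg (a q : ℝ) (j : ℕ) : 0 ≤ arcMass a q j := ENNReal.toReal_nonneg

lemma measurableSet_arcCell (q : ℝ) (j : ℕ) : MeasurableSet (arcCell q j) :=
  measurableSet_Ico.inter measurableSet_Ioo

lemma pairwiseDisjoint_arcCell {q : ℝ} (hq : 0 < q) (s : Set ℕ) :
    s.PairwiseDisjoint (arcCell q) := by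
  intro i _ j _ hij
  refine Set.disjoint_left.2 fun x hx hy => hij ?_
  obtain ⟨⟨h1, h2⟩, -⟩ := hx
  obtain ⟨⟨h3, h4⟩, -⟩ := hy
  have h5 : (i : ℝ) < j + 1 := lt_of_mul_lt_mul_left (h1.trans_lt h4) hq.le
  have h6 : (j : ℝ) < i + 1 := lt_of_mul_lt_mul_left (h3.trans_lt h2) hq.le
  have h5' : i < j + 1 := by exact_mod_cast h5
  have h6' : j < i + 1 := by exact_mod_cast h6
  omega

lemma biUnion_arcCell {q : ℝ} (hq : 0 < q) {n : ℕ} (hn : 1 ≤ q * n) :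
    ⋃ j ∈ Finset.range n, arcCell q j = Ioo 0 1 := by
  ext x
  simp only [Set.mem_iUnion, Finset.mem_range, arcCell, Set.mem_inter_iff, exists_prop]
  refine ⟨fun ⟨j, _, _, h⟩ => h, fun hx => ⟨⌊x / q⌋₊, ?_, ⟨?_, ?_⟩, hx⟩⟩
  · rw [Nat.floor_lt (div_nonneg hx.1.le hq.le), div_lt_iff₀ hq]
    linarith [hx.2]
  · have := Nat.floor_le (div_nonneg hx.1.le hq.le)
    rw [le_div_iff₀ hq] at this; linarith
  · have := Nat.lt_floor_add_one (x / q)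
    rw [div_lt_iff₀ hq] at this; linarith

lemma lintegral_arc {a : ℝ} (ha : a < 1) :
    ∫⁻ s in Ioo (0 : ℝ) 1, ENNReal.ofReal ((s * (1 - s)) ^ (-a)) =
      ENNReal.ofReal (ProbabilityTheory.beta (1 - a) (1 - a)) := by
  rw [← lintegral_beta (by linarith) (by linarith)]
  refine setLIntegral_congr_fun measurableSet_Ioo fun s hs => ?_
  have h1s : 0 < 1 - s := by linarith [hs.2]
  rw [Real.mul_rpow hs.1.le h1s.le]
  congr 3 <;> ring

lemma ofReal_arcMass {a : ℝ} (ha : a < 1) (q : ℝ) (j : ℕ) :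
    ENNReal.ofReal (arcMass a q j) =
      ∫⁻ s in arcCell q j, ENNReal.ofReal ((s * (1 - s)) ^ (-a)) := by
  refine ENNReal.ofReal_toReal (ne_top_of_le_ne_top ENNReal.ofReal_ne_top
    ((lintegral_mono_set inter_subset_right).trans (lintegral_arc ha).le))

lemma sum_arcMass {a q : ℝ} (ha : a < 1) (hq : 0 < q) {n : ℕ} (hn : 1 ≤ q * n) :
    ∑ j ∈ Finset.range n, arcMass a q j = ProbabilityTheory.beta (1 - a) (1 - a) := by
  have hB := ProbabilityTheory.beta_pos (show 0 < 1 - a by linarith) (show 0 < 1 - a by linarith)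
  rw [← ENNReal.toReal_ofReal (Finset.sum_nonneg fun j _ => arcMass_nonneg a q j),
    ENNReal.ofReal_sum_of_nonneg fun j _ => arcMass_nonneg a q j]
  simp_rw [ofReal_arcMass ha]
  rw [← lintegral_biUnion_finset (pairwiseDisjoint_arcCell hq _)
    (fun j _ => measurableSet_arcCell q j), biUnion_arcCell hq hn, lintegral_arc ha,
    ENNReal.toReal_ofReal hB.le]

lemma exists_sum_arcMass_ge {a ε : ℝ} (ha0 : 0 < a) (ha : a < 1 / 2) (hε : 0 < ε) :
    ∃ h : ℝ, 0 < h ∧ ∀ q, 0 < q → q ≤ h → ∀ n k : ℕ, 1 ≤ q * n → q * k ≤ 1 →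
      (1 - ε) * (Real.pi / Real.sin (Real.pi * a)) ≤
        ∑ j ∈ Finset.range n, arcMass a q j * (q * |(k : ℝ) - j| + h) ^ (2 * a - 1) := by
  obtain ⟨h, hh, hreg⟩ := exists_regularized_riesz_ge ha0 ha hε
  refine ⟨h / 2, by positivity, fun q hq hqh n k hn hk => ?_⟩
  have h1 := hreg (q * k) ⟨by positivity, hk⟩
  have hnn : ∀ j : ℕ, 0 ≤ arcMass a q j * (q * |(k : ℝ) - j| + h / 2) ^ (2 * a - 1) := fun j =>
    mul_nonneg (arcMass_nonneg a q j) (by positivity)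
  rw [← ENNReal.ofReal_le_ofReal_iff (Finset.sum_nonneg fun j _ => hnn j)]
  refine h1.trans ?_
  rw [ENNReal.ofReal_sum_of_nonneg fun j _ => hnn j, ← biUnion_arcCell hq hn,
    lintegral_biUnion_finset (pairwiseDisjoint_arcCell hq _) fun j _ => measurableSet_arcCell q j]
  refine Finset.sum_le_sum fun j _ => ?_
  rw [ENNReal.ofReal_mul (arcMass_nonneg a q j), ofReal_arcMass (by linarith),
    ← lintegral_mul_const' _ _ ENNReal.ofReal_ne_top]
  refine setLIntegral_mono' (measurableSet_arcCell q j) fun s hs => ?_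
  obtain ⟨⟨h2, h3⟩, hs0, hs1⟩ := hs
  have hD : 0 < s * (1 - s) := mul_pos hs0 (by linarith)
  rw [← ENNReal.ofReal_mul (by positivity)]
  refine ENNReal.ofReal_le_ofReal (mul_le_mul_of_nonneg_left ?_ (by positivity))
  refine Real.rpow_le_rpow_of_nonpos (by positivity) ?_ (by linarith)
  have h4 : q * |(k : ℝ) - j| ≤ |s - q * k| + q := by
    rw [← abs_of_pos hq, ← abs_mul, abs_of_pos hq, mul_sub]
    calc |q * (k : ℝ) - q * j| = |(q * k - s) + (s - q * j)| := by ring_nf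
      _ ≤ |q * k - s| + |s - q * j| := abs_add_le _ _
      _ ≤ _ := by
        rw [abs_sub_comm (q * (k : ℝ)) s, abs_of_nonneg (sub_nonneg.2 h2)]
        linarith
  linarith

lemma sum_arcMass_far_le {a ε : ℝ} (ha0 : 0 < a) (ha : a < 1 / 2) (hε1 : ε < 1) {q : ℝ}
    (hq : 0 < q) {A : ℕ} (hA : 1 ≤ A) (hεA : 1 ≤ ε * (A + 1)) {n k : ℕ} (hk : q * k ≤ 1) :
    ∑ j ∈ (Finset.range n).filter (fun j => A ≤ Nat.dist j k),
        arcMass a q j * (q * |(k : ℝ) - j|) ^ (2 * a - 1) ≤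
      (1 - ε) ^ (2 * a - 1) * (Real.pi / Real.sin (Real.pi * a)) := by
  have hsin : 0 < Real.sin (Real.pi * a) :=
    Real.sin_pos_of_pos_of_lt_pi (by positivity) (by nlinarith [Real.pi_pos])
  have h1ε : 0 < 1 - ε := by linarith
  have hL : 0 < Real.pi / Real.sin (Real.pi * a) := div_pos Real.pi_pos hsin
  have hnn : ∀ j : ℕ, 0 ≤ arcMass a q j * (q * |(k : ℝ) - j|) ^ (2 * a - 1) := fun j =>
    mul_nonneg (arcMass_nonneg a q j) (by positivity)
  rw [← ENNReal.ofReal_le_ofReal_iff (by positivity),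
    ENNReal.ofReal_sum_of_nonneg fun j _ => hnn j, ENNReal.ofReal_mul (by positivity),
    ← lintegral_riesz ha0 ha ⟨by positivity, hk⟩]
  rw [← lintegral_const_mul' _ _ ENNReal.ofReal_ne_top]
  refine le_trans (Finset.sum_le_sum (g := fun j => ∫⁻ s in arcCell q j,
    ENNReal.ofReal ((1 - ε) ^ (2 * a - 1)) *
      ENNReal.ofReal ((s * (1 - s)) ^ (-a) * |s - q * k| ^ (2 * a - 1))) fun j hj => ?_) ?_
  · rw [Finset.mem_filter] at hj
    have hjA : (A : ℝ) ≤ |(k : ℝ) - j| := by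
      rw [abs_sub_comm, ← cast_dist]; exact_mod_cast hj.2
    rw [ENNReal.ofReal_mul (arcMass_nonneg a q j), ofReal_arcMass (by linarith),
      ← lintegral_mul_const' _ _ ENNReal.ofReal_ne_top]
    refine setLIntegral_mono' (measurableSet_arcCell q j) fun s hs => ?_
    obtain ⟨⟨h2, h3⟩, hs0, hs1⟩ := hs
    have hD : 0 < s * (1 - s) := mul_pos hs0 (by linarith)
    rw [← ENNReal.ofReal_mul (by positivity), ← ENNReal.ofReal_mul (by positivity),
      mul_left_comm, ← Real.mul_rpow h1ε.le (abs_nonneg _)]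
    refine ENNReal.ofReal_le_ofReal (mul_le_mul_of_nonneg_left ?_ (by positivity))
    have hne : s - q * k ≠ 0 := by
      intro h0
      rw [sub_eq_zero.1 h0] at h2 h3
      have h5 : (j : ℝ) ≤ k := le_of_mul_le_mul_left h2 hq
      have h6 : (k : ℝ) < j + 1 := lt_of_mul_lt_mul_left h3 hq.le
      have h5' : j ≤ k := by exact_mod_cast h5
      have h6' : k < j + 1 := by exact_mod_cast h6
      have : j = k := by omega
      subst this
      simp at hj
      omega
    refine Real.rpow_le_rpow_of_nonpos (mul_pos h1ε (abs_pos.2 hne)) ?_ (by linarith)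
    have h4 : |s - q * k| ≤ q * |(k : ℝ) - j| + q := by
      calc |s - q * k| = |(s - q * j) + q * (j - k)| := by ring_nf
        _ ≤ |s - q * j| + |q * ((j : ℝ) - k)| := abs_add_le _ _
        _ ≤ _ := by
          rw [abs_mul, abs_of_pos hq, abs_sub_comm (k : ℝ), abs_of_nonneg (sub_nonneg.2 h2)]
          linarith
    have h5 : 1 ≤ ε * (|(k : ℝ) - j| + 1) := by
      have h0 : 0 < ε := by
        by_contra! h0
        nlinarith [mul_nonneg (neg_nonneg.2 h0) (show (0 : ℝ) ≤ (A : ℝ) + 1 by positivity)]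
      exact hεA.trans (by gcongr)
    calc (1 - ε) * |s - q * k| ≤ (1 - ε) * (q * |(k : ℝ) - j| + q) := by gcongr
      _ = q * ((|(k : ℝ) - j| + 1) - ε * (|(k : ℝ) - j| + 1)) := by ring
      _ ≤ _ := by gcongr; linarith
  · rw [← lintegral_biUnion_finset (pairwiseDisjoint_arcCell hq _)
      fun j _ => measurableSet_arcCell q j]
    exact lintegral_mono_set (Set.iUnion₂_subset fun j _ => inter_subset_right)

lemma exists_arcMass_le {a : ℝ} (ha0 : 0 < a) (ha : a < 1 / 2) :
    ∃ B : ℝ, 0 < B ∧ ∀ q, 0 < q → q ≤ 1 → ∀ j,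
      arcMass a q j ≤ B * q ^ (1 - 2 * a + 2 * a ^ 2) := by
  have hB := ProbabilityTheory.beta_pos (show 0 < 1 - (a + 1 / 2) by linarith)
    (show 0 < 1 - (a + 1 / 2) by linarith)
  set B := ProbabilityTheory.beta (1 - (a + 1 / 2)) (1 - (a + 1 / 2))
  refine ⟨1 + B, by positivity, fun q hq hq1 j => ?_⟩
  set θ := q ^ (2 - 2 * a) with hθ
  have hθ0 : 0 < θ := by positivity
  have hvol : volume (arcCell q j) ≤ ENNReal.ofReal q := by
    refine (measure_mono inter_subset_left).trans ?_
    rw [Real.volume_Ico]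
    exact ENNReal.ofReal_le_ofReal (by linarith)
  have hpt : ∀ s ∈ arcCell q j, ENNReal.ofReal ((s * (1 - s)) ^ (-a)) ≤
      ENNReal.ofReal (θ ^ (-a)) +
        ENNReal.ofReal (θ ^ (1 / 2 : ℝ)) * ENNReal.ofReal ((s * (1 - s)) ^ (-(a + 1 / 2))) := by
    intro s hs
    have hD : 0 < s * (1 - s) := mul_pos hs.2.1 (by linarith [hs.2.2])
    rw [← ENNReal.ofReal_mul (by positivity), ← ENNReal.ofReal_add (by positivity) (by positivity)]
    refine ENNReal.ofReal_le_ofReal ?_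
    rcases le_total θ (s * (1 - s)) with h1 | h1
    · have := Real.rpow_le_rpow_of_nonpos hθ0 h1 (show -a ≤ 0 by linarith)
      have : 0 ≤ θ ^ (1 / 2 : ℝ) * (s * (1 - s)) ^ (-(a + 1 / 2)) := by positivity
      linarith
    · have h2 : (s * (1 - s)) ^ (-a) = (s * (1 - s)) ^ (1 / 2 : ℝ) *
          (s * (1 - s)) ^ (-(a + 1 / 2)) := by
        rw [← Real.rpow_add hD]; congr 1; ring
      have h3 : (s * (1 - s)) ^ (1 / 2 : ℝ) ≤ θ ^ (1 / 2 : ℝ) := by gcongr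
      have h4 : 0 ≤ θ ^ (-a) := by positivity
      rw [h2]
      have := mul_le_mul_of_nonneg_right h3
        (show 0 ≤ (s * (1 - s)) ^ (-(a + 1 / 2)) by positivity)
      linarith
  have h1 : ENNReal.ofReal (arcMass a q j) ≤
      ENNReal.ofReal (θ ^ (-a) * q + θ ^ (1 / 2 : ℝ) * B) := by
    rw [ofReal_arcMass (by linarith)]
    refine (setLIntegral_mono' (measurableSet_arcCell q j) hpt).trans ?_
    rw [lintegral_add_left measurable_const, setLIntegral_const,
      lintegral_const_mul' _ _ ENNReal.ofReal_ne_top, ENNReal.ofReal_add (by positivity)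
      (by positivity), ENNReal.ofReal_mul (by positivity), ENNReal.ofReal_mul (by positivity)]
    gcongr
    exact (lintegral_mono_set inter_subset_right).trans (lintegral_arc (by linarith)).le
  rw [ENNReal.ofReal_le_ofReal_iff (by positivity)] at h1
  refine h1.trans ?_
  have h2 : θ ^ (-a) * q = q ^ (1 - 2 * a + 2 * a ^ 2) := by
    rw [hθ, ← Real.rpow_mul hq.le]
    nth_rewrite 2 [← Real.rpow_one q]
    rw [← Real.rpow_add hq]; congr 1; ring
  have h3 : θ ^ (1 / 2 : ℝ) ≤ q ^ (1 - 2 * a + 2 * a ^ 2) := by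
    rw [hθ, ← Real.rpow_mul hq.le]
    exact Real.rpow_le_rpow_of_exponent_ge hq hq1 (by nlinarith)
  rw [h2, add_mul, one_mul, mul_comm B]
  gcongr

lemma kappaNu_eq {ν : ℝ} (hν1 : ν < 1) :
    kappaNu ν = ProbabilityTheory.beta (1 - (1 - ν) / 2) (1 - (1 - ν) / 2) /
      (Real.pi / Real.sin (Real.pi * ((1 - ν) / 2))) := by
  rw [kappaNu, if_pos hν1, ProbabilityTheory.beta,
    show Real.pi * ((1 - ν) / 2) = Real.pi / 2 - Real.pi * ν / 2 by ring, Real.sin_pi_div_two_sub,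
    show 1 - (1 - ν) / 2 + (1 - (1 - ν) / 2) = 1 + ν by ring,
    show 1 - (1 - ν) / 2 = (1 + ν) / 2 by ring, div_div_eq_mul_div]

lemma sin_half_pos {ν : ℝ} (hν0 : 0 < ν) (hν1 : ν < 1) :
    0 < Real.sin (Real.pi * ((1 - ν) / 2)) :=
  Real.sin_pos_of_pos_of_lt_pi (mul_pos Real.pi_pos (by linarith)) (by nlinarith [Real.pi_pos])

lemma kappaNu_pos {ν : ℝ} (hν0 : 0 < ν) : 0 < kappaNu ν := by
  rcases lt_or_ge ν 1 with hν1 | hν1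
  · rw [kappaNu_eq hν1]
    exact div_pos (ProbabilityTheory.beta_pos (by linarith) (by linarith))
      (div_pos Real.pi_pos (sin_half_pos hν0 hν1))
  · rw [kappaNu, if_neg (by linarith)]; norm_num

section LowerSubcriticalPath

variable {lam dd : V → V → ℝ} {P : V → Measure (ℕ → V)} {α ν c₃ C₃ c C : ℝ}
variable [Countable V] [MeasurableSingletonClass V]

lemma Standing.lower_of_lt_one (h : Standing lam dd P α ν c₃ C₃) (hb : Bounds lam dd P α ν c C)
    {c₄ C₄ : ℝ} (hc₄ : 0 < c₄) (hC₄ : 0 < C₄) (hgeo : Geodesic lam dd c₄ C₄) (hν1 : ν < 1)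
    {u₀ η : ℝ} (hu₀ : 0 < u₀) (hη0 : 0 < η) (hη : η ≤ 1 / 4) :
    ∃ C' : ℝ, 0 < C' ∧ ∀ u, 0 < u → u ≤ u₀ → ∀ N, 0 < N → C' ≤ N ^ ν * u → ∀ x,
      ENNReal.ofReal (Real.exp (-(kappaNu ν / c₃ / (1 - η) * (N ^ ν * u)))) ≤
        ∫⁻ ω, ENNReal.ofReal (Real.exp (-u * capa lam P (visited (vball dd x N) ω))) ∂(P x) := by
  have hν0 := h.nu_pos
  have hc₃ := h.c₃_pos
  set a := (1 - ν) / 2 with ha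
  have ha0 : 0 < a := by rw [ha]; linarith
  have ha1 : a < 1 / 2 := by rw [ha]; linarith
  have hν : 2 * a - 1 = -ν := by rw [ha]; ring
  have hsin : 0 < Real.sin (Real.pi * a) := sin_half_pos hν0 hν1
  have hL : 0 < Real.pi / Real.sin (Real.pi * a) := div_pos Real.pi_pos hsin
  have hκ := kappaNu_pos hν0
  have hκeq := kappaNu_eq hν1
  rw [← ha] at hκeq
  set L := Real.pi / Real.sin (Real.pi * a)
  set β := ProbabilityTheory.beta (1 - a) (1 - a)
  set ε := η / 4 with hε
  have hε0 : 0 < ε := by positivity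
  have hε1 : ε ≤ 1 / 16 := by linarith
  have h1ε : 0 < 1 - ε := by linarith
  obtain ⟨R₀, K, Λ, hR₀, hR₀c, hK, hΛ, htube⟩ :=
    h.exists_tube hb hc₄ hC₄ hgeo (η := ε) hε0 (by linarith)
  obtain ⟨h', hh', hsum⟩ := exists_sum_arcMass_ge ha0 ha1 hε0
  set δ := min (h' / K) (η / 12) with hδ
  have hδ0 : 0 < δ := by positivity
  have hδK : K * δ ≤ h' := by
    have : δ ≤ h' / K := min_le_left _ _
    rw [le_div_iff₀ (by positivity)] at this; linarith
  have hδη : δ ≤ η / 12 := min_le_right _ _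
  have hδh : δ ≤ h' := le_trans (le_mul_of_one_le_left hδ0.le hK) hδK
  refine ⟨max (u₀ * (R₀ / δ) ^ ν) (Λ * (1 / δ + 1) * (4 * c₃) / (η * kappaNu ν)), by positivity,
    fun u hu huu N hN0 hN x => ?_⟩
  have hE0 : 0 < N ^ ν * u := by positivity
  have hRR₀ : R₀ ≤ δ * N := by
    have h1 : u₀ * (R₀ / δ) ^ ν ≤ N ^ ν * u := (le_max_left _ _).trans hN
    have h2 : N ^ ν * u ≤ u₀ * N ^ ν := by rw [mul_comm]; gcongr
    have h3 := le_of_mul_le_mul_left (h1.trans h2) hu₀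
    rw [Real.rpow_le_rpow_iff (by positivity) hN0.le hν0, div_le_iff₀ hδ0] at h3
    linarith
  have hΛ1 : Λ * (N / (δ * N) + 1) ≤ η * kappaNu ν / (4 * c₃) * (N ^ ν * u) := by
    have h1 := (le_max_right _ _).trans hN
    rw [div_le_iff₀ (by positivity)] at h1
    rw [div_mul_eq_mul_div, le_div_iff₀ (by positivity)]
    have h2 : N / (δ * N) = 1 / δ := by field_simp
    rw [h2]
    linarith
  set N' := N * (1 + 3 * δ) with hN'
  have hN'0 : 0 < N' := by positivity
  have hNN' : N ≤ N' := by rw [hN']; nlinarith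
  set q := c₄ / N' with hq
  have hq0 : 0 < q := by positivity
  have hqN : q * N' = c₄ := by rw [hq]; field_simp
  have hqh : q ≤ h' := by
    rw [hq, div_le_iff₀ hN'0]
    calc c₄ ≤ δ * N := hR₀c.trans hRR₀
      _ ≤ h' * N' := by gcongr
  set n : ℕ := ⌊1 / q⌋₊ + 1 with hn
  have hqn : 1 ≤ q * n := by
    have := Nat.lt_floor_add_one (1 / q)
    rw [div_lt_iff₀ hq0] at this
    rw [hn]; push_cast; linarith
  set W := N' ^ ν / ((1 - ε) ^ 2 * c₃ * L) with hW
  have hW0 : 0 < W := by positivity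
  have hmain := htube (δ * N) hRR₀ N hN0.le (Finset.range n) (fun j => W * arcMass a q j)
    (fun j => mul_nonneg hW0.le (arcMass_nonneg a q j)) (fun k hk => ?_) u hu.le x
  · refine le_trans (ENNReal.ofReal_le_ofReal (Real.exp_le_exp.2 ?_)) hmain
    rw [← Finset.mul_sum, sum_arcMass (by linarith) hq0 hqn]
    have h1 : u * (W * β) ≤ 2 * kappaNu ν * ((1 + 4 * (η / 16)) / (2 * (1 - ε) ^ 2 * c₃)) *
        (N ^ ν * u) := by
      have h2 : N' ^ ν ≤ N ^ ν * (1 + 4 * (η / 16)) := by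
        rw [hN', Real.mul_rpow hN0.le (by positivity)]
        gcongr
        calc (1 + 3 * δ) ^ ν ≤ (1 + 3 * δ) ^ (1 : ℝ) :=
              Real.rpow_le_rpow_of_exponent_le (by linarith) hν1.le
          _ ≤ _ := by rw [Real.rpow_one]; linarith
      have h3 : β = kappaNu ν * L := by rw [hκeq]; field_simp
      calc u * (W * β) = N' ^ ν * (u * kappaNu ν / ((1 - ε) ^ 2 * c₃)) := by
            rw [h3, hW]; field_simp
        _ ≤ N ^ ν * (1 + 4 * (η / 16)) * (u * kappaNu ν / ((1 - ε) ^ 2 * c₃)) := by gcongr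
        _ = _ := by field_simp
    have h4 := mul_le_mul_of_nonneg_right (lower_coef_le hc₃ hη0 hη)
      (show 0 ≤ 2 * kappaNu ν * (N ^ ν * u) by positivity)
    have h5 : 1 / 2 / c₃ / (1 - η) * (2 * kappaNu ν * (N ^ ν * u)) =
        kappaNu ν / c₃ / (1 - η) * (N ^ ν * u) := by ring
    have h6 : η / (8 * c₃) * (2 * kappaNu ν * (N ^ ν * u)) =
        η * kappaNu ν / (4 * c₃) * (N ^ ν * u) := by field_simp; ring
    rw [h5, add_mul, h6] at h4
    linarith
  · have hqk : q * k ≤ 1 := by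
      rw [hq, div_mul_eq_mul_div, div_le_one hN'0, hN']; linarith
    have h1 := hsum q hq0 hqh n k hqn hqk
    have h2 : 1 = W * ((1 - ε) * c₃ * N' ^ (-ν)) * ((1 - ε) * L) := by
      rw [hW, Real.rpow_neg hN'0.le]; field_simp
    refine h2.le.trans ((mul_le_mul_of_nonneg_left h1 (by positivity)).trans ?_)
    rw [Finset.mul_sum]
    refine Finset.sum_le_sum fun j _ => ?_
    have h3 : N' ^ (-ν) * (q * |(k : ℝ) - j| + h') ^ (-ν) ≤
        (c₄ * |(k : ℝ) - j| + K * (δ * N)) ^ (-ν) := by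
      rw [← Real.mul_rpow hN'0.le (by positivity)]
      refine Real.rpow_le_rpow_of_nonpos (by positivity) ?_ (by linarith)
      calc c₄ * |(k : ℝ) - j| + K * (δ * N) = q * N' * |(k : ℝ) - j| + K * δ * N := by
            rw [hqN]; ring
        _ ≤ q * N' * |(k : ℝ) - j| + h' * N' := by gcongr
        _ = _ := by ring
    rw [hν]
    have := mul_le_mul_of_nonneg_left h3
      (show 0 ≤ W * arcMass a q j * ((1 - ε) * c₃) from
        mul_nonneg (mul_nonneg hW0.le (arcMass_nonneg a q j)) (by positivity))
    linarith

end LowerSubcriticalPath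

section UpperSubcriticalPath

variable {lam dd : V → V → ℝ} {P : V → Measure (ℕ → V)} {α ν c₃ C₃ c C : ℝ}
variable [Countable V] [MeasurableSingletonClass V]

lemma card_filter_dist_lt_le (s : Finset ℕ) (A i : ℕ) :
    (s.filter fun k => Nat.dist k i < A).card ≤ 2 * A := by
  calc _ ≤ (Finset.Ico (i + 1 - A) (i + A)).card := by
        refine Finset.card_le_card fun k hk => ?_
        rw [Finset.mem_filter, Nat.dist] at hk
        rw [Finset.mem_Ico]; omega
    _ ≤ 2 * A := by rw [Nat.card_Ico]; omega

lemma upper_coef_le {η ε : ℝ} (hε : ε = η / 10) (hη0 : 0 < η) (hη : η ≤ 1 / 4) :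
    (1 + ε) / (1 - ε) ^ 2 + ε ≤ (1 + η) * (1 - ε) := by
  have h1 : 0 < 1 - ε := by linarith
  have h0 : 0 < ε := by linarith
  rw [div_add' _ _ _ (by positivity), div_le_iff₀ (by positivity)]
  have h2 : (1 - ε) ^ 2 ≤ 1 := by nlinarith
  have h3 : 1 - 3 * ε ≤ (1 - ε) ^ 3 := by nlinarith [pow_pos h0 3, sq_nonneg ε]
  have h4 : ε * (1 - ε) ^ 2 ≤ ε := mul_le_of_le_one_right h0.le h2
  have h5 : (1 + η) * (1 - 3 * ε) ≤ (1 + η) * (1 - ε) ^ 3 := by gcongr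
  have h6 : 1 + 2 * ε ≤ (1 + η) * (1 - 3 * ε) := by
    rw [hε]; nlinarith
  linarith

/-- For `ν < 1` the capacity of the range is almost surely bounded below by that of a segment. -/
lemma Standing.exists_capa_visited_ge (h : Standing lam dd P α ν c₃ C₃)
    (hb : Bounds lam dd P α ν c C) (hν1 : ν < 1) {η : ℝ} (hη0 : 0 < η) (hη : η ≤ 1 / 4) :
    ∃ N₀ : ℝ, 0 < N₀ ∧ ∀ N, N₀ ≤ N → ∀ x, ∀ᵐ ω ∂(P x),
      kappaNu ν / C₃ / (1 + η) * N ^ ν ≤ capa lam P (visited (vball dd x N) ω) := by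
  have hν0 := h.nu_pos
  have hC := hb.C_pos
  have hC₃ : 0 < C₃ := h.c₃_pos.trans_le h.c₃_le_C₃
  set a := (1 - ν) / 2 with ha
  have ha0 : 0 < a := by rw [ha]; linarith
  have ha1 : a < 1 / 2 := by rw [ha]; linarith
  have hν : 2 * a - 1 = -ν := by rw [ha]; ring
  have hν' : 1 - 2 * a = ν := by linarith
  have hsin : 0 < Real.sin (Real.pi * a) := sin_half_pos hν0 hν1
  have hQ : 0 < Real.pi / Real.sin (Real.pi * a) := div_pos Real.pi_pos hsin
  have hκ := kappaNu_pos hν0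
  have hκeq := kappaNu_eq hν1
  rw [← ha] at hκeq
  set ε := η / 10 with hε
  have hε0 : 0 < ε := by positivity
  have hε1 : ε ≤ 1 / 40 := by linarith
  have h1ε : 0 < 1 - ε := by linarith
  obtain ⟨D, hD, hgreen⟩ := h.exists_green_le hε0
  obtain ⟨B, hB, hmass⟩ := exists_arcMass_le ha0 ha1
  set L : ℝ := C / ε + D / (1 - ε) with hL
  have hLC : C ≤ ε * L := by
    have : 0 < ε * (D / (1 - ε)) := by positivity
    have h2 : ε * (C / ε) = C := by field_simp
    rw [hL, mul_add, h2]; linarith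
  have hLD : D ≤ (1 - ε) * L := by
    have : 0 < (1 - ε) * (C / ε) := by positivity
    have h2 : (1 - ε) * (D / (1 - ε)) = D := by field_simp
    rw [hL, mul_add, h2]; linarith
  have hL0 : 0 < L := by positivity
  set A : ℕ := ⌈1 / ε⌉₊ with hA
  have hA1 : 1 ≤ A := Nat.one_le_ceil_iff.2 (by positivity)
  have hεA : 1 ≤ ε * (A + 1) := by
    have := Nat.le_ceil (1 / ε)
    rw [div_le_iff₀ hε0] at this
    linarith
  set X : ℝ := C * (2 * A * B) / (ε * (C₃ * L ^ (-ν) * (Real.pi / Real.sin (Real.pi * a)))) with hX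
  have hX0 : 0 ≤ X := by positivity
  set m₀ : ℝ := X ^ (1 / (2 * a ^ 2)) with hm₀
  have hm₀0 : 0 ≤ m₀ := by positivity
  refine ⟨L * (m₀ + 2) / ε, by positivity, fun N hN x => ?_⟩
  have hNL : L * (m₀ + 2) ≤ N * ε := by rwa [div_le_iff₀ hε0] at hN
  have hN0 : 0 < N := lt_of_lt_of_le (by positivity) hN
  have hN1 : L * (m₀ + 2) ≤ N := hNL.trans (mul_le_of_le_one_right hN0.le (by linarith))
  filter_upwards [h.ae_regular hb x] with ω ⟨h0, hnn, hre⟩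
  set M : ℕ := ⌊N / L⌋₊ with hM
  have hMle : (M : ℝ) * L ≤ N := by
    have := Nat.floor_le (show 0 ≤ N / L by positivity)
    rwa [le_div_iff₀ hL0] at this
  have hMge : N ≤ (M + 1) * L := by
    have := Nat.lt_floor_add_one (N / L)
    rw [div_lt_iff₀ hL0] at this; exact this.le
  have hMm : m₀ + 1 ≤ M := by
    have : (m₀ + 2) * L ≤ (M + 1) * L := by linarith
    have := le_of_mul_le_mul_right this hL0
    linarith
  have hM1 : (1 : ℝ) ≤ M := by linarith
  have hM0 : (0 : ℝ) < M := by linarith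
  have hMN : (1 - ε) * N ≤ M * L := by
    have : 0 ≤ L * m₀ := by positivity
    linarith
  set q : ℝ := 1 / M with hq
  have hq0 : 0 < q := by positivity
  have hqM : q * M = 1 := by rw [hq]; field_simp
  have hq1 : q ≤ 1 := by rw [hq, div_le_one hM0]; exact hM1
  set y : ℕ → V := fun k => eshift dd x (k * L) ω 0 with hy
  have hmem : ∀ k : ℕ, y k ∈ pieceAt dd x 0 (k * L) ω := fun k =>
    ⟨0, fun n hn => by
      rw [Nat.le_zero.1 hn]
      simp only [vball, Set.mem_ofPred_eq, h.dd_self, le_refl], rfl⟩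
  set Y : ℝ := C₃ * L ^ (-ν) * (Real.pi / Real.sin (Real.pi * a)) with hY
  have hY0 : 0 < Y := by positivity
  have hqX : X * q ^ (2 * a ^ 2) ≤ 1 := by
    have h1 : X ≤ M ^ (2 * a ^ 2) := by
      calc X = m₀ ^ (2 * a ^ 2) := by
            rw [hm₀, ← Real.rpow_mul hX0, one_div_mul_cancel (by positivity), Real.rpow_one]
        _ ≤ _ := by gcongr; linarith
    calc X * q ^ (2 * a ^ 2) ≤ M ^ (2 * a ^ 2) * q ^ (2 * a ^ 2) := by gcongr
      _ = 1 := by rw [← Real.mul_rpow hM0.le hq0.le, mul_comm, hqM, Real.one_rpow]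
  have hcap := h.sum_le_mul_capa (A := visited (vball dd x N) ω)
    (hb.visited_finite x N ω) (Finset.range M) (arcMass a q) y
    (b := q ^ ν * Y * ((1 + ε) / (1 - ε) ^ 2 + ε)) (fun k hk => ?_) (by positivity) fun i hi => ?_
  · rw [sum_arcMass (by linarith) hq0 hqM.ge] at hcap
    have h3 : ProbabilityTheory.beta (1 - a) (1 - a) =
        kappaNu ν * (Real.pi / Real.sin (Real.pi * a)) := by rw [hκeq, div_mul_cancel₀ _ hQ.ne']
    have hqν : 0 < q ^ ν := by positivity
    have hcoef := upper_coef_le hε hη0 hη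
    have hcap0 : 0 ≤ capa lam P (visited (vball dd x N) ω) := h.capa_nonneg _
    have h4 : q ^ ν * L ^ (-ν) * ((1 - ε) * N ^ ν) ≤ 1 := by
      have h5 : (1 - ε) * N ^ ν ≤ (M * L) ^ ν := by
        calc (1 - ε) * N ^ ν ≤ (1 - ε) ^ ν * N ^ ν := by
              gcongr
              calc 1 - ε = (1 - ε) ^ (1 : ℝ) := (Real.rpow_one _).symm
                _ ≤ _ := Real.rpow_le_rpow_of_exponent_ge h1ε (by linarith) hν1.le
          _ = ((1 - ε) * N) ^ ν := (Real.mul_rpow h1ε.le hN0.le).symm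
          _ ≤ _ := by gcongr
      calc q ^ ν * L ^ (-ν) * ((1 - ε) * N ^ ν) ≤ q ^ ν * L ^ (-ν) * (M * L) ^ ν := by gcongr
        _ = (q * M) ^ ν * (L ^ (-ν) * L ^ ν) := by
            rw [Real.mul_rpow hM0.le hL0.le, Real.mul_rpow hq0.le hM0.le]; ring
        _ = 1 := by rw [hqM, ← Real.rpow_add hL0, neg_add_cancel, Real.rpow_zero, Real.one_rpow,
                      one_mul]
    have h6 : kappaNu ν ≤ q ^ ν * (C₃ * L ^ (-ν)) * ((1 + η) * (1 - ε)) *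
        capa lam P (visited (vball dd x N) ω) := by
      refine le_of_mul_le_mul_right ?_ hQ
      rw [← h3]
      refine hcap.trans (le_of_le_of_eq (mul_le_mul_of_nonneg_right
        (mul_le_mul_of_nonneg_left hcoef (by positivity)) hcap0) ?_)
      rw [hY]; ring
    rw [div_div, div_mul_eq_mul_div, div_le_iff₀ (by positivity)]
    calc kappaNu ν * N ^ ν ≤ q ^ ν * (C₃ * L ^ (-ν)) * ((1 + η) * (1 - ε)) *
          capa lam P (visited (vball dd x N) ω) * N ^ ν := by gcongr
      _ = q ^ ν * L ^ (-ν) * ((1 - ε) * N ^ ν) *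
          (capa lam P (visited (vball dd x N) ω) * (C₃ * (1 + η))) := by ring
      _ ≤ 1 * (capa lam P (visited (vball dd x N) ω) * (C₃ * (1 + η))) := by gcongr
      _ = _ := one_mul _
  · rw [Finset.mem_range] at hk
    refine pieceAt_subset h hb (by positivity) le_rfl ?_ h0 hnn (hre _) (hmem k)
    have h1 : (k : ℝ) + 1 ≤ M := by exact_mod_cast hk
    have h2 : ((k : ℝ) + 1) * L ≤ M * L := by gcongr
    have h3 : ε * L ≤ L := mul_le_of_le_one_left hL0.le (by linarith)
    linarith
  · rw [Finset.mem_range] at hi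
    have hi' : q * i ≤ 1 := by
      rw [← hqM]; gcongr
    rw [← Finset.sum_filter_add_sum_filter_not (Finset.range M) (fun k => A ≤ Nat.dist k i)]
    have hfar : ∑ k ∈ (Finset.range M).filter (fun k => A ≤ Nat.dist k i),
        arcMass a q k * green lam P (y i) (y k) ≤ q ^ ν * Y * ((1 + ε) / (1 - ε) ^ 2) := by
      have h1 := sum_arcMass_far_le (n := M) ha0 ha1 (show ε < 1 by linarith) hq0 hA1 hεA hi'
      calc _ ≤ ∑ k ∈ (Finset.range M).filter (fun k => A ≤ Nat.dist k i),
            (1 + ε) * C₃ * L ^ (-ν) * (1 - ε) ^ (-ν) * q ^ ν *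
              (arcMass a q k * (q * |(i : ℝ) - k|) ^ (2 * a - 1)) := by
            refine Finset.sum_le_sum fun k hk => ?_
            rw [Finset.mem_filter] at hk
            have hd : (1 : ℝ) ≤ |(i : ℝ) - k| := by
              rw [abs_sub_comm, ← cast_dist]; exact_mod_cast hA1.trans hk.2
            have hdist := dist_pieceAt h hb h0 hnn hre hL0.le (hmem i) (hmem k)
            have h2 := hgreen (y i) (y k) (|(i : ℝ) - k| * ((1 - ε) * L)) ?_ ?_
            · rw [Real.mul_rpow (by positivity) (by positivity), Real.mul_rpow h1ε.le hL0.le] at h2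
              have h3 := mul_le_mul_of_nonneg_left h2 (arcMass_nonneg a q k)
              refine h3.trans (le_of_eq ?_)
              rw [hν, Real.mul_rpow hq0.le (by positivity), Real.rpow_neg hq0.le]
              field_simp
            · exact hLD.trans (le_mul_of_one_le_left (by positivity) hd)
            · refine le_trans ?_ hdist
              have : ε * L ≤ |(i : ℝ) - k| * (ε * L) := le_mul_of_one_le_left (by positivity) hd
              linarith
        _ ≤ (1 + ε) * C₃ * L ^ (-ν) * (1 - ε) ^ (-ν) * q ^ ν *
            ((1 - ε) ^ (2 * a - 1) * (Real.pi / Real.sin (Real.pi * a))) := by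
            rw [← Finset.mul_sum]
            gcongr
        _ = q ^ ν * Y * (1 + ε) * ((1 - ε) ^ (-ν) * (1 - ε) ^ (-ν)) := by rw [hν, hY]; ring
        _ ≤ q ^ ν * Y * (1 + ε) * (1 - ε) ^ (-2 : ℝ) := by
            rw [← Real.rpow_add h1ε]
            exact mul_le_mul_of_nonneg_left
              (Real.rpow_le_rpow_of_exponent_ge h1ε (by linarith) (by linarith)) (by positivity)
        _ = _ := by rw [Real.rpow_neg h1ε.le, Real.rpow_two]; ring
    have hnear : ∑ k ∈ (Finset.range M).filter (fun k => ¬ A ≤ Nat.dist k i),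
        arcMass a q k * green lam P (y i) (y k) ≤ q ^ ν * Y * ε := by
      simp only [not_le]
      calc _ ≤ ∑ k ∈ (Finset.range M).filter (fun k => Nat.dist k i < A),
            B * q ^ (1 - 2 * a + 2 * a ^ 2) * C := by
            refine Finset.sum_le_sum fun k _ => ?_
            exact mul_le_mul (hmass q hq0 hq1 k) (hb.green_le_C h _ _) (h.green_pos _ _).le
              (by positivity)
        _ ≤ 2 * A * (B * q ^ (1 - 2 * a + 2 * a ^ 2) * C) := by
            rw [Finset.sum_const, nsmul_eq_mul]
            gcongr
            exact_mod_cast card_filter_dist_lt_le _ _ _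
        _ = q ^ ν * Y * ε * (X * q ^ (2 * a ^ 2)) := by
            rw [Real.rpow_add hq0, hν', hX]; field_simp
        _ ≤ _ := mul_le_of_le_one_right (by positivity) hqX
    calc _ ≤ q ^ ν * Y * ((1 + ε) / (1 - ε) ^ 2) + q ^ ν * Y * ε := add_le_add hfar hnear
      _ = _ := by ring

lemma Standing.upper_of_lt_one (h : Standing lam dd P α ν c₃ C₃) (hb : Bounds lam dd P α ν c C)
    (hν1 : ν < 1) {u₀ η : ℝ} (hu₀ : 0 < u₀) (hη0 : 0 < η) (hη : η ≤ 1 / 4) :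
    ∃ C' : ℝ, 0 < C' ∧ ∀ u, 0 < u → u ≤ u₀ → ∀ N, 0 < N → C' ≤ N ^ ν * u → ∀ x,
      ∫⁻ ω, ENNReal.ofReal (Real.exp (-u * capa lam P (visited (vball dd x N) ω))) ∂(P x) ≤
        ENNReal.ofReal (Real.exp (-(kappaNu ν / C₃ / (1 + η) * (N ^ ν * u)))) := by
  obtain ⟨N₀, hN₀, hcap⟩ := h.exists_capa_visited_ge hb hν1 hη0 hη
  have hν0 := h.nu_pos
  refine ⟨u₀ * N₀ ^ ν, by positivity, fun u hu huu N hN0 hN x => ?_⟩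
  have := h.prob x
  have hNN : N₀ ≤ N := by
    have h2 : N ^ ν * u ≤ u₀ * N ^ ν := by rw [mul_comm]; gcongr
    have h3 := le_of_mul_le_mul_left (hN.trans h2) hu₀
    rwa [Real.rpow_le_rpow_iff hN₀.le hN0.le hν0] at h3
  calc _ ≤ ∫⁻ _, ENNReal.ofReal (Real.exp (-(kappaNu ν / C₃ / (1 + η) * (N ^ ν * u)))) ∂(P x) := by
        refine lintegral_mono_ae ?_
        filter_upwards [hcap N hNN x] with ω hω
        refine ENNReal.ofReal_le_ofReal (Real.exp_le_exp.2 ?_)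
        have := mul_le_mul_of_nonneg_left hω hu.le
        linarith
    _ = _ := by simp

end UpperSubcriticalPath

lemma Standing.ofReal_integral_exp_capa {lam dd : V → V → ℝ} {P : V → Measure (ℕ → V)}
    {α ν c₃ C₃ : ℝ} [Countable V] [MeasurableSingletonClass V]
    (h : Standing lam dd P α ν c₃ C₃) {A : Set V} (hA : A.Finite)
    {u : ℝ} (hu : 0 < u) (x : V) :
    ENNReal.ofReal (∫ ω, Real.exp (-u * capa lam P (visited A ω)) ∂(P x)) =
      ∫⁻ ω, ENNReal.ofReal (Real.exp (-u * capa lam P (visited A ω))) ∂(P x) := by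
  have := h.prob x
  refine ofReal_integral_eq_lintegral_ofReal ?_ (ae_of_all _ fun ω => (Real.exp_pos _).le)
  refine Integrable.of_bound
    (measurable_visited hA fun S => Real.exp (-u * capa lam P S)).aestronglyMeasurable 1
    (ae_of_all _ fun ω => ?_)
  rw [Real.norm_of_nonneg (Real.exp_pos _).le, Real.exp_le_one_iff]
  have := mul_nonneg hu.le (h.capa_nonneg (visited A ω))
  linarith

lemma Fnu1_of_lt_one {ν N u : ℝ} (hν0 : 0 < ν) (hν : ν < 1) (hN : 0 ≤ N) (hu : 0 < u) :
    Fnu1 ν (N * u ^ (1 / ν)) = N ^ ν * u := by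
  rw [Fnu1, Fnu, if_pos hν, Real.mul_rpow hN (by positivity), ← Real.rpow_mul hu.le,
    one_div_mul_cancel hν0.ne', Real.rpow_one]

lemma Fnu1_one (N u : ℝ) :
    Fnu1 1 (N * u ^ (1 / (1 : ℝ))) = N * u / max 1 (Real.log (N * u)) := by
  simp [Fnu1, Fnu]

lemma Fnu1_of_one_lt {ν : ℝ} (hν : 1 < ν) (z : ℝ) : Fnu1 ν z = z := by
  rw [Fnu1, Fnu, if_neg hν.le.not_gt, if_neg hν.ne', Real.one_rpow, mul_one]

lemma le_rpow_mul_of_rpow_mul_rpow_le {ν K N u : ℝ} (hν0 : 0 < ν) (hK : 0 < K) (hu : 0 < u)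
    (hN : K ^ (1 / ν) * u ^ (-(1 / ν)) ≤ N) : K ≤ N ^ ν * u := by
  have h1 := Real.rpow_le_rpow (by positivity) hN hν0.le
  rw [Real.mul_rpow (by positivity) (by positivity), ← Real.rpow_mul hK.le,
    ← Real.rpow_mul hu.le, neg_mul, one_div_mul_cancel hν0.ne', Real.rpow_one,
    Real.rpow_neg_one] at h1
  rwa [← div_eq_mul_inv, div_le_iff₀ hu] at h1

/-- (Lemma `lem:hittinginter`: bounds on the Laplace transform
`E_x[exp(-u·cap(X̄_{B(x,N)}))]`, i.e. on the probability that an independent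
interlacement at level `u` avoids the walk before it exits `B(x,N)`). -/
theorem statement11
    (V : Type) [MeasurableSpace V]
    (lam dd : V → V → ℝ) (P : V → Measure (ℕ → V)) (α ν c₃ C₃ : ℝ)
    (hSt : Standing lam dd P α ν c₃ C₃)
    (hGeo : ∃ c₄ C₄ : ℝ, 0 < c₄ ∧ 0 < C₄ ∧ Geodesic lam dd c₄ C₄) :
    ∀ η u₀ : ℝ, 0 < η → η ≤ 1/4 → 0 < u₀ →
    ∃ C c₆ C₆ : ℝ, 0 < C ∧ 0 < c₆ ∧ 0 < C₆ ∧
      (ν ≤ 1 → c₆ = cBeta ν C₃ ∧ C₆ = CBeta ν c₃) ∧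
      ∀ u : ℝ, 0 < u → u ≤ u₀ → ∀ N : ℝ, C * u ^ (-(1/ν)) ≤ N → ∀ x : V,
        Real.exp (-(C₆ / (1 - η)) * Fnu1 ν (N * u ^ (1/ν)))
          ≤ ∫ ω, Real.exp (-u * capa lam P (visited (vball dd x N) ω)) ∂(P x) ∧
        (2 * ν ≤ α →
          ∫ ω, Real.exp (-u * capa lam P (visited (vball dd x N) ω)) ∂(P x)
            ≤ Real.exp (-(c₆ / (1 + η)) * Fnu1 ν (N * u ^ (1/ν)) *
                (max 1 (Real.log (1/u))) ^ (-(if α = 2 * ν then (1:ℝ) else 0)))) ∧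
        (α < 2 * ν →
          ∫ ω, Real.exp (-u * capa lam P (visited (vball dd x N) ω)) ∂(P x)
            ≤ Real.exp (-(c₆ * N * u ^ ((1 - α + 2 * ν) / ν)))) := by
  intro η u₀ hη0 hη hu₀
  obtain ⟨c₄, C₄, hc₄, hC₄, hgeo⟩ := hGeo
  have := hSt.countable
  have := hSt.measurableSingletonClass
  obtain ⟨c, C, hb⟩ := hSt.exists_bounds
  have hν0 := hSt.nu_pos
  have hνα := hSt.nu_le
  have hη1 : 0 < 1 - η := by linarith
  have lower_iff {u : ℝ} (hu : 0 < u) (N : ℝ) (x : V) {b : ℝ} :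
      Real.exp b ≤ ∫ ω, Real.exp (-u * capa lam P (visited (vball dd x N) ω)) ∂(P x) ↔
        ENNReal.ofReal (Real.exp b) ≤
          ∫⁻ ω, ENNReal.ofReal (Real.exp (-u * capa lam P (visited (vball dd x N) ω))) ∂(P x) := by
    rw [← hSt.ofReal_integral_exp_capa (hb.finite x N) hu, ENNReal.ofReal_le_ofReal_iff
      (integral_nonneg fun ω => (Real.exp_pos _).le)]
  have upper_iff {u : ℝ} (hu : 0 < u) (N : ℝ) (x : V) {b : ℝ} :
      ∫ ω, Real.exp (-u * capa lam P (visited (vball dd x N) ω)) ∂(P x) ≤ Real.exp b ↔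
        ∫⁻ ω, ENNReal.ofReal (Real.exp (-u * capa lam P (visited (vball dd x N) ω))) ∂(P x) ≤
          ENNReal.ofReal (Real.exp b) := by
    rw [← hSt.ofReal_integral_exp_capa (hb.finite x N) hu, ENNReal.ofReal_le_ofReal_iff
      (Real.exp_pos _).le]
  have hβ : 0 < cBeta ν C₃ := div_pos (kappaNu_pos hν0) (hSt.c₃_pos.trans_le hSt.c₃_le_C₃)
  have hβ' : 0 < CBeta ν c₃ := div_pos (kappaNu_pos hν0) hSt.c₃_pos
  rcases lt_trichotomy ν 1 with hν | hν | hν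
  · obtain ⟨K₁, hK₁, lower⟩ := hSt.lower_of_lt_one hb hc₄ hC₄ hgeo hν hu₀ hη0 hη
    obtain ⟨K₂, hK₂, upper⟩ := hSt.upper_of_lt_one hb hν hu₀ hη0 hη
    have hK : 0 < max K₁ K₂ := lt_max_of_lt_left hK₁
    refine ⟨(max K₁ K₂) ^ (1 / ν), _, _, by positivity, hβ, hβ', fun _ => ⟨rfl, rfl⟩,
      fun u hu huu N hN x => ?_⟩
    have hN0 : 0 < N := lt_of_lt_of_le (by positivity) hN
    have hNK := le_rpow_mul_of_rpow_mul_rpow_le hν0 hK hu hN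
    rw [Fnu1_of_lt_one hν0 hν hN0.le hu, if_neg (by linarith), neg_zero, Real.rpow_zero, mul_one,
      lower_iff hu, upper_iff hu]
    refine ⟨?_, fun _ => ?_, fun _ => by linarith⟩
    · simpa [CBeta] using lower u hu huu N hN0 ((le_max_left _ _).trans hNK) x
    · simpa [cBeta] using upper u hu huu N hN0 ((le_max_right _ _).trans hNK) x
  · obtain ⟨K₁, hK₁, lower⟩ := hSt.lower_of_eq_one hb hc₄ hC₄ hgeo hν hu₀ hη0 hη
    obtain ⟨K₂, hK₂, upper⟩ := hSt.upper_of_eq_one hb hν hη0 hη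
    refine ⟨max K₁ K₂, _, _, lt_max_of_lt_left hK₁, hβ, hβ', fun _ => ⟨rfl, rfl⟩,
      fun u hu huu N hN x => ?_⟩
    subst hν
    have hNK : max K₁ K₂ ≤ N * u := by
      rwa [div_one, Real.rpow_neg_one, ← div_eq_mul_inv, div_le_iff₀ hu] at hN
    rw [Fnu1_one, if_neg (by linarith), neg_zero, Real.rpow_zero, mul_one,
      lower_iff hu, upper_iff hu]
    refine ⟨?_, fun _ => ?_, fun _ => by linarith⟩
    · simpa [CBeta, kappaNu] using lower u hu huu N ((le_max_left _ _).trans hNK) x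
    · simpa [cBeta, kappaNu] using upper u hu huu N ((le_max_right _ _).trans hNK) x
  · obtain ⟨K₁, C₆, hK₁, hC₆, lower⟩ := hSt.lower_of_one_lt hb hc₄ hC₄ hgeo hu₀
    obtain ⟨K₂, c₆, hK₂, hc₆, upper⟩ := hSt.upper_of_one_lt hb hν hu₀
    refine ⟨max K₁ K₂, c₆, C₆, lt_max_of_lt_left hK₁, hc₆, hC₆, fun h => by linarith,
      fun u hu huu N hN x => ?_⟩
    have hN₁ : K₁ * u ^ (-(1 / ν)) ≤ N := le_trans (by gcongr; exact le_max_left _ _) hN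
    have hN₂ : K₂ * u ^ (-(1 / ν)) ≤ N := le_trans (by gcongr; exact le_max_right _ _) hN
    have hN0 : 0 < N := lt_of_lt_of_le (by positivity) hN₁
    obtain ⟨upper₁, upper₂, upper₃⟩ := upper u hu huu N hN₂ x
    rw [Fnu1_of_one_lt hν, lower_iff hu, upper_iff hu, upper_iff hu]
    have hc₆' : c₆ / (1 + η) ≤ c₆ := div_le_self hc₆.le (by linarith)
    refine ⟨(ENNReal.ofReal_le_ofReal (Real.exp_le_exp.2 ?_)).trans (lower u hu huu N hN₁ x),
      fun hα => ?_, fun hα => by simpa only [mul_assoc] using upper₃ hα⟩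
    · rw [neg_mul, neg_le_neg_iff]
      gcongr
      exact le_div_self hC₆.le hη1 (by linarith)
    · split_ifs with hα'
      · refine (upper₂ hα').trans (ENNReal.ofReal_le_ofReal (Real.exp_le_exp.2 ?_))
        rw [Real.rpow_neg_one, ← div_eq_mul_inv, neg_mul, neg_div, neg_le_neg_iff, mul_div_assoc]
        gcongr
      · refine (upper₁ (lt_of_le_of_ne hα (Ne.symm hα'))).trans
          (ENNReal.ofReal_le_ofReal (Real.exp_le_exp.2 ?_))
        rw [neg_zero, Real.rpow_zero, mul_one, neg_mul, neg_le_neg_iff]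
        gcongr

end Paper
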